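/- arXiv:1511.00546 — 2 statements merged into one kernel-verified Lean document; each statement's English description precedes it below -/
import Mathlib

section
/- Assume ((a+b)/2)·Φ^(2) ≥ 1 and (a-b)²·Φ^(2) ≤ 2(a+b). Let G be an instance of the DC-PPM on n vertices and let u and v be independently uniformly chosen vertices of G. Then P(σ_u = + | σ_v, G) converges to 1/2 in probability as n → ∞. -/
noncomputable section

/-- The factor `ψ_u ψ_v / n · (a·1[τ_u = τ_v] + b·1[τ_u ≠ τ_v])`, the conditional probability
of an edge between `u` and `v` in the Degree-Corrected Planted-Partition Model. -/
def edgeProb (a b : ℝ) (n : ℕ) (τ : Fin n → Bool) (ψ : Fin n → ℝ) (u v : Fin n) : ℝ :=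
  ψ u * ψ v / n * (if τ u = τ v then a else b)

/-- The set of (ordered representatives of) unordered pairs of distinct vertices. -/
def vertexPairs (n : ℕ) : Finset (Fin n × Fin n) :=
  Finset.univ.filter fun p => p.1 < p.2

/-- The density, with respect to `(uniform spins) ⊗ ν^{⊗ n}`, of observing the graph `g`
together with spins `τ` and weights `ψ` in the DC-PPM. -/
def configDensity (a b : ℝ) (n : ℕ) (g : Fin n → Fin n → Bool) (τ : Fin n → Bool)
    (ψ : Fin n → ℝ) : ℝ :=
  (1 / 2 ^ n) * ∏ p ∈ vertexPairs n,
    (if g p.1 p.2 then edgeProb a b n τ ψ p.1 p.2 else 1 - edgeProb a b n τ ψ p.1 p.2)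

/-- `(P, spin, wt, adj)` is a Degree-Corrected Planted-Partition Model on `n` vertices, with
parameters `a, b` and weight law `ν`: spins are i.i.d. uniform on `{+,-}`, weights are i.i.d.
with law `ν`, and conditionally on spins and weights distinct vertices `u, v` are joined
independently by an edge with probability `(ψ_u ψ_v / n)·a` if they carry the same spin, and
`(ψ_u ψ_v / n)·b` otherwise. -/
def IsDCPPM (a b : ℝ) (ν : MeasureTheory.Measure ℝ) (n : ℕ) {Ω : Type}
    [MeasurableSpace Ω] (P : MeasureTheory.Measure Ω) (spin : Ω → Fin n → Bool)
    (wt : Ω → Fin n → ℝ) (adj : Ω → Fin n → Fin n → Bool) : Prop :=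
  MeasureTheory.IsProbabilityMeasure P ∧
  Measurable spin ∧ Measurable wt ∧ Measurable adj ∧
  (∀ ω u v, adj ω u v = adj ω v u) ∧ (∀ ω u, adj ω u u = false) ∧
  ∀ (τ : Fin n → Bool) (g : Fin n → Fin n → Bool),
    (∀ u v, g u v = g v u) → (∀ u, g u u = false) →
    ∀ B : Set (Fin n → ℝ), MeasurableSet B →
      P {ω | spin ω = τ ∧ adj ω = g ∧ wt ω ∈ B}
        = ∫⁻ ψ in B, ENNReal.ofReal (configDensity a b n g τ ψ)
            ∂(MeasureTheory.Measure.pi fun _ : Fin n => ν)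

open MeasureTheory ProbabilityTheory Filter Topology


namespace DCP

lemma cosh_bd (x B : ℝ) (h : |x| ≤ B) :
    Real.cosh x ≤ Real.exp (x ^ 2 / 2 - Real.exp (-(B ^ 2 / 2)) / 16 * x ^ 4) := by
  have h1 : Real.cosh x = Real.cosh (x / 2) ^ 4 - Real.sinh (x / 2) ^ 4 := by
    have e1 : x = 2 * (x / 2) := by ring
    have e2 := Real.cosh_sq (x / 2)
    rw [e1, Real.cosh_two_mul]
    have e3 : 2 * (x / 2) / 2 = x / 2 := by ring
    rw [e3]
    have : Real.cosh (x/2) ^ 4 = (Real.cosh (x/2) ^ 2) ^ 2 := by ring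
    rw [this, e2]; ring
  have h2 : Real.cosh (x / 2) ^ 4 ≤ Real.exp (x ^ 2 / 2) := by
    have := Real.cosh_le_exp_half_sq (x / 2)
    have h3 : Real.exp (x ^ 2 / 2) = Real.exp ((x / 2) ^ 2 / 2) ^ 4 := by
      rw [← Real.exp_nat_mul]; congr 1; push_cast; ring
    rw [h3]
    exact pow_le_pow_left₀ (Real.cosh_pos _).le this 4
  have h3 : x ^ 4 / 16 ≤ Real.sinh (x / 2) ^ 4 := by
    have h4 : |x / 2| ≤ |Real.sinh (x / 2)| := by
      rw [Real.abs_sinh]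
      exact Real.self_le_sinh_iff.mpr (abs_nonneg _)
    have := pow_le_pow_left₀ (abs_nonneg _) h4 4
    rw [← abs_pow, ← abs_pow, abs_of_nonneg (by positivity), abs_of_nonneg (by positivity)] at this
    calc x ^ 4 / 16 = (x / 2) ^ 4 := by ring
      _ ≤ _ := this
  have hB : x ^ 2 ≤ B ^ 2 := by
    rw [← sq_abs x]; exact pow_le_pow_left₀ (abs_nonneg _) h 2
  rw [Real.exp_sub, h1, le_div_iff₀ (Real.exp_pos _)]
  set c := Real.exp (-(B ^ 2 / 2)) / 16 * x ^ 4 with hc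
  have h5 : c ≤ Real.exp (-(x ^ 2 / 2)) * (x ^ 4 / 16) := by
    rw [hc]
    have : Real.exp (-(B ^ 2 / 2)) ≤ Real.exp (-(x ^ 2 / 2)) := by
      apply Real.exp_le_exp.mpr; linarith
    have h4 : 0 ≤ x ^ 4 / 16 := by positivity
    nlinarith
  have h6 : Real.exp (x^2/2) * c ≤ x ^ 4 / 16 := by
    have := mul_le_mul_of_nonneg_left h5 (Real.exp_pos (x^2/2)).le
    rwa [← mul_assoc _ (Real.exp (-(x^2/2))), ← Real.exp_add, add_neg_cancel, Real.exp_zero, one_mul] at this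
  have h7 : Real.cosh (x / 2) ^ 4 - Real.sinh (x / 2) ^ 4 ≤ Real.exp (x^2/2) * (1 - c) := by
    linarith
  have h8 : 1 - c ≤ Real.exp (-c) := by
    have := Real.add_one_le_exp (-c); linarith
  calc _ ≤ Real.exp (x^2/2) * Real.exp (-c) * Real.exp c := by
        apply mul_le_mul_of_nonneg_right _ (Real.exp_pos _).le
        exact h7.trans (mul_le_mul_of_nonneg_left h8 (Real.exp_pos _).le)
    _ = _ := by rw [mul_assoc, ← Real.exp_add]; simp

lemma exp_disc (μ : ℝ) (N : ℕ) (h : |μ| ≤ N) :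
    Real.exp (μ ^ 2 / 2) ≤ Real.exp (1 / 2) *
      ∑ k ∈ Finset.Icc (-(N : ℤ)) N, Real.exp (k * μ - (k : ℝ) ^ 2 / 2) := by
  obtain ⟨h1, h2⟩ := abs_le.mp h
  have hk : ⌊μ⌋ ∈ Finset.Icc (-(N : ℤ)) N := by
    rw [Finset.mem_Icc]
    constructor
    · rw [Int.le_floor]; push_cast; exact h1
    · have := (Int.floor_le μ).trans h2
      exact_mod_cast this
  have := Finset.single_le_sum (f := fun k : ℤ => Real.exp (k * μ - (k : ℝ) ^ 2 / 2))
    (fun i _ => (Real.exp_pos _).le) hk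
  refine le_trans ?_ (mul_le_mul_of_nonneg_left this (Real.exp_pos _).le)
  rw [← Real.exp_add]
  apply Real.exp_le_exp.mpr
  have h3 := Int.floor_le μ
  have h4 := Int.lt_floor_add_one μ
  nlinarith

/-- sign of a spin -/
def sg (b : Bool) : ℝ := if b then 1 else -1

lemma sg_mul_self (b : Bool) : sg b * sg b = 1 := by cases b <;> simp [sg]

/-- weighted overlap -/
def ovl {n : ℕ} (ψ : Fin n → ℝ) (τ τ' : Fin n → Bool) : ℝ := ∑ u, ψ u * (sg (τ u) * sg (τ' u))

lemma sum_exp_ovl {n : ℕ} (ψ : Fin n → ℝ) (t : ℝ) :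
    ∑ τ : Fin n → Bool, ∑ τ' : Fin n → Bool, Real.exp (t * ovl ψ τ τ')
      = 4 ^ n * ∏ u, Real.cosh (t * ψ u) := by
  have h : ∀ τ : Fin n → Bool, ∑ τ' : Fin n → Bool, Real.exp (t * ovl ψ τ τ')
      = 2 ^ n * ∏ u, Real.cosh (t * ψ u) := by
    intro τ
    have h1 : ∀ τ' : Fin n → Bool, Real.exp (t * ovl ψ τ τ')
        = ∏ u, Real.exp (t * (ψ u * (sg (τ u) * sg (τ' u)))) := by
      intro τ'
      rw [← Real.exp_sum, ovl, Finset.mul_sum]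
    simp_rw [h1]
    rw [← Fintype.piFinset_univ,
      ← Finset.prod_univ_sum (fun _ => Finset.univ) (fun u b => Real.exp (t * (ψ u * (sg (τ u) * sg b))))]
    have h2 : ∀ u, ∑ b, Real.exp (t * (ψ u * (sg (τ u) * sg b))) = 2 * Real.cosh (t * ψ u) := by
      intro u
      rw [Fintype.sum_bool, Real.cosh_eq]
      cases τ u <;> simp [sg] <;> ring
    simp_rw [h2, Finset.prod_mul_distrib]
    simp
  simp_rw [h]
  simp
  rw [← mul_assoc, ← mul_pow]; norm_num

lemma ovl_abs {n : ℕ} (ψ : Fin n → ℝ) (M : ℝ) (h : ∀ u, |ψ u| ≤ M) (τ τ' : Fin n → Bool) :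
    |ovl ψ τ τ'| ≤ n * M := by
  unfold ovl
  refine (Finset.abs_sum_le_sum_abs _ _).trans ?_
  have : ∀ u ∈ Finset.univ, |ψ u * (sg (τ u) * sg (τ' u))| ≤ M := by
    intro u _
    rw [abs_mul]
    have : |sg (τ u) * sg (τ' u)| = 1 := by
      cases τ u <;> cases τ' u <;> simp [sg]
    rw [this, mul_one]; exact h u
  refine (Finset.sum_le_sum this).trans ?_
  simp

lemma summ_int (a : ℝ) (ha : 0 < a) : Summable (fun k : ℤ => 1 / (a + (k : ℝ) ^ 2)) := by
  have h0 : Summable (fun k : ℤ => 1 / (k : ℝ) ^ 2) := by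
    have := Real.summable_one_div_int_pow (p := 2); simpa using this.mpr (by norm_num)
  rw [← (Equiv.refl ℤ).summable_iff] 
  refine Summable.of_norm_bounded_eventually (g := fun k : ℤ => 1 / (k : ℝ) ^ 2) h0 ?_
  rw [Filter.eventually_cofinite]
  refine (Set.finite_singleton (0:ℤ)).subset ?_
  intro k hk
  by_contra hne
  apply hk
  have : (k : ℝ) ≠ 0 := by exact_mod_cast hne
  have hp : 0 < (k:ℝ)^2 := by positivity
  simp only [Function.comp, Equiv.refl_apply, Real.norm_eq_abs]
  rw [abs_of_nonneg (by positivity)]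
  apply one_div_le_one_div_of_le hp; linarith

/-- the error rate -/
noncomputable def rate (n : ℕ) : ℝ := ∑' k : ℤ, 1 / (Real.sqrt n + (k : ℝ) ^ 2)

lemma rate_tendsto : Tendsto rate atTop (𝓝 0) := by
  have := tendsto_tsum_of_dominated_convergence (𝓕 := atTop)
    (f := fun (n : ℕ) (k : ℤ) => 1 / (Real.sqrt n + (k : ℝ) ^ 2)) (g := fun _ => (0:ℝ))
    (summ_int 1 one_pos) ?_ ?_
  · rw [tsum_zero] at this; exact this
  · intro k
    have h1 : Tendsto (fun n : ℕ => Real.sqrt n + (k : ℝ) ^ 2) atTop atTop := by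
      apply tendsto_atTop_add_const_right
      exact Real.tendsto_sqrt_atTop.comp tendsto_natCast_atTop_atTop
    simp only [one_div]; exact h1.inv_tendsto_atTop
  · filter_upwards [eventually_ge_atTop 1] with n hn k
    have : (1:ℝ) ≤ Real.sqrt n := by
      rw [Real.one_le_sqrt]; exact_mod_cast hn
    rw [Real.norm_eq_abs, abs_of_nonneg (by positivity)]
    apply one_div_le_one_div_of_le (by positivity); linarith

set_option maxHeartbeats 1000000 in
/-- The Curie-Weiss estimate at criticality. -/
lemma cw_bound (φmin φmax κ K : ℝ) (hφmin : 0 < φmin) (hφ : φmin ≤ φmax) (hκ : 0 < κ) (hK : 0 < K) :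
    ∃ C : ℝ, 0 ≤ C ∧ ∀ n : ℕ, 1 ≤ n → ∀ ψ : Fin n → ℝ, (∀ u, ψ u ∈ Set.Icc φmin φmax) →
      κ * ((∑ u, ψ u ^ 2) / n) ≤ 1 + K / Real.sqrt n →
      (1 / 4 ^ n) * ∑ τ : Fin n → Bool, ∑ τ' : Fin n → Bool,
        Real.exp ((κ + K / Real.sqrt n) * ovl ψ τ τ' ^ 2 / (2 * n)) ≤ C * (Real.sqrt n * rate n) := by
  have hφmax : 0 < φmax := hφmin.trans_le hφ
  set A := φmax * Real.sqrt (κ + K) with hA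
  have hApos : 0 < A := by positivity
  set B := (A + 1) * A with hB
  set c := Real.exp (-(B ^ 2 / 2)) / 16 with hc
  have hcpos : 0 < c := by positivity
  set c' := c * (φmin ^ 4 * κ ^ 2) with hc'
  have hc'pos : 0 < c' := by positivity
  set K' := K + K * φmax ^ 2 with hK'
  have hK'pos : 0 < K' := by positivity
  set C₀ := Real.exp ((1 + K' / 2) ^ 2 / (4 * c')) with hC₀
  refine ⟨Real.exp (1/2) * C₀, by positivity, ?_⟩
  intro n hn ψ hψ hgood
  have hn0 : (0:ℝ) < n := by exact_mod_cast hn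
  have hn1 : (1:ℝ) ≤ n := by exact_mod_cast hn
  set w := Real.sqrt n with hw
  have hw1 : 1 ≤ w := by rw [hw, Real.one_le_sqrt]; exact hn1
  have hw0 : 0 < w := by linarith
  have hww : w ^ 2 = n := Real.sq_sqrt hn0.le
  set κ' := κ + K / w with hκ'
  have hκ'pos : 0 < κ' := by positivity
  have hκκ' : κ ≤ κ' := by rw [hκ']; have : 0 < K / w := by positivity
                           linarith
  have hκ'le : κ' ≤ κ + K := by
    have : K / w ≤ K := div_le_self hK.le hw1
    linarith
  set q := Real.sqrt κ' with hq
  have hq0 : 0 < q := Real.sqrt_pos.mpr hκ'pos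
  have hqq : q ^ 2 = κ' := Real.sq_sqrt hκ'pos.le
  have hqA : φmax * q ≤ A := by
    rw [hA]; apply mul_le_mul_of_nonneg_left _ hφmax.le
    exact Real.sqrt_le_sqrt hκ'le
  set N := ⌈A * w⌉₊ with hN
  have hN1 : A * w ≤ N := Nat.le_ceil _
  have hN2 : (N : ℝ) ≤ (A + 1) * w := by
    have := Nat.ceil_lt_add_one (a := A * w) (by positivity)
    nlinarith
  have hS : ∀ τ τ' : Fin n → Bool, |ovl ψ τ τ' * (q / w)| ≤ N := by
    intro τ τ'
    rw [abs_mul, abs_of_pos (show 0 < q / w by positivity)]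
    have h1 := ovl_abs ψ φmax (fun u => by
      rw [abs_of_pos (hφmin.trans_le (hψ u).1)]; exact (hψ u).2) τ τ'
    calc |ovl ψ τ τ'| * (q / w) ≤ n * φmax * (q / w) := mul_le_mul_of_nonneg_right h1 (by positivity)
      _ = w * (φmax * q) := by rw [← hww]; field_simp
      _ ≤ w * A := mul_le_mul_of_nonneg_left hqA hw0.le
      _ ≤ N := by linarith
  have hstep : ∀ τ τ' : Fin n → Bool, Real.exp (κ' * ovl ψ τ τ' ^ 2 / (2 * n))
      ≤ Real.exp (1 / 2) * ∑ k ∈ Finset.Icc (-(N : ℤ)) N,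
        Real.exp (-((k : ℝ) ^ 2 / 2)) * Real.exp ((k * (q / w)) * ovl ψ τ τ') := by
    intro τ τ'
    have := exp_disc _ N (hS τ τ')
    have e1 : (ovl ψ τ τ' * (q / w)) ^ 2 / 2 = κ' * ovl ψ τ τ' ^ 2 / (2 * n) := by
      rw [← hww, ← hqq]; field_simp
    rw [e1] at this
    refine this.trans_eq ?_
    congr 1
    apply Finset.sum_congr rfl
    intro k _
    rw [← Real.exp_add]; congr 1; ring
  have hterm : ∀ k ∈ Finset.Icc (-(N : ℤ)) N,
      Real.exp (-((k : ℝ) ^ 2 / 2)) * ∏ u, Real.cosh ((k * (q / w)) * ψ u)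
        ≤ C₀ * (w * (1 / (w + (k:ℝ) ^ 2))) := by
    intro k hk
    have hkN : |(k : ℝ)| ≤ N := by
      rw [Finset.mem_Icc] at hk
      rw [abs_le]; constructor
      · exact_mod_cast hk.1
      · exact_mod_cast hk.2
    have hx : ∀ u, |(k * (q / w)) * ψ u| ≤ B := by
      intro u
      rw [abs_mul, abs_mul, abs_of_pos (show 0 < q / w by positivity),
        abs_of_pos (hφmin.trans_le (hψ u).1)]
      calc |(k:ℝ)| * (q / w) * ψ u ≤ ((A + 1) * w) * (q / w) * φmax := by
            have := (hψ u).2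
            have h0 := hφmin.trans_le (hψ u).1
            have h3 := hkN.trans hN2
            gcongr
        _ = (A + 1) * (φmax * q) := by field_simp
        _ ≤ B := by rw [hB]; gcongr
    have h1 : ∏ u, Real.cosh ((k * (q / w)) * ψ u) ≤
        ∏ u, Real.exp (((k * (q / w)) * ψ u) ^ 2 / 2 - c * ((k * (q / w)) * ψ u) ^ 4) :=
      Finset.prod_le_prod (fun u _ => (Real.cosh_pos _).le) (fun u _ => cosh_bd _ B (hx u))
    rw [← Real.exp_sum] at h1
    have h2 : ∑ u, (((k * (q / w)) * ψ u) ^ 2 / 2 - c * ((k * (q / w)) * ψ u) ^ 4)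
        ≤ (k:ℝ) ^ 2 / 2 + (K' / 2 * ((k:ℝ)^2 / w) - c' * ((k:ℝ)^2 / w) ^ 2) := by
      rw [Finset.sum_sub_distrib]
      have e1 : ∑ u, ((k * (q / w)) * ψ u) ^ 2 / 2 = (k:ℝ)^2 / 2 * (κ' * ((∑ u, ψ u ^ 2) / n)) := by
        rw [Finset.sum_div, Finset.mul_sum, Finset.mul_sum]
        apply Finset.sum_congr rfl
        intro u _
        rw [← hqq, ← hww]; field_simp
      have e2 : c' * ((k:ℝ)^2 / w) ^ 2 ≤ ∑ u, c * ((k * (q / w)) * ψ u) ^ 4 := by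
        have : ∀ u ∈ Finset.univ, c * ((k:ℝ) ^ 4 * (κ ^ 2 / w ^ 4) * φmin ^ 4) ≤ c * ((k * (q / w)) * ψ u) ^ 4 := by
          intro u _
          have e : ((k * (q / w)) * ψ u) ^ 4 = (k:ℝ) ^ 4 * (κ' ^ 2 / w ^ 4) * ψ u ^ 4 := by
            rw [← hqq]; field_simp
          rw [e]
          have := (hψ u).1
          have h4 : (0:ℝ) ≤ (k:ℝ) ^ 4 := by positivity
          gcongr
        have := Finset.sum_le_sum this
        refine le_trans (le_of_eq ?_) this
        simp only [Finset.sum_const, Finset.card_univ, Fintype.card_fin, nsmul_eq_mul]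
        rw [← hww, hc']; field_simp
      have e3 : κ' * ((∑ u, ψ u ^ 2) / n) ≤ 1 + K' / w := by
        have : (∑ u, ψ u ^ 2) / n ≤ φmax ^ 2 := by
          rw [div_le_iff₀ hn0]
          have : ∀ u ∈ Finset.univ, ψ u ^ 2 ≤ φmax ^ 2 := by
            intro u _
            have h0 := hφmin.trans_le (hψ u).1
            have := (hψ u).2
            gcongr
          refine (Finset.sum_le_sum this).trans ?_
          simp; linarith
        have h5 : K / w * ((∑ u, ψ u ^ 2) / n) ≤ K / w * φmax ^ 2 :=
          mul_le_mul_of_nonneg_left this (by positivity)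
        rw [hκ', add_mul]
        have : K' / w = K / w + K / w * φmax ^ 2 := by rw [hK']; ring
        rw [this]; linarith
      rw [e1]
      have e4 : (k:ℝ)^2 / 2 * (κ' * ((∑ u, ψ u ^ 2) / n)) ≤ (k:ℝ)^2 / 2 * (1 + K' / w) :=
        mul_le_mul_of_nonneg_left e3 (by positivity)
      have e5 : (k:ℝ)^2 / 2 * (1 + K' / w) = (k:ℝ) ^ 2 / 2 + K' / 2 * ((k:ℝ)^2 / w) := by ring
      linarith
    have h3 : Real.exp (-((k : ℝ) ^ 2 / 2)) * ∏ u, Real.cosh ((k * (q / w)) * ψ u)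
        ≤ Real.exp (K' / 2 * ((k:ℝ)^2 / w) - c' * ((k:ℝ)^2 / w) ^ 2) := by
      refine (mul_le_mul_of_nonneg_left (h1.trans (Real.exp_le_exp.mpr h2)) (Real.exp_pos _).le).trans ?_
      rw [← Real.exp_add]
      apply Real.exp_le_exp.mpr; linarith
    refine h3.trans ?_
    set z := (k:ℝ)^2 / w with hz
    have hz0 : 0 ≤ z := by positivity
    have h4 : w * (1 / (w + (k:ℝ)^2)) = 1 / (1 + z) := by rw [hz]; field_simp
    rw [h4, mul_one_div, le_div_iff₀ (by positivity)]
    have h5 : 1 + z ≤ Real.exp z := by have := Real.add_one_le_exp z; linarith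
    refine (mul_le_mul_of_nonneg_left h5 (Real.exp_pos _).le).trans ?_
    rw [← Real.exp_add, hC₀]
    apply Real.exp_le_exp.mpr
    rw [le_div_iff₀ (by positivity)]
    have h6 := sq_nonneg (2 * c' * z - (1 + K' / 2))
    have h7 : (K' / 2 * z - c' * z ^ 2 + z) * (4 * c') = (1 + K' / 2) ^ 2 - (2 * c' * z - (1 + K' / 2)) ^ 2 := by
      ring
    rw [h7]; exact sub_le_self _ h6
  calc (1 / 4 ^ n) * ∑ τ : Fin n → Bool, ∑ τ' : Fin n → Bool,
        Real.exp (κ' * ovl ψ τ τ' ^ 2 / (2 * n))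
      ≤ (1 / 4 ^ n) * ∑ τ : Fin n → Bool, ∑ τ' : Fin n → Bool,
        Real.exp (1 / 2) * ∑ k ∈ Finset.Icc (-(N : ℤ)) N,
        Real.exp (-((k : ℝ) ^ 2 / 2)) * Real.exp ((k * (q / w)) * ovl ψ τ τ') := by
        apply mul_le_mul_of_nonneg_left _ (by positivity)
        exact Finset.sum_le_sum fun τ _ => Finset.sum_le_sum fun τ' _ => hstep τ τ'
    _ = Real.exp (1/2) * ∑ k ∈ Finset.Icc (-(N : ℤ)) N,
        Real.exp (-((k : ℝ) ^ 2 / 2)) * ∏ u, Real.cosh ((k * (q / w)) * ψ u) := by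
        have e : ∀ k : ℤ, ∏ u, Real.cosh ((k * (q / w)) * ψ u) = (1 / 4 ^ n) *
          ∑ τ : Fin n → Bool, ∑ τ' : Fin n → Bool, Real.exp ((k * (q / w)) * ovl ψ τ τ') := by
          intro k; rw [sum_exp_ovl]; field_simp
        simp_rw [e, ← Finset.mul_sum]
        rw [mul_left_comm]
        congr 1
        simp_rw [mul_left_comm _ (1 / (4:ℝ) ^ n), ← Finset.mul_sum]
        congr 1
        simp_rw [Finset.mul_sum]
        rw [Finset.sum_comm (s := Finset.Icc (-(N : ℤ)) N)]
        apply Finset.sum_congr rfl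
        intro τ _
        rw [Finset.sum_comm]
    _ ≤ Real.exp (1/2) * ∑ k ∈ Finset.Icc (-(N : ℤ)) N, C₀ * (w * (1 / (w + (k:ℝ) ^ 2))) :=
        mul_le_mul_of_nonneg_left (Finset.sum_le_sum hterm) (Real.exp_pos _).le
    _ = Real.exp (1/2) * C₀ * (w * ∑ k ∈ Finset.Icc (-(N : ℤ)) N, 1 / (w + (k:ℝ) ^ 2)) := by
        simp_rw [← Finset.mul_sum]; ring
    _ ≤ _ := by
        have := (summ_int w hw0).sum_le_tsum (Finset.Icc (-(N : ℤ)) N) (fun k _ => by positivity)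
        unfold rate
        gcongr

end DCP
namespace DCP

lemma chi_abs {ι T : Type} [Fintype ι] [DecidableEq ι] [Fintype T] (q : ι → ℝ)
    (hq0 : ∀ e, 0 < q e) (hq1 : ∀ e, q e < 1) (f : T → ι → ℝ) (c : T → ℝ) (t : ℝ) (ht : 0 < t) :
    ∑ γ : ι → Bool, |∑ τ, c τ * ∏ e, (if γ e then f τ e else 1 - f τ e)|
      ≤ t / 2 + 1 / (2 * t) * ∑ τ, ∑ τ', c τ * c τ' *
        ∏ e, (1 + (f τ e - q e) * (f τ' e - q e) / (q e * (1 - q e))) := by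
  set Q : (ι → Bool) → ℝ := fun γ => ∏ e, (if γ e then q e else 1 - q e) with hQ
  have hQpos : ∀ γ, 0 < Q γ := by
    intro γ
    apply Finset.prod_pos
    intro e _
    split_ifs
    · exact hq0 e
    · have := hq1 e; linarith
  have hQsum : ∑ γ, Q γ = 1 := by
    rw [hQ, ← Fintype.piFinset_univ,
      ← Finset.prod_univ_sum (fun _ => Finset.univ) (fun e b => if b = true then q e else 1 - q e)]
    simp
  have hN : ∀ γ, |∑ τ, c τ * ∏ e, (if γ e then f τ e else 1 - f τ e)|
      ≤ t / 2 * Q γ + 1 / (2 * t) * ((∑ τ, c τ * ∏ e, (if γ e then f τ e else 1 - f τ e)) ^ 2 / Q γ) := by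
    intro γ
    have hq := hQpos γ
    generalize (∑ τ, c τ * ∏ e, (if γ e then f τ e else 1 - f τ e)) = N
    generalize Q γ = r at *
    have : t / 2 * r + 1 / (2 * t) * (N ^ 2 / r) - |N| = (t * r - |N|) ^ 2 / (2 * t * r) := by
      rw [← sq_abs N]; field_simp; ring
    have h2 : 0 ≤ (t * r - |N|) ^ 2 / (2 * t * r) := by positivity
    linarith
  refine (Finset.sum_le_sum fun γ _ => hN γ).trans ?_
  rw [Finset.sum_add_distrib, ← Finset.mul_sum, ← Finset.mul_sum, hQsum, mul_one]
  apply le_of_eq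
  congr 2
  have h1 : ∀ γ, (∑ τ, c τ * ∏ e, (if γ e then f τ e else 1 - f τ e)) ^ 2 / Q γ
      = ∑ τ, ∑ τ', c τ * c τ' * ∏ e, ((if γ e then f τ e else 1 - f τ e) *
        (if γ e then f τ' e else 1 - f τ' e) / (if γ e then q e else 1 - q e)) := by
    intro γ
    rw [sq, Finset.sum_mul_sum, Finset.sum_div]
    apply Finset.sum_congr rfl
    intro τ _
    rw [Finset.sum_div]
    apply Finset.sum_congr rfl
    intro τ' _
    rw [Finset.prod_div_distrib, Finset.prod_mul_distrib, hQ]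
    ring
  simp_rw [h1]
  rw [Finset.sum_comm]
  apply Finset.sum_congr rfl
  intro τ _
  rw [Finset.sum_comm]
  apply Finset.sum_congr rfl
  intro τ' _
  rw [← Finset.mul_sum, ← Fintype.piFinset_univ,
      ← Finset.prod_univ_sum (fun _ => Finset.univ) (fun e b => (if b = true then f τ e else 1 - f τ e) *
        (if b = true then f τ' e else 1 - f τ' e) / (if b = true then q e else 1 - q e))]
  congr 1
  apply Finset.prod_congr rfl
  intro e _
  have h2 := hq0 e
  have h3 : 0 < 1 - q e := by have := hq1 e; linarith
  rw [Fintype.sum_bool]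
  simp only [if_true, Bool.false_eq_true, if_false]
  field_simp
  ring

/-- density indexed by edge configurations -/
def den (a b : ℝ) (n : ℕ) (γ : ↥(vertexPairs n) → Bool) (τ : Fin n → Bool) (ψ : Fin n → ℝ) : ℝ :=
  (1 / 2 ^ n) * ∏ p : ↥(vertexPairs n),
    (if γ p then edgeProb a b n τ ψ p.1.1 p.1.2 else 1 - edgeProb a b n τ ψ p.1.1 p.1.2)

lemma configDensity_eq (a b : ℝ) (n : ℕ) (g : Fin n → Fin n → Bool) (τ : Fin n → Bool)
    (ψ : Fin n → ℝ) :
    configDensity a b n g τ ψ = den a b n (fun p => g p.1.1 p.1.2) τ ψ := by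
  unfold configDensity den
  rw [← Finset.prod_coe_sort (vertexPairs n)]

lemma pair_sum {n : ℕ} (x : Fin n → ℝ) :
    ∑ p ∈ vertexPairs n, x p.1 * x p.2 ≤ (∑ u, x u) ^ 2 / 2 := by
  have h1 : (∑ u, x u) ^ 2 = ∑ p : Fin n × Fin n, x p.1 * x p.2 := by
    rw [sq, Finset.sum_mul_sum, Fintype.sum_prod_type]
  have h2 : ∑ p ∈ Finset.univ.filter (fun p : Fin n × Fin n => p.2 < p.1), x p.1 * x p.2
      = ∑ p ∈ vertexPairs n, x p.1 * x p.2 := by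
    apply Finset.sum_bij (fun p _ => p.swap)
    · intro p hp; simpa [vertexPairs] using hp
    · intro p _ p' _ h; exact Prod.swap_injective h
    · intro p hp; exact ⟨p.swap, by simpa [vertexPairs] using hp, by simp⟩
    · intro p _; simp [mul_comm]
  have h3 : 0 ≤ ∑ p ∈ (Finset.univ.filter (fun p : Fin n × Fin n => ¬ p.1 < p.2)).filter
      (fun p => ¬ p.2 < p.1), x p.1 * x p.2 := by
    apply Finset.sum_nonneg
    intro p hp
    simp only [Finset.mem_filter, Finset.mem_univ, true_and, not_lt] at hp
    have : p.1 = p.2 := le_antisymm hp.2 hp.1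
    rw [this]; exact mul_self_nonneg _
  have h4 := Finset.sum_filter_add_sum_filter_not (Finset.univ : Finset (Fin n × Fin n))
    (fun p => p.1 < p.2) (fun p => x p.1 * x p.2)
  have h5 := Finset.sum_filter_add_sum_filter_not
    (Finset.univ.filter (fun p : Fin n × Fin n => ¬ p.1 < p.2))
    (fun p => p.2 < p.1) (fun p => x p.1 * x p.2)
  have h6 : (Finset.univ.filter (fun p : Fin n × Fin n => ¬ p.1 < p.2)).filter
      (fun p => p.2 < p.1) = Finset.univ.filter (fun p : Fin n × Fin n => p.2 < p.1) := by
    ext p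
    simp only [Finset.mem_filter, Finset.mem_univ, true_and]
    constructor
    · exact fun h => h.2
    · exact fun h => ⟨not_lt.mpr h.le, h⟩
  rw [h6, h2] at h5
  change ∑ p ∈ vertexPairs n, x p.1 * x p.2 + _ = _ at h4
  rw [h1]
  linarith

/-- total `L¹` correlation of the spins of `u` and `v` given the weights -/
def corr (a b : ℝ) (n : ℕ) (ψ : Fin n → ℝ) (u v : Fin n) : ℝ :=
  ∑ γ : ↥(vertexPairs n) → Bool, |∑ τ : Fin n → Bool, sg (τ u) * sg (τ v) * den a b n γ τ ψ|

lemma corr_nonneg (a b : ℝ) (n : ℕ) (ψ : Fin n → ℝ) (u v : Fin n) : 0 ≤ corr a b n ψ u v :=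
  Finset.sum_nonneg fun _ _ => abs_nonneg _

lemma edge_factor (a b : ℝ) (n : ℕ) (ψ : Fin n → ℝ) (τ : Fin n → Bool) (u v : Fin n) :
    edgeProb a b n τ ψ u v - ψ u * ψ v / n * ((a + b) / 2)
      = ψ u * ψ v / n * ((a - b) / 2) * (sg (τ u) * sg (τ v)) := by
  unfold edgeProb
  cases τ u <;> cases τ v <;> simp [sg] <;> ring

lemma prod_bound (a b φmin φmax κ : ℝ) (ha : 0 < a) (hb : 0 < b) (hφmin : 0 < φmin)
    (hκ : (a - b) ^ 2 / (2 * (a + b)) ≤ κ)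
    (n : ℕ) (hn : 1 ≤ n) (hbig : φmax ^ 2 * (a + b) ≤ n) (ψ : Fin n → ℝ)
    (hψ : ∀ u, ψ u ∈ Set.Icc φmin φmax) (τ τ' : Fin n → Bool) :
    ∏ p : ↥(vertexPairs n), (1 + (edgeProb a b n τ ψ p.1.1 p.1.2 - ψ p.1.1 * ψ p.1.2 / n * ((a + b) / 2)) *
      (edgeProb a b n τ' ψ p.1.1 p.1.2 - ψ p.1.1 * ψ p.1.2 / n * ((a + b) / 2)) /
      ((ψ p.1.1 * ψ p.1.2 / n * ((a + b) / 2)) * (1 - ψ p.1.1 * ψ p.1.2 / n * ((a + b) / 2))))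
    ≤ Real.exp (φmax ^ 4 * (a + b) ^ 2 / 2) * Real.exp (κ * ovl ψ τ τ' ^ 2 / (2 * n)) := by
  have hn0 : (0:ℝ) < n := by exact_mod_cast hn
  set κ₀ := (a - b) ^ 2 / (2 * (a + b)) with hκ₀
  have hκ₀0 : 0 ≤ κ₀ := by positivity
  have hκ₀1 : κ₀ ≤ (a + b) / 2 := by
    rw [hκ₀, div_le_div_iff₀ (by positivity) (by positivity)]
    nlinarith [mul_pos ha hb]
  set x : Fin n → ℝ := fun u => ψ u * (sg (τ u) * sg (τ' u)) with hx
  set q : Fin n × Fin n → ℝ := fun p => ψ p.1 * ψ p.2 / n * ((a + b) / 2) with hqdef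
  have hψψ : ∀ p : Fin n × Fin n, 0 < ψ p.1 * ψ p.2 ∧ ψ p.1 * ψ p.2 ≤ φmax ^ 2 := by
    intro p
    have h1 := hφmin.trans_le (hψ p.1).1
    have h2 := hφmin.trans_le (hψ p.2).1
    have h3 := (hψ p.1).2
    have h4 := (hψ p.2).2
    refine ⟨by positivity, ?_⟩
    rw [sq]; gcongr
    exact h1.le.trans h3
  have hq0 : ∀ p, 0 < q p := by
    intro p
    have := (hψψ p).1
    rw [hqdef]; positivity
  have hqM : ∀ p, q p ≤ φmax ^ 2 * (a + b) / 2 / n := by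
    intro p
    have := (hψψ p).2
    rw [hqdef]
    calc ψ p.1 * ψ p.2 / n * ((a + b) / 2) ≤ φmax ^ 2 / n * ((a + b) / 2) := by gcongr
      _ = _ := by ring
  have hqhalf : ∀ p, q p ≤ 1 / 2 := by
    intro p
    refine (hqM p).trans ?_
    rw [div_le_iff₀ hn0]; linarith
  -- per pair
  have hfac : ∀ p : Fin n × Fin n,
      (edgeProb a b n τ ψ p.1 p.2 - q p) * (edgeProb a b n τ' ψ p.1 p.2 - q p) / (q p * (1 - q p))
        = κ₀ / n * (x p.1 * x p.2) / (1 - q p) := by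
    intro p
    have h1 : 0 < 1 - q p := by have := hqhalf p; linarith
    have h3 := (hψψ p).1
    have e1 : edgeProb a b n τ ψ p.1 p.2 - q p = _ := edge_factor a b n ψ τ p.1 p.2
    have e2 : edgeProb a b n τ' ψ p.1 p.2 - q p = _ := edge_factor a b n ψ τ' p.1 p.2
    rw [e1, e2, mul_comm (q p), ← div_div, div_div _ (1 - q p), mul_comm (1 - q p), ← div_div]
    congr 1
    rw [div_eq_iff (hq0 p).ne']
    simp only [hqdef, hκ₀, hx]
    have : a + b ≠ 0 := by positivity
    field_simp
  have habs : ∀ p : Fin n × Fin n, |x p.1 * x p.2| = ψ p.1 * ψ p.2 := by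
    intro p
    have e : x p.1 * x p.2 = ψ p.1 * ψ p.2 * ((sg (τ p.1) * sg (τ' p.1)) * (sg (τ p.2) * sg (τ' p.2))) := by
      simp only [hx]; ring
    rw [e, abs_mul, abs_of_pos (hψψ p).1]
    have : |(sg (τ p.1) * sg (τ' p.1)) * (sg (τ p.2) * sg (τ' p.2))| = 1 := by
      cases τ p.1 <;> cases τ' p.1 <;> cases τ p.2 <;> cases τ' p.2 <;> simp [sg]
    rw [this, mul_one]
  have hyq : ∀ p : Fin n × Fin n, |κ₀ / n * (x p.1 * x p.2)| ≤ q p := by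
    intro p
    rw [abs_mul, habs, abs_of_nonneg (by positivity)]
    have h3 := (hψψ p).1
    simp only [hqdef]
    calc κ₀ / n * (ψ p.1 * ψ p.2) ≤ ((a + b) / 2) / n * (ψ p.1 * ψ p.2) := by gcongr
      _ = _ := by ring
  have hpos : ∀ p : Fin n × Fin n, 0 ≤ 1 + κ₀ / n * (x p.1 * x p.2) / (1 - q p) := by
    intro p
    have h1 : 0 < 1 - q p := by have := hqhalf p; linarith
    have h2 := (abs_le.mp (hyq p)).1
    have h3 : -1 ≤ κ₀ / n * (x p.1 * x p.2) / (1 - q p) := by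
      rw [le_div_iff₀ h1]; have := hqhalf p; linarith
    linarith
  have hle : ∀ p : Fin n × Fin n, κ₀ / n * (x p.1 * x p.2) / (1 - q p)
      ≤ κ₀ / n * (x p.1 * x p.2) + φmax ^ 4 * (a + b) ^ 2 / 2 / n ^ 2 := by
    intro p
    have h1 : 0 < 1 - q p := by have := hqhalf p; linarith
    have h2 := (abs_le.mp (hyq p)).2
    have h3 := hqhalf p
    have h4 := hq0 p
    have h5 : κ₀ / n * (x p.1 * x p.2) / (1 - q p) ≤ κ₀ / n * (x p.1 * x p.2) + 2 * q p ^ 2 := by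
      rw [div_le_iff₀ h1]
      generalize κ₀ / n * (x p.1 * x p.2) = y at *
      nlinarith [mul_nonneg h4.le (sub_nonneg.mpr h2), mul_nonneg (sq_nonneg (q p)) (sub_nonneg.mpr h3)]
    have h6 : 2 * q p ^ 2 ≤ 2 * (φmax ^ 2 * (a + b) / 2 / n) ^ 2 := by
      have := hqM p
      gcongr
    have h7 : 2 * (φmax ^ 2 * (a + b) / 2 / n) ^ 2 = φmax ^ 4 * (a + b) ^ 2 / 2 / n ^ 2 := by
      field_simp
    linarith
  have step1 : ∀ p : ↥(vertexPairs n), (1 + (edgeProb a b n τ ψ p.1.1 p.1.2 - ψ p.1.1 * ψ p.1.2 / n * ((a + b) / 2)) *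
      (edgeProb a b n τ' ψ p.1.1 p.1.2 - ψ p.1.1 * ψ p.1.2 / n * ((a + b) / 2)) /
      ((ψ p.1.1 * ψ p.1.2 / n * ((a + b) / 2)) * (1 - ψ p.1.1 * ψ p.1.2 / n * ((a + b) / 2))))
      = 1 + κ₀ / n * (x p.1.1 * x p.1.2) / (1 - q p.1) := fun p => by rw [← hfac p.1]
  rw [Finset.prod_congr rfl (fun p _ => step1 p)]
  have step2 : ∏ p : ↥(vertexPairs n), (1 + κ₀ / n * (x p.1.1 * x p.1.2) / (1 - q p.1)) ≤
      ∏ p : ↥(vertexPairs n), Real.exp (κ₀ / n * (x p.1.1 * x p.1.2) + φmax ^ 4 * (a + b) ^ 2 / 2 / n ^ 2) := by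
    apply Finset.prod_le_prod
    · intro p _; exact hpos p.1
    · intro p _
      have h1 := hle p.1
      have h2 := Real.add_one_le_exp (κ₀ / n * (x p.1.1 * x p.1.2) + φmax ^ 4 * (a + b) ^ 2 / 2 / n ^ 2)
      linarith
  refine step2.trans ?_
  rw [← Real.exp_sum, ← Real.exp_add]
  apply Real.exp_le_exp.mpr
  rw [Finset.sum_add_distrib, ← Finset.mul_sum,
    Finset.sum_coe_sort (vertexPairs n) (fun p => x p.1 * x p.2)]
  have h1 := pair_sum x
  have h2 : κ₀ / n * ∑ p ∈ vertexPairs n, x p.1 * x p.2 ≤ κ₀ / n * ((∑ u, x u) ^ 2 / 2) :=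
    mul_le_mul_of_nonneg_left h1 (by positivity)
  have h3 : κ₀ / n * ((∑ u, x u) ^ 2 / 2) ≤ κ * ovl ψ τ τ' ^ 2 / (2 * n) := by
    have : ovl ψ τ τ' = ∑ u, x u := rfl
    rw [this]
    calc κ₀ / n * ((∑ u, x u) ^ 2 / 2) ≤ κ / n * ((∑ u, x u) ^ 2 / 2) := by gcongr
      _ = _ := by field_simp
  have h4 : ∑ _p : ↥(vertexPairs n), φmax ^ 4 * (a + b) ^ 2 / 2 / (n:ℝ) ^ 2 ≤ φmax ^ 4 * (a + b) ^ 2 / 2 := by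
    have hc : ((Fintype.card ↥(vertexPairs n) : ℕ) : ℝ) ≤ (n:ℝ) ^ 2 := by
      have : Fintype.card ↥(vertexPairs n) ≤ n ^ 2 := by
        rw [Fintype.card_coe]
        refine (Finset.card_le_univ _).trans ?_
        simp [sq]
      exact_mod_cast this
    rw [Finset.sum_const, nsmul_eq_mul, Finset.card_univ]
    calc ((Fintype.card ↥(vertexPairs n) : ℕ) : ℝ) * (φmax ^ 4 * (a + b) ^ 2 / 2 / (n:ℝ) ^ 2)
        ≤ (n:ℝ) ^ 2 * (φmax ^ 4 * (a + b) ^ 2 / 2 / (n:ℝ) ^ 2) := by gcongr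
      _ = _ := by field_simp
  linarith

lemma corr_bound (a b φmin φmax κ : ℝ) (ha : 0 < a) (hb : 0 < b) (hφmin : 0 < φmin)
    (hκ : (a - b) ^ 2 / (2 * (a + b)) ≤ κ)
    (n : ℕ) (hn : 1 ≤ n) (hbig : φmax ^ 2 * (a + b) ≤ n) (ψ : Fin n → ℝ)
    (hψ : ∀ u, ψ u ∈ Set.Icc φmin φmax) (t : ℝ) (ht : 0 < t) :
    φmin ^ 2 * ∑ u, ∑ v, corr a b n ψ u v ≤ n ^ 2 * φmax ^ 2 * (t / 2) +
      1 / (2 * t) * (Real.exp (φmax ^ 4 * (a + b) ^ 2 / 2) * ((1 / 4 ^ n) *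
        ∑ τ : Fin n → Bool, ∑ τ' : Fin n → Bool,
          ovl ψ τ τ' ^ 2 * Real.exp (κ * ovl ψ τ τ' ^ 2 / (2 * n)))) := by
  have hn0 : (0:ℝ) < n := by exact_mod_cast hn
  set F : (Fin n → Bool) → (Fin n → Bool) → ℝ := fun τ τ' =>
    ∏ p : ↥(vertexPairs n), (1 + (edgeProb a b n τ ψ p.1.1 p.1.2 - ψ p.1.1 * ψ p.1.2 / n * ((a + b) / 2)) *
      (edgeProb a b n τ' ψ p.1.1 p.1.2 - ψ p.1.1 * ψ p.1.2 / n * ((a + b) / 2)) /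
      ((ψ p.1.1 * ψ p.1.2 / n * ((a + b) / 2)) * (1 - ψ p.1.1 * ψ p.1.2 / n * ((a + b) / 2)))) with hF
  have hψψ : ∀ u v, 0 < ψ u * ψ v ∧ φmin ^ 2 ≤ ψ u * ψ v ∧ ψ u * ψ v ≤ φmax ^ 2 := by
    intro u v
    have h1 := hφmin.trans_le (hψ u).1
    have h2 := hφmin.trans_le (hψ v).1
    have h3 := (hψ u).2
    have h4 := (hψ v).2
    have h5 := (hψ u).1
    have h6 := (hψ v).1
    refine ⟨by positivity, by rw [sq]; gcongr, ?_⟩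
    rw [sq]; gcongr
    exact h1.le.trans h3
  have hA : ∀ u v, corr a b n ψ u v ≤ t / 2 + 1 / (2 * t) * ∑ τ, ∑ τ',
      (1 / 2 ^ n * (sg (τ u) * sg (τ v))) * (1 / 2 ^ n * (sg (τ' u) * sg (τ' v))) * F τ τ' := by
    intro u v
    have := chi_abs (fun p : ↥(vertexPairs n) => ψ p.1.1 * ψ p.1.2 / n * ((a + b) / 2))
      (fun p => by have := (hψψ p.1.1 p.1.2).1; positivity)
      (fun p => by
        have := (hψψ p.1.1 p.1.2).2.2
        have h1 : ψ p.1.1 * ψ p.1.2 / n * ((a + b) / 2) ≤ φmax ^ 2 / n * ((a + b) / 2) := by gcongr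
        have h2 : φmax ^ 2 / n * ((a + b) / 2) ≤ 1 / 2 := by
          have e : φmax ^ 2 / n * ((a + b) / 2) = (φmax ^ 2 * (a + b)) / n / 2 := by ring
          have h3 : (φmax ^ 2 * (a + b)) / n ≤ 1 := by rw [div_le_one hn0]; exact hbig
          rw [e]; linarith
        linarith)
      (fun τ p => edgeProb a b n τ ψ p.1.1 p.1.2)
      (fun τ => 1 / 2 ^ n * (sg (τ u) * sg (τ v))) t ht
    refine le_trans (le_of_eq ?_) this
    unfold corr
    apply Finset.sum_congr rfl
    intro γ _
    congr 1
    apply Finset.sum_congr rfl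
    intro τ _
    unfold den
    ring
  have hB : ∀ u v, φmin ^ 2 * corr a b n ψ u v ≤ φmax ^ 2 * (t / 2) + 1 / (2 * t) * ((1 / 4 ^ n) *
      ∑ τ, ∑ τ', ψ u * (sg (τ u) * sg (τ' u)) * (ψ v * (sg (τ v) * sg (τ' v))) * F τ τ') := by
    intro u v
    have h0 := corr_nonneg a b n ψ u v
    obtain ⟨h1, h2, h3⟩ := hψψ u v
    calc φmin ^ 2 * corr a b n ψ u v ≤ ψ u * ψ v * corr a b n ψ u v := by gcongr
      _ ≤ ψ u * ψ v * (t / 2 + 1 / (2 * t) * ∑ τ, ∑ τ',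
        (1 / 2 ^ n * (sg (τ u) * sg (τ v))) * (1 / 2 ^ n * (sg (τ' u) * sg (τ' v))) * F τ τ') := by
          gcongr; exact hA u v
      _ = ψ u * ψ v * (t / 2) + 1 / (2 * t) * ((1 / 4 ^ n) *
      ∑ τ, ∑ τ', ψ u * (sg (τ u) * sg (τ' u)) * (ψ v * (sg (τ v) * sg (τ' v))) * F τ τ') := by
          rw [mul_add]
          congr 1
          rw [mul_left_comm]
          congr 1
          rw [Finset.mul_sum, Finset.mul_sum]
          apply Finset.sum_congr rfl
          intro τ _
          rw [Finset.mul_sum, Finset.mul_sum]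
          apply Finset.sum_congr rfl
          intro τ' _
          have : (4:ℝ) ^ n = 2 ^ n * 2 ^ n := by rw [← mul_pow]; norm_num
          rw [this]; ring
      _ ≤ _ := by gcongr
  have hC : φmin ^ 2 * ∑ u, ∑ v, corr a b n ψ u v ≤ n ^ 2 * φmax ^ 2 * (t / 2) + 1 / (2 * t) * ((1 / 4 ^ n) *
      ∑ τ, ∑ τ', ovl ψ τ τ' ^ 2 * F τ τ') := by
    rw [Finset.mul_sum]
    simp_rw [Finset.mul_sum (Finset.univ) _ (φmin ^ 2)]
    refine (Finset.sum_le_sum fun u _ => Finset.sum_le_sum fun v _ => hB u v).trans (le_of_eq ?_)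
    simp_rw [Finset.sum_add_distrib, ← Finset.mul_sum]
    congr 1
    · simp; ring
    · congr 2
      have : ∀ τ τ', ovl ψ τ τ' ^ 2 * F τ τ' = ∑ u, ∑ v,
        ψ u * (sg (τ u) * sg (τ' u)) * (ψ v * (sg (τ v) * sg (τ' v))) * F τ τ' := by
        intro τ τ'
        rw [sq, ovl, Finset.sum_mul_sum, Finset.sum_mul]
        simp_rw [Finset.sum_mul]
      simp_rw [this]
      calc _ = ∑ u, ∑ τ, ∑ v, ∑ τ', ψ u * (sg (τ u) * sg (τ' u)) * (ψ v * (sg (τ v) * sg (τ' v))) * F τ τ' := by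
            apply Finset.sum_congr rfl; intro u _; rw [Finset.sum_comm]
        _ = ∑ τ, ∑ u, ∑ v, ∑ τ', ψ u * (sg (τ u) * sg (τ' u)) * (ψ v * (sg (τ v) * sg (τ' v))) * F τ τ' := by
            rw [Finset.sum_comm]
        _ = ∑ τ, ∑ u, ∑ τ', ∑ v, ψ u * (sg (τ u) * sg (τ' u)) * (ψ v * (sg (τ v) * sg (τ' v))) * F τ τ' := by
            apply Finset.sum_congr rfl; intro τ _
            apply Finset.sum_congr rfl; intro u _; rw [Finset.sum_comm]
        _ = _ := by
            apply Finset.sum_congr rfl; intro τ _; rw [Finset.sum_comm]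
  refine hC.trans ?_
  have hD : ∑ τ, ∑ τ', ovl ψ τ τ' ^ 2 * F τ τ' ≤ Real.exp (φmax ^ 4 * (a + b) ^ 2 / 2) *
        ∑ τ : Fin n → Bool, ∑ τ' : Fin n → Bool,
          ovl ψ τ τ' ^ 2 * Real.exp (κ * ovl ψ τ τ' ^ 2 / (2 * n)) := by
    rw [Finset.mul_sum]
    simp_rw [Finset.mul_sum]
    apply Finset.sum_le_sum; intro τ _
    apply Finset.sum_le_sum; intro τ' _
    have := prod_bound a b φmin φmax κ ha hb hφmin hκ n hn hbig ψ hψ τ τ'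
    rw [mul_left_comm]
    exact mul_le_mul_of_nonneg_left this (sq_nonneg _)
  have e : Real.exp (φmax ^ 4 * (a + b) ^ 2 / 2) * ((1 / 4 ^ n) *
        ∑ τ : Fin n → Bool, ∑ τ' : Fin n → Bool,
          ovl ψ τ τ' ^ 2 * Real.exp (κ * ovl ψ τ τ' ^ 2 / (2 * n))) = (1 / 4 ^ n) * (Real.exp (φmax ^ 4 * (a + b) ^ 2 / 2) *
        ∑ τ : Fin n → Bool, ∑ τ' : Fin n → Bool,
          ovl ψ τ τ' ^ 2 * Real.exp (κ * ovl ψ τ τ' ^ 2 / (2 * n))) := by ring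
  rw [e]
  gcongr

/-- On good weights the average correlation is small. -/
lemma corr_avg (a b φmin φmax κ K : ℝ) (ha : 0 < a) (hb : 0 < b) (hφmin : 0 < φmin)
    (hφ : φmin ≤ φmax) (hκ0 : 0 < κ)
    (hκ : (a - b) ^ 2 / (2 * (a + b)) ≤ κ) (hK : 0 < K) :
    ∃ C : ℝ, 0 ≤ C ∧ ∀ n : ℕ, 1 ≤ n → φmax ^ 2 * (a + b) ≤ n → ∀ ψ : Fin n → ℝ,
      (∀ u, ψ u ∈ Set.Icc φmin φmax) → κ * ((∑ u, ψ u ^ 2) / n) ≤ 1 + K / Real.sqrt n →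
      ∀ t : ℝ, 0 < t →
      1 / (n:ℝ) ^ 2 * ∑ u, ∑ v, corr a b n ψ u v ≤ φmax ^ 2 / φmin ^ 2 * (t / 2) + C / t * rate n := by
  obtain ⟨C, hC0, hC⟩ := cw_bound φmin φmax κ K hφmin hφ hκ0 hK
  set E := Real.exp (φmax ^ 4 * (a + b) ^ 2 / 2) with hE
  refine ⟨1 / φmin ^ 2 * (E * C / K), by positivity, ?_⟩
  intro n hn hbig ψ hψ hgood t ht
  have hn0 : (0:ℝ) < n := by exact_mod_cast hn
  have h1 := corr_bound a b φmin φmax κ ha hb hφmin hκ n hn hbig ψ hψ t ht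
  have h2 := hC n hn ψ hψ hgood
  set w := Real.sqrt n with hw
  have hw0 : 0 < w := Real.sqrt_pos.mpr hn0
  have hww : w ^ 2 = n := Real.sq_sqrt hn0.le
  have h3 : (1 / 4 ^ n) * ∑ τ : Fin n → Bool, ∑ τ' : Fin n → Bool,
          ovl ψ τ τ' ^ 2 * Real.exp (κ * ovl ψ τ τ' ^ 2 / (2 * n))
      ≤ (2 * n * w / K) * (C * (w * rate n)) := by
    refine le_trans ?_ (mul_le_mul_of_nonneg_left h2 (by positivity))
    rw [mul_left_comm]
    apply mul_le_mul_of_nonneg_left _ (by positivity)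
    rw [Finset.mul_sum]
    simp_rw [Finset.mul_sum]
    apply Finset.sum_le_sum; intro τ _
    apply Finset.sum_le_sum; intro τ' _
    have e1 : (κ + K / w) * ovl ψ τ τ' ^ 2 / (2 * n)
      = (K / w * ovl ψ τ τ' ^ 2 / (2 * n)) + κ * ovl ψ τ τ' ^ 2 / (2 * n) := by ring
    rw [e1, Real.exp_add, ← mul_assoc]
    apply mul_le_mul_of_nonneg_right _ (Real.exp_pos _).le
    have e2 := Real.add_one_le_exp (K / w * ovl ψ τ τ' ^ 2 / (2 * n))
    calc ovl ψ τ τ' ^ 2 = (2 * n * w / K) * (K / w * ovl ψ τ τ' ^ 2 / (2 * n)) := by field_simp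
      _ ≤ _ := by
        apply mul_le_mul_of_nonneg_left _ (by positivity)
        linarith
  have h4 : φmin ^ 2 * ∑ u, ∑ v, corr a b n ψ u v ≤ n ^ 2 * φmax ^ 2 * (t / 2) +
      1 / (2 * t) * (E * ((2 * n * w / K) * (C * (w * rate n)))) := by
    refine h1.trans ?_
    gcongr
  have h5 : 1 / (n:ℝ) ^ 2 * ∑ u, ∑ v, corr a b n ψ u v
      = 1 / (n ^ 2 * φmin ^ 2) * (φmin ^ 2 * ∑ u, ∑ v, corr a b n ψ u v) := by field_simp
  rw [h5]
  refine (mul_le_mul_of_nonneg_left h4 (by positivity)).trans (le_of_eq ?_)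
  rw [← hww]; field_simp

end DCP
namespace DCP

lemma edgeProb_mem (a b φmin φmax : ℝ) (ha : 0 < a) (hb : 0 < b) (hφmin : 0 < φmin)
    (n : ℕ) (hn : 1 ≤ n) (hbig : φmax ^ 2 * (a + b) ≤ n) (ψ : Fin n → ℝ)
    (hψ : ∀ u, ψ u ∈ Set.Icc φmin φmax) (τ : Fin n → Bool) (u v : Fin n) :
    0 ≤ edgeProb a b n τ ψ u v ∧ edgeProb a b n τ ψ u v ≤ 1 := by
  have hn0 : (0:ℝ) < n := by exact_mod_cast hn
  have h1 := hφmin.trans_le (hψ u).1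
  have h2 := hφmin.trans_le (hψ v).1
  have h3 := (hψ u).2
  have h4 := (hψ v).2
  have h5 : ψ u * ψ v ≤ φmax ^ 2 := by
    rw [sq]; gcongr
    exact h1.le.trans h3
  have h6 : 0 < ψ u * ψ v := by positivity
  have h7 : (0:ℝ) ≤ (if τ u = τ v then a else b) ∧ (if τ u = τ v then a else b) ≤ a + b := by
    split_ifs <;> constructor <;> linarith
  unfold edgeProb
  refine ⟨mul_nonneg (by positivity) h7.1, ?_⟩
  calc ψ u * ψ v / n * (if τ u = τ v then a else b) ≤ φmax ^ 2 / n * (a + b) := by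
        gcongr
        exact h7.2
    _ = (φmax ^ 2 * (a + b)) / n := by ring
    _ ≤ 1 := by rw [div_le_one hn0]; exact hbig

lemma den_nonneg (a b φmin φmax : ℝ) (ha : 0 < a) (hb : 0 < b) (hφmin : 0 < φmin)
    (n : ℕ) (hn : 1 ≤ n) (hbig : φmax ^ 2 * (a + b) ≤ n) (ψ : Fin n → ℝ)
    (hψ : ∀ u, ψ u ∈ Set.Icc φmin φmax) (γ : ↥(vertexPairs n) → Bool) (τ : Fin n → Bool) :
    0 ≤ den a b n γ τ ψ := by
  unfold den
  apply mul_nonneg (by positivity)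
  apply Finset.prod_nonneg
  intro p _
  have := edgeProb_mem a b φmin φmax ha hb hφmin n hn hbig ψ hψ τ p.1.1 p.1.2
  split_ifs
  · exact this.1
  · linarith [this.2]

lemma den_sum (a b : ℝ) (n : ℕ) (ψ : Fin n → ℝ) :
    ∑ γ : ↥(vertexPairs n) → Bool, ∑ τ : Fin n → Bool, den a b n γ τ ψ = 1 := by
  rw [Finset.sum_comm]
  have : ∀ τ : Fin n → Bool, ∑ γ : ↥(vertexPairs n) → Bool, den a b n γ τ ψ = 1 / 2 ^ n := by
    intro τ
    unfold den
    rw [← Finset.mul_sum, ← Fintype.piFinset_univ,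
      ← Finset.prod_univ_sum (fun _ => Finset.univ) (fun (p : ↥(vertexPairs n)) b' =>
        if b' = true then edgeProb a b n τ ψ p.1.1 p.1.2 else 1 - edgeProb a b n τ ψ p.1.1 p.1.2)]
    simp
  simp_rw [this]
  simp

lemma sg_abs (b : Bool) : |sg b| = 1 := by cases b <;> simp [sg]

lemma corr_le_one (a b φmin φmax : ℝ) (ha : 0 < a) (hb : 0 < b) (hφmin : 0 < φmin)
    (n : ℕ) (hn : 1 ≤ n) (hbig : φmax ^ 2 * (a + b) ≤ n) (ψ : Fin n → ℝ)
    (hψ : ∀ u, ψ u ∈ Set.Icc φmin φmax) (u v : Fin n) : corr a b n ψ u v ≤ 1 := by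
  rw [← den_sum a b n ψ]
  apply Finset.sum_le_sum
  intro γ _
  refine (Finset.abs_sum_le_sum_abs _ _).trans ?_
  apply Finset.sum_le_sum
  intro τ _
  rw [abs_mul, abs_mul, sg_abs, sg_abs, one_mul, one_mul,
    abs_of_nonneg (den_nonneg a b φmin φmax ha hb hφmin n hn hbig ψ hψ γ τ)]

lemma den_meas (a b : ℝ) (n : ℕ) (γ : ↥(vertexPairs n) → Bool) (τ : Fin n → Bool) :
    Measurable (fun ψ => den a b n γ τ ψ) := by
  unfold den edgeProb
  apply Measurable.const_mul
  apply Finset.measurable_prod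
  intro p _
  by_cases h : γ p = true
  · simp only [h, if_true]; fun_prop
  · simp only [Bool.not_eq_true] at h
    simp only [h, Bool.false_eq_true, if_false]; fun_prop

lemma den_flip (a b : ℝ) (n : ℕ) (γ : ↥(vertexPairs n) → Bool) (τ : Fin n → Bool) (ψ : Fin n → ℝ) :
    den a b n γ (fun w => !τ w) ψ = den a b n γ τ ψ := by
  unfold den edgeProb
  simp

lemma den_odd (a b : ℝ) (n : ℕ) (γ : ↥(vertexPairs n) → Bool) (ψ : Fin n → ℝ) (u : Fin n) :
    ∑ τ : Fin n → Bool, sg (τ u) * den a b n γ τ ψ = 0 := by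
  have h := Equiv.sum_comp (Equiv.arrowCongr (Equiv.refl (Fin n)) Equiv.boolNot)
    (fun τ : Fin n → Bool => sg (τ u) * den a b n γ τ ψ)
  have h2 : ∀ τ : Fin n → Bool, (Equiv.arrowCongr (Equiv.refl (Fin n)) Equiv.boolNot) τ = fun w => !τ w := by
    intro τ; ext w; simp [Equiv.arrowCongr]
  simp_rw [h2, den_flip] at h
  have h3 : ∀ b', sg (!b') = - sg b' := by intro b'; cases b' <;> simp [sg]
  simp_rw [h3, neg_mul, Finset.sum_neg_distrib] at h
  linarith

lemma pi_supp (φmin φmax : ℝ) (ν : Measure ℝ) [IsProbabilityMeasure ν]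
    (hsupp : ∀ᵐ x ∂ν, x ∈ Set.Icc φmin φmax) (n : ℕ) :
    ∀ᵐ ψ ∂(Measure.pi fun _ : Fin n => ν), ∀ u, ψ u ∈ Set.Icc φmin φmax := by
  rw [ae_all_iff]
  intro u
  exact (measurePreserving_eval (fun _ : Fin n => ν) u).quasiMeasurePreserving.ae hsupp

lemma den_integrable (a b φmin φmax : ℝ) (ha : 0 < a) (hb : 0 < b) (hφmin : 0 < φmin)
    (ν : Measure ℝ) [IsProbabilityMeasure ν]
    (hsupp : ∀ᵐ x ∂ν, x ∈ Set.Icc φmin φmax)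
    (n : ℕ) (hn : 1 ≤ n) (hbig : φmax ^ 2 * (a + b) ≤ n)
    (γ : ↥(vertexPairs n) → Bool) (τ : Fin n → Bool) :
    Integrable (fun ψ => den a b n γ τ ψ) (Measure.pi fun _ : Fin n => ν) := by
  refine Integrable.of_bound (den_meas a b n γ τ).aestronglyMeasurable 1 ?_
  filter_upwards [pi_supp φmin φmax ν hsupp n] with ψ hψ
  have h0 := fun γ τ => den_nonneg a b φmin φmax ha hb hφmin n hn hbig ψ hψ γ τ
  rw [Real.norm_eq_abs, abs_of_nonneg (h0 γ τ), ← den_sum a b n ψ]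
  calc den a b n γ τ ψ ≤ ∑ τ, den a b n γ τ ψ :=
        Finset.single_le_sum (f := fun τ => den a b n γ τ ψ) (fun τ _ => h0 γ τ) (Finset.mem_univ τ)
    _ ≤ _ := Finset.single_le_sum (f := fun γ => ∑ τ, den a b n γ τ ψ)
        (fun γ _ => Finset.sum_nonneg fun τ _ => h0 γ τ) (Finset.mem_univ γ)

lemma corr_integrable (a b φmin φmax : ℝ) (ha : 0 < a) (hb : 0 < b) (hφmin : 0 < φmin)
    (ν : Measure ℝ) [IsProbabilityMeasure ν]
    (hsupp : ∀ᵐ x ∂ν, x ∈ Set.Icc φmin φmax)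
    (n : ℕ) (hn : 1 ≤ n) (hbig : φmax ^ 2 * (a + b) ≤ n) (u v : Fin n) :
    Integrable (fun ψ => corr a b n ψ u v) (Measure.pi fun _ : Fin n => ν) := by
  unfold corr
  apply integrable_finsetSum
  intro γ _
  apply Integrable.abs
  apply integrable_finsetSum
  intro τ _
  exact (den_integrable a b φmin φmax ha hb hφmin ν hsupp n hn hbig γ τ).const_mul _

/-- Chebyshev for the empirical second moment. -/
lemma bad_weights (φmin φmax K : ℝ) (hφmin : 0 < φmin) (hK : 0 < K)
    (ν : Measure ℝ) [IsProbabilityMeasure ν]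
    (hsupp : ∀ᵐ x ∂ν, x ∈ Set.Icc φmin φmax) (m : ℝ) (hm : m = ∫ x, x ^ 2 ∂ν) (hm0 : 0 < m)
    (n : ℕ) (hn : 1 ≤ n) :
    (Measure.pi fun _ : Fin n => ν).real
      {ψ | ¬ (1 / m) * ((∑ u, ψ u ^ 2) / n) ≤ 1 + K / Real.sqrt n}
      ≤ (φmax ^ 2 / 2) ^ 2 / m ^ 2 / K ^ 2 := by
  have hn0 : (0:ℝ) < n := by exact_mod_cast hn
  have hbd : ∀ᵐ x ∂ν, x ^ 2 ∈ Set.Icc 0 (φmax ^ 2) := by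
    filter_upwards [hsupp] with x hx
    have := hφmin.trans_le hx.1
    have h2 := hx.2
    exact ⟨by positivity, by gcongr⟩
  have hL : MemLp (fun x : ℝ => x ^ 2) 2 ν := by
    refine MemLp.of_bound (by fun_prop) (φmax ^ 2) ?_
    filter_upwards [hbd] with x hx
    rw [Real.norm_eq_abs, abs_of_nonneg hx.1]; exact hx.2
  have hsqint : Integrable (fun x : ℝ => x ^ 2) ν := hL.integrable (by norm_num)
  set π := (Measure.pi fun _ : Fin n => ν) with hπ
  have hLi : ∀ i : Fin n, MemLp (fun ψ : Fin n → ℝ => ψ i ^ 2) 2 π := by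
    intro i
    exact hL.comp_measurePreserving (measurePreserving_eval (fun _ : Fin n => ν) i)
  have hLs : MemLp (fun ψ : Fin n → ℝ => ∑ i, ψ i ^ 2) 2 π :=
    memLp_finsetSum _ (fun i _ => hLi i)
  have hmean : ∫ ψ, (∑ i, ψ i ^ 2) ∂π = n * m := by
    rw [integral_finsetSum _ (fun i _ => (hLi i).integrable (by norm_num))]
    have : ∀ i : Fin n, ∫ ψ, ψ i ^ 2 ∂π = m := by
      intro i
      rw [hm]
      exact integral_comp_eval (μ := fun _ : Fin n => ν) (i := i) (f := fun x : ℝ => x ^ 2) (by fun_prop)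
    simp [this]
  have hvar : variance (fun ψ : Fin n → ℝ => ∑ i, ψ i ^ 2) π ≤ n * (φmax ^ 2 / 2) ^ 2 := by
    have h1 := variance_sum_pi (μ := fun _ : Fin n => ν) (X := fun _ x => x ^ 2) (fun _ => hL)
    have h2 : (∑ i : Fin n, fun ψ : Fin n → ℝ => ψ i ^ 2) = fun ψ => ∑ i, ψ i ^ 2 := by
      ext ψ; simp
    rw [h2] at h1
    rw [hπ, h1]
    have h3 : variance (fun x : ℝ => x ^ 2) ν ≤ ((φmax ^ 2 - 0) / 2) ^ 2 :=
      variance_le_sq_of_bounded hbd hsqint.aemeasurable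
    rw [sub_zero] at h3
    simp only [Finset.sum_const, Finset.card_univ, Fintype.card_fin, nsmul_eq_mul]
    gcongr
  set w := Real.sqrt n with hw
  have hw0 : 0 < w := Real.sqrt_pos.mpr hn0
  have hww : w ^ 2 = n := Real.sq_sqrt hn0.le
  have hc : 0 < K * w * m := by positivity
  have hch := meas_ge_le_variance_div_sq hLs hc
  rw [hmean] at hch
  have hsub : {ψ : Fin n → ℝ | ¬ (1 / m) * ((∑ u, ψ u ^ 2) / n) ≤ 1 + K / w}
      ⊆ {ψ | K * w * m ≤ |∑ i, ψ i ^ 2 - n * m|} := by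
    intro ψ hψ
    simp only [Set.mem_setOf_eq, not_le] at hψ ⊢
    refine le_trans ?_ (le_abs_self _)
    have h1 : (1 + K / w) * (n * m) < ∑ u, ψ u ^ 2 := by
      have : (∑ u, ψ u ^ 2) = (1 / m) * ((∑ u, ψ u ^ 2) / n) * (n * m) := by field_simp
      rw [this]
      exact mul_lt_mul_of_pos_right hψ (by positivity)
    have h2 : (1 + K / w) * (n * m) = n * m + K * w * m := by
      rw [← hww]; field_simp
    linarith
  have h3 : π.real {ψ : Fin n → ℝ | ¬ (1 / m) * ((∑ u, ψ u ^ 2) / n) ≤ 1 + K / w}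
      ≤ variance (fun ψ : Fin n → ℝ => ∑ i, ψ i ^ 2) π / (K * w * m) ^ 2 := by
    apply ENNReal.toReal_le_of_le_ofReal
    · exact div_nonneg (variance_nonneg _ _) (by positivity)
    · exact (measure_mono hsub).trans hch
  refine h3.trans ?_
  calc variance (fun ψ : Fin n → ℝ => ∑ i, ψ i ^ 2) π / (K * w * m) ^ 2
      ≤ (n * (φmax ^ 2 / 2) ^ 2) / (K * w * m) ^ 2 := by gcongr
    _ = _ := by rw [← hww]; field_simp

/-- Averaged correlation, integrated over weights. -/
lemma int_corr (a b φmin φmax K : ℝ) (ha : 0 < a) (hb : 0 < b) (hφmin : 0 < φmin)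
    (hφ : φmin ≤ φmax) (hK : 0 < K)
    (ν : Measure ℝ) [IsProbabilityMeasure ν]
    (hsupp : ∀ᵐ x ∂ν, x ∈ Set.Icc φmin φmax) (m : ℝ) (hm : m = ∫ x, x ^ 2 ∂ν) (hm0 : 0 < m)
    (hthresh : (a - b) ^ 2 * m ≤ 2 * (a + b)) :
    ∃ C : ℝ, 0 ≤ C ∧ ∀ n : ℕ, 1 ≤ n → φmax ^ 2 * (a + b) ≤ n → ∀ t : ℝ, 0 < t →
      1 / (n:ℝ) ^ 2 * ∑ u, ∑ v, ∫ ψ, corr a b n ψ u v ∂(Measure.pi fun _ : Fin n => ν)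
        ≤ φmax ^ 2 / φmin ^ 2 * (t / 2) + C / t * rate n + (φmax ^ 2 / 2) ^ 2 / m ^ 2 / K ^ 2 := by
  have hκ : (a - b) ^ 2 / (2 * (a + b)) ≤ 1 / m := by
    rw [div_le_div_iff₀ (by positivity) hm0]; linarith
  obtain ⟨C, hC0, hC⟩ := corr_avg a b φmin φmax (1 / m) K ha hb hφmin hφ (by positivity) hκ hK
  refine ⟨C, hC0, ?_⟩
  intro n hn hbig t ht
  have hn0 : (0:ℝ) < n := by exact_mod_cast hn
  set π := (Measure.pi fun _ : Fin n => ν) with hπ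
  set bad := {ψ : Fin n → ℝ | ¬ (1 / m) * ((∑ u, ψ u ^ 2) / n) ≤ 1 + K / Real.sqrt n} with hbad
  have hbadm : MeasurableSet bad := by
    have hm' : MeasurableSet {ψ : Fin n → ℝ |
        (1 / m) * ((∑ u, ψ u ^ 2) / n) ≤ 1 + K / Real.sqrt n} :=
      measurableSet_le (by fun_prop) (by fun_prop)
    exact hm'.compl
  set R := φmax ^ 2 / φmin ^ 2 * (t / 2) + C / t * rate n with hR
  have hrate : 0 ≤ rate n := tsum_nonneg fun k => by positivity
  have hR0 : 0 ≤ R := by positivity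
  have hci := corr_integrable a b φmin φmax ha hb hφmin ν hsupp n hn hbig
  have e1 : 1 / (n:ℝ) ^ 2 * ∑ u, ∑ v, ∫ ψ, corr a b n ψ u v ∂π
      = ∫ ψ, 1 / (n:ℝ) ^ 2 * ∑ u, ∑ v, corr a b n ψ u v ∂π := by
    rw [integral_const_mul, integral_finsetSum _ (fun u _ => integrable_finsetSum _ (fun v _ => hci u v))]
    congr 1
    apply Finset.sum_congr rfl
    intro u _
    rw [integral_finsetSum _ (fun v _ => hci u v)]
  rw [e1]
  have hI : Integrable (fun ψ => R + bad.indicator (fun _ => (1:ℝ)) ψ) π :=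
    (integrable_const R).add ((integrable_const (1:ℝ)).indicator hbadm)
  have h2 : ∫ ψ, 1 / (n:ℝ) ^ 2 * ∑ u, ∑ v, corr a b n ψ u v ∂π
      ≤ ∫ ψ, (R + bad.indicator (fun _ => (1:ℝ)) ψ) ∂π := by
    apply integral_mono_ae _ hI
    · filter_upwards [pi_supp φmin φmax ν hsupp n] with ψ hψ
      by_cases hb' : ψ ∈ bad
      · rw [Set.indicator_of_mem hb']
        have : 1 / (n:ℝ) ^ 2 * ∑ u, ∑ v, corr a b n ψ u v ≤ 1 := by
          have : ∑ u : Fin n, ∑ v : Fin n, corr a b n ψ u v ≤ ∑ u : Fin n, ∑ v : Fin n, (1:ℝ) :=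
            Finset.sum_le_sum fun u _ => Finset.sum_le_sum fun v _ =>
              corr_le_one a b φmin φmax ha hb hφmin n hn hbig ψ hψ u v
          simp only [Finset.sum_const, Finset.card_univ, Fintype.card_fin, nsmul_eq_mul, mul_one] at this
          rw [one_div, inv_mul_le_iff₀ (by positivity)]
          linarith
        linarith
      · rw [Set.indicator_of_notMem hb', add_zero]
        have hg : (1 / m) * ((∑ u, ψ u ^ 2) / n) ≤ 1 + K / Real.sqrt n := by
          by_contra h; exact hb' h
        exact hC n hn hbig ψ hψ hg t ht
    · exact (integrable_finsetSum _ (fun u _ => integrable_finsetSum _ (fun v _ => hci u v))).const_mul _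
  refine h2.trans ?_
  rw [integral_add (integrable_const R) ((integrable_const (1:ℝ)).indicator hbadm), integral_indicator hbadm]
  simp only [integral_const, smul_eq_mul, mul_one, probReal_univ, one_mul, measureReal_restrict_apply_univ]
  have := bad_weights φmin φmax K hφmin hK ν hsupp m hm hm0 n hn
  linarith

/-- Transfer to the model. -/
lemma model_bound (a b φmin φmax : ℝ) (ha : 0 < a) (hb : 0 < b) (hφmin : 0 < φmin)
    (ν : Measure ℝ) [IsProbabilityMeasure ν]
    (hsupp : ∀ᵐ x ∂ν, x ∈ Set.Icc φmin φmax)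
    (n : ℕ) (hn : 1 ≤ n) (hbig : φmax ^ 2 * (a + b) ≤ n)
    {Ω : Type} [mΩ : MeasurableSpace Ω] (P : Measure Ω) (spin : Ω → Fin n → Bool)
    (wt : Ω → Fin n → ℝ) (adj : Ω → Fin n → Fin n → Bool)
    (hmod : IsDCPPM a b ν n P spin wt adj) (u v : Fin n) (ε : ℝ) (hε : 0 < ε) :
    (P {ω | ε < |(P[(fun ω' => if spin ω' u = true then (1 : ℝ) else 0)|
        MeasurableSpace.comap (fun ω' => (spin ω' v, adj ω')) inferInstance]) ω - 1 / 2|}).toReal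
      ≤ 1 / (2 * ε) * ∫ ψ, corr a b n ψ u v ∂(Measure.pi fun _ : Fin n => ν) := by
  classical
  obtain ⟨hP, hspin, hwt, hadj, hsym, hloop, hlaw⟩ := hmod
  set π := (Measure.pi fun _ : Fin n => ν) with hπ
  set Z : Ω → Bool × (Fin n → Fin n → Bool) := fun ω' => (spin ω' v, adj ω') with hZ
  have hZm : Measurable Z := ((measurable_pi_apply v).comp hspin).prodMk hadj
  have hmle : MeasurableSpace.comap Z inferInstance ≤ mΩ := hZm.comap_le
  set X : Ω → ℝ := fun ω' => if spin ω' u = true then (1 : ℝ) else 0 with hX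
  have hXm : Measurable X := by
    have h1 : Measurable (fun c : Bool => if c = true then (1:ℝ) else 0) := measurable_of_finite _
    exact h1.comp ((measurable_pi_apply u).comp hspin)
  have hXi : Integrable X P := by
    refine Integrable.of_bound hXm.aestronglyMeasurable 1 (ae_of_all _ fun ω => ?_)
    simp only [hX]; split_ifs <;> simp
  set Y : Ω → ℝ := P[X|MeasurableSpace.comap Z inferInstance] with hY
  have hYi : Integrable Y P := integrable_condExp
  obtain ⟨f, hf, hfY⟩ := (stronglyMeasurable_condExp (μ := P) (m := MeasurableSpace.comap Z inferInstance) (f := X)).exists_eq_measurable_comp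
  -- sign function
  set h : Bool × (Fin n → Fin n → Bool) → ℝ := fun z => if 1 / 2 ≤ f z then 1 else -1 with hh
  have hhabs : ∀ z, |h z| = 1 := by
    intro z; simp only [hh]; split_ifs <;> simp
  have hhm : Measurable h := measurable_of_finite _
  have habsY : ∀ ω, |Y ω - 1 / 2| = h (Z ω) * (Y ω - 1 / 2) := by
    intro ω
    have : Y ω = f (Z ω) := congrFun hfY ω
    simp only [hh, ← this]
    split_ifs with hc
    · rw [abs_of_nonneg (by linarith), one_mul]
    · rw [abs_of_neg (by linarith)]; ring
  have hhZi : Integrable (fun ω => h (Z ω)) P := by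
    refine Integrable.of_bound (hhm.comp hZm).aestronglyMeasurable 1 (ae_of_all _ fun ω => ?_)
    rw [Real.norm_eq_abs, hhabs]
  have hhYi : Integrable (fun ω => h (Z ω) * Y ω) P :=
    hYi.bdd_mul (hhm.comp hZm).aestronglyMeasurable (c := 1) (ae_of_all _ fun ω => by
      simp [hhabs])
  have hhXi : Integrable (fun ω => h (Z ω) * X ω) P :=
    hXi.bdd_mul (hhm.comp hZm).aestronglyMeasurable (c := 1) (ae_of_all _ fun ω => by
      simp [hhabs])
  have hpull : ∫ ω, h (Z ω) * Y ω ∂P = ∫ ω, h (Z ω) * X ω ∂P := by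
    have hsm : StronglyMeasurable[MeasurableSpace.comap Z inferInstance] (fun ω => h (Z ω)) := by
      have : Measurable[MeasurableSpace.comap Z inferInstance] Z := comap_measurable Z
      exact (hhm.comp this).stronglyMeasurable
    have h1 := condExp_mul_of_stronglyMeasurable_left (μ := P) (m := MeasurableSpace.comap Z inferInstance) hsm (g := X) hhXi hXi
    have h2 := integral_condExp (μ := P) hmle (f := (fun ω => h (Z ω)) * X)
    rw [integral_congr_ae h1] at h2
    exact h2
  have hE : ∫ ω, |Y ω - 1 / 2| ∂P = 1 / 2 * ∫ ω, h (Z ω) * sg (spin ω u) ∂P := by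
    have e1 : ∀ ω, |Y ω - 1 / 2| = h (Z ω) * Y ω - 1 / 2 * h (Z ω) := by
      intro ω; rw [habsY]; ring
    simp_rw [e1]
    rw [integral_sub hhYi (hhZi.const_mul _), hpull, ← integral_sub hhXi (hhZi.const_mul _),
      ← integral_const_mul]
    congr 1
    ext ω
    simp only [hX, sg]
    split_ifs <;> ring
  -- law of (spin, adj)
  set W : Ω → (Fin n → Bool) × (Fin n → Fin n → Bool) := fun ω => (spin ω, adj ω) with hW
  have hWm : Measurable W := hspin.prodMk hadj
  have hsum : ∫ ω, h (Z ω) * sg (spin ω u) ∂P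
      = ∑ g : Fin n → Fin n → Bool, ∑ τ : Fin n → Bool,
        P.real {ω | spin ω = τ ∧ adj ω = g} * (h (τ v, g) * sg (τ u)) := by
    set F : (Fin n → Bool) × (Fin n → Fin n → Bool) → ℝ := fun p => h (p.1 v, p.2) * sg (p.1 u) with hF
    have hFm : Measurable F := measurable_of_finite _
    have e1 : ∫ ω, h (Z ω) * sg (spin ω u) ∂P = ∫ p, F p ∂(P.map W) := by
      rw [integral_map hWm.aemeasurable hFm.aestronglyMeasurable]
    have : IsProbabilityMeasure (P.map W) := Measure.isProbabilityMeasure_map hWm.aemeasurable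
    rw [e1, integral_fintype Integrable.of_finite, Fintype.sum_prod_type, Finset.sum_comm]
    apply Finset.sum_congr rfl; intro g _
    apply Finset.sum_congr rfl; intro τ _
    rw [map_measureReal_apply hWm (measurableSet_singleton _), smul_eq_mul]
    congr 2
    ext ω
    simp [hW]
  have hmass : ∀ g : Fin n → Fin n → Bool, (∀ u v, g u v = g v u) → (∀ u, g u u = false) →
      ∀ τ, P.real {ω | spin ω = τ ∧ adj ω = g} = ∫ ψ, den a b n (fun p => g p.1.1 p.1.2) τ ψ ∂π := by
    intro g hg1 hg2 τ
    have h1 := hlaw τ g hg1 hg2 Set.univ MeasurableSet.univ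
    simp only [Set.mem_univ, and_true, Measure.restrict_univ] at h1
    rw [integral_eq_lintegral_of_nonneg_ae]
    · rw [measureReal_def, h1]
      simp_rw [configDensity_eq]
    · filter_upwards [pi_supp φmin φmax ν hsupp n] with ψ hψ
      exact den_nonneg a b φmin φmax ha hb hφmin n hn hbig ψ hψ _ τ
    · exact (den_meas a b n _ τ).aestronglyMeasurable
  have hdi := den_integrable a b φmin φmax ha hb hφmin ν hsupp n hn hbig
  set J : (↥(vertexPairs n) → Bool) → ℝ := fun γ =>
    ∫ ψ, |∑ τ : Fin n → Bool, sg (τ u) * sg (τ v) * den a b n γ τ ψ| ∂π with hJ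
  have hJ0 : ∀ γ, 0 ≤ J γ := fun γ => integral_nonneg fun ψ => abs_nonneg _
  have hgood : ∀ g : Fin n → Fin n → Bool, (∀ u v, g u v = g v u) → (∀ u, g u u = false) →
      ∑ τ : Fin n → Bool, P.real {ω | spin ω = τ ∧ adj ω = g} * (h (τ v, g) * sg (τ u))
        ≤ J (fun p => g p.1.1 p.1.2) := by
    intro g hg1 hg2
    simp_rw [hmass g hg1 hg2]
    set γ : ↥(vertexPairs n) → Bool := fun p => g p.1.1 p.1.2 with hγ
    have hdec : ∀ c : Bool, h (c, g) = (h (true, g) + h (false, g)) / 2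
        + sg c * ((h (true, g) - h (false, g)) / 2) := by
      intro c; cases c <;> simp [sg] <;> ring
    have hodd : ∑ τ : Fin n → Bool, sg (τ u) * ∫ ψ, den a b n γ τ ψ ∂π = 0 := by
      simp_rw [← integral_const_mul]
      rw [← integral_finsetSum _ (fun τ _ => (hdi γ τ).const_mul _)]
      simp_rw [den_odd]
      simp
    have heven : ∑ τ : Fin n → Bool, sg (τ u) * sg (τ v) * ∫ ψ, den a b n γ τ ψ ∂π
        = ∫ ψ, ∑ τ : Fin n → Bool, sg (τ u) * sg (τ v) * den a b n γ τ ψ ∂π := by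
      simp_rw [← integral_const_mul]
      rw [← integral_finsetSum _ (fun τ _ => (hdi γ τ).const_mul _)]
    have e1 : ∑ τ : Fin n → Bool, (∫ ψ, den a b n γ τ ψ ∂π) * (h (τ v, g) * sg (τ u))
        = (h (true, g) + h (false, g)) / 2 * ∑ τ : Fin n → Bool, sg (τ u) * ∫ ψ, den a b n γ τ ψ ∂π
        + (h (true, g) - h (false, g)) / 2 *
          ∑ τ : Fin n → Bool, sg (τ u) * sg (τ v) * ∫ ψ, den a b n γ τ ψ ∂π := by
      rw [Finset.mul_sum, Finset.mul_sum, ← Finset.sum_add_distrib]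
      apply Finset.sum_congr rfl; intro τ _
      rw [hdec (τ v)]; ring
    rw [e1, hodd, mul_zero, zero_add, heven]
    refine (le_abs_self _).trans ?_
    rw [abs_mul]
    have h1 : |(h (true, g) - h (false, g)) / 2| ≤ 1 := by
      have h1 := abs_le.mp (hhabs (true, g)).le
      have h2 := abs_le.mp (hhabs (false, g)).le
      rw [abs_le]; constructor <;> linarith [h1.1, h1.2, h2.1, h2.2]
    calc _ ≤ 1 * |∫ ψ, ∑ τ : Fin n → Bool, sg (τ u) * sg (τ v) * den a b n γ τ ψ ∂π| :=
          mul_le_mul_of_nonneg_right h1 (abs_nonneg _)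
      _ ≤ _ := by rw [one_mul]; exact abs_integral_le_integral_abs
  set Gs : Finset (Fin n → Fin n → Bool) :=
    Finset.univ.filter (fun g => (∀ u v, g u v = g v u) ∧ (∀ u, g u u = false)) with hGs
  have hinj : Set.InjOn (fun (g : Fin n → Fin n → Bool) (p : ↥(vertexPairs n)) => g p.1.1 p.1.2) Gs := by
    intro g hg g' hg' he
    simp only [hGs, Finset.coe_filter, Finset.mem_univ, true_and, Set.mem_setOf_eq] at hg hg'
    have key : ∀ i j, i < j → g i j = g' i j := by
      intro i j hij
      exact congrFun he ⟨(i, j), by simp [vertexPairs, hij]⟩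
    funext i j
    rcases lt_trichotomy i j with hij | hij | hij
    · exact key i j hij
    · subst hij; rw [hg.2, hg'.2]
    · rw [hg.1, hg'.1]; exact key j i hij
  have htot : ∫ ω, h (Z ω) * sg (spin ω u) ∂P ≤ ∫ ψ, corr a b n ψ u v ∂π := by
    rw [hsum]
    calc ∑ g : Fin n → Fin n → Bool, ∑ τ : Fin n → Bool,
        P.real {ω | spin ω = τ ∧ adj ω = g} * (h (τ v, g) * sg (τ u))
        = ∑ g ∈ Gs, ∑ τ : Fin n → Bool,
        P.real {ω | spin ω = τ ∧ adj ω = g} * (h (τ v, g) * sg (τ u)) := by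
          symm
          apply Finset.sum_subset (Finset.subset_univ _)
          intro g _ hg
          apply Finset.sum_eq_zero
          intro τ _
          have : {ω | spin ω = τ ∧ adj ω = g} = ∅ := by
            ext ω
            simp only [Set.mem_setOf_eq, Set.mem_empty_iff_false, iff_false, not_and]
            intro _ hag
            apply hg
            rw [hGs, Finset.mem_filter, ← hag]
            exact ⟨Finset.mem_univ _, hsym ω, hloop ω⟩
          rw [this]; simp
      _ ≤ ∑ g ∈ Gs, J (fun p => g p.1.1 p.1.2) := by
          apply Finset.sum_le_sum
          intro g hg
          simp only [hGs, Finset.mem_filter, Finset.mem_univ, true_and] at hg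
          exact hgood g hg.1 hg.2
      _ = ∑ γ ∈ Gs.image (fun (g : Fin n → Fin n → Bool) (p : ↥(vertexPairs n)) => g p.1.1 p.1.2), J γ := by
          rw [Finset.sum_image hinj]
      _ ≤ ∑ γ, J γ := Finset.sum_le_sum_of_subset_of_nonneg (Finset.subset_univ _) (fun γ _ _ => hJ0 γ)
      _ = _ := by
          unfold corr
          rw [integral_finsetSum]
          intro γ _
          exact (integrable_finsetSum _ fun τ _ => (hdi γ τ).const_mul _).abs
  have hYi' : Integrable (fun ω => |Y ω - 1 / 2|) P := (hYi.sub (integrable_const _)).abs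
  have hmark := mul_meas_ge_le_integral_of_nonneg (μ := P) (ae_of_all _ fun ω => abs_nonneg (Y ω - 1 / 2)) hYi' ε
  have hle : (P {ω | ε < |Y ω - 1 / 2|}).toReal ≤ P.real {ω | ε ≤ |Y ω - 1 / 2|} :=
    measureReal_mono (by intro ω hω; exact le_of_lt (show ε < |Y ω - 1 / 2| from hω))
  have hfin : ε * (P {ω | ε < |Y ω - 1 / 2|}).toReal ≤ 1 / 2 * ∫ ψ, corr a b n ψ u v ∂π := by
    calc _ ≤ ε * P.real {ω | ε ≤ |Y ω - 1 / 2|} := mul_le_mul_of_nonneg_left hle hε.le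
      _ ≤ ∫ ω, |Y ω - 1 / 2| ∂P := hmark
      _ ≤ _ := by rw [hE]; gcongr
  have e : 1 / (2 * ε) * ∫ ψ, corr a b n ψ u v ∂π = (1 / 2 * ∫ ψ, corr a b n ψ u v ∂π) / ε := by
    field_simp
  rw [e, le_div_iff₀ hε, mul_comm]
  exact hfin

end DCP

/-- **No information about the spin of a vertex below the threshold.**
Assume `((a+b)/2)·Φ⁽²⁾ ≥ 1` and `(a-b)²·Φ⁽²⁾ ≤ 2(a+b)`.  Let `G` be an instance of the DC-PPM
on `n` vertices and let `u, v` be independently uniformly chosen vertices.  Then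
`P(σ_u = + | σ_v, G)` converges to `1/2` in probability as `n → ∞`: for every `ε > 0`, the
probability (over the graph and the uniform choice of `u, v`) that the conditional probability
of `{σ_u = +}` given the σ-algebra generated by `(σ_v, G)` deviates from `1/2` by more than
`ε` tends to `0`. -/
theorem stmt1
    (a b φmin φmax : ℝ) (ha : 0 < a) (hb : 0 < b)
    (hφmin : 0 < φmin) (hφ : φmin ≤ φmax)
    (ν : Measure ℝ) (hν : IsProbabilityMeasure ν)
    (hsupp : ∀ᵐ x ∂ν, x ∈ Set.Icc φmin φmax)
    (hgiant : 1 ≤ (a + b) / 2 * ∫ x, x ^ 2 ∂ν)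
    (hthresh : (a - b) ^ 2 * (∫ x, x ^ 2 ∂ν) ≤ 2 * (a + b))
    (Ω : ℕ → Type) [mΩ : ∀ n, MeasurableSpace (Ω n)]
    (P : ∀ n, Measure (Ω n))
    (spin : ∀ n, Ω n → Fin n → Bool) (wt : ∀ n, Ω n → Fin n → ℝ)
    (adj : ∀ n, Ω n → Fin n → Fin n → Bool)
    (hmodel : ∀ᶠ n in atTop, IsDCPPM a b ν n (P n) (spin n) (wt n) (adj n)) :
    ∀ ε : ℝ, 0 < ε →
      Tendsto
        (fun (n : ℕ) => (1 / (n : ℝ) ^ 2) * ∑ u : Fin n, ∑ v : Fin n,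
          ((P n) {ω | ε <
            |((P n)[(fun ω' => if spin n ω' u = true then (1 : ℝ) else 0)|
                MeasurableSpace.comap (fun ω' => (spin n ω' v, adj n ω'))
                  inferInstance]) ω - 1 / 2|}).toReal)
        atTop (𝓝 0) := by
  classical
  intro ε hε
  set m := ∫ x, x ^ 2 ∂ν with hm
  have hm0 : 0 < m := by
    by_contra h
    push Not at h
    have : (a + b) / 2 * m ≤ 0 := mul_nonpos_of_nonneg_of_nonpos (by positivity) h
    linarith
  have hφmax : 0 < φmax := hφmin.trans_le hφ
  rw [tendsto_order]
  constructor
  · intro c hc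
    refine Eventually.of_forall fun n => lt_of_lt_of_le hc ?_
    exact mul_nonneg (by positivity)
      (Finset.sum_nonneg fun u _ => Finset.sum_nonneg fun v _ => ENNReal.toReal_nonneg)
  · intro η hη
    set V := (φmax ^ 2 / 2) ^ 2 / m ^ 2 with hV
    have hV0 : 0 < V := by positivity
    -- choose the parameters
    set δ := η * (2 * ε) / 4 with hδ
    have hδ0 : 0 < δ := by positivity
    set K := Real.sqrt (V / δ) with hKdef
    have hK0 : 0 < K := Real.sqrt_pos.mpr (by positivity)
    have hKK : V / K ^ 2 = δ := by
      rw [hKdef, Real.sq_sqrt (by positivity)]; field_simp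
    obtain ⟨C, hC0, hC⟩ := DCP.int_corr a b φmin φmax K ha hb hφmin hφ hK0 ν hsupp m hm hm0 hthresh
    set t := 2 * δ * φmin ^ 2 / φmax ^ 2 with ht
    have ht0 : 0 < t := by positivity
    have htt : φmax ^ 2 / φmin ^ 2 * (t / 2) = δ := by rw [ht]; field_simp
    have hr : Tendsto (fun n => C / t * DCP.rate n) atTop (𝓝 0) := by
      simpa using DCP.rate_tendsto.const_mul (C / t)
    filter_upwards [hmodel, eventually_ge_atTop 1, hr.eventually_lt_const hδ0,
      tendsto_natCast_atTop_atTop.eventually_ge_atTop (φmax ^ 2 * (a + b))] with n hmod hn hrn hbig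
    have h1 := hC n hn hbig t ht0
    rw [htt] at h1
    have h2 : (1 / (n : ℝ) ^ 2) * ∑ u : Fin n, ∑ v : Fin n,
          ((P n) {ω | ε <
            |((P n)[(fun ω' => if spin n ω' u = true then (1 : ℝ) else 0)|
                MeasurableSpace.comap (fun ω' => (spin n ω' v, adj n ω'))
                  inferInstance]) ω - 1 / 2|}).toReal
        ≤ 1 / (2 * ε) * (1 / (n:ℝ) ^ 2 * ∑ u, ∑ v,
            ∫ ψ, DCP.corr a b n ψ u v ∂(Measure.pi fun _ : Fin n => ν)) := by
      rw [mul_left_comm]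
      apply mul_le_mul_of_nonneg_left _ (by positivity)
      rw [Finset.mul_sum]
      apply Finset.sum_le_sum; intro u _
      rw [Finset.mul_sum]
      apply Finset.sum_le_sum; intro v _
      exact DCP.model_bound a b φmin φmax ha hb hφmin ν hsupp n hn hbig (P n) (spin n) (wt n) (adj n)
        hmod u v ε hε
    refine h2.trans_lt ?_
    rw [one_div, inv_mul_lt_iff₀ (by positivity)]
    have h3 : 2 * ε * η = 4 * δ := by rw [hδ]; ring
    rw [h3]
    have h4 : (φmax ^ 2 / 2) ^ 2 / m ^ 2 / K ^ 2 = δ := hKK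
    rw [h4] at h1
    linarith
end
end

section
/- Let G be an instance of the DC-PPM on n vertices and u a uniformly chosen vertex. Let A = A(G), B = B(G), C = C(G) be a (random) partition of V(G) with u ∈ A such that B separates A and C in G. If |A ∪ B| ≤ n^{1/8} for asymptotically almost every realization of G, then |P(σ_u = + | σ_{B∪C}, G, φ) - P(σ_u = + | σ_B, G_{A∪B}, φ_{A∪B})| = o_n(1) with probability 1 - o_n(1), where G_{A∪B} and φ_{A∪B} denote the restrictions of the graph and weights to A ∪ B; moreover the o_n(1) terms converge uniformly to 0. -/
noncomputable section

/-- The observed spins on a (random) set `S(ω)` of vertices, encoded as the set of pairs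
`(v, σ_v)` with `v ∈ S(ω)`. -/
def spinsOn {Ω : Type} {n : ℕ} (spin : Ω → Fin n → Bool) (S : Ω → Set (Fin n)) (ω : Ω) :
    Set (Fin n × Bool) :=
  {p | p.1 ∈ S ω ∧ spin ω p.1 = p.2}

/-- The restriction `G_S` of the observed graph to a (random) set `S(ω)` of vertices: the
vertex set together with the set of its internal edges. -/
def graphOn {Ω : Type} {n : ℕ} (adj : Ω → Fin n → Fin n → Bool) (S : Ω → Set (Fin n))
    (ω : Ω) : Set (Fin n) × Set (Fin n × Fin n) :=
  (S ω, {q | q.1 ∈ S ω ∧ q.2 ∈ S ω ∧ adj ω q.1 q.2 = true})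

open Classical in
/-- The weights observed on a (random) set `S(ω)` of vertices, extended by `0` elsewhere. -/
def wtOn {Ω : Type} {n : ℕ} (wt : Ω → Fin n → ℝ) (S : Ω → Set (Fin n)) (ω : Ω) :
    Fin n → ℝ :=
  fun v => if v ∈ S ω then wt ω v else 0

/-- The σ-algebra generated by `(σ_S, G, φ)`: the spins on `S`, the whole graph, and all the
weights. -/
def infoFull {Ω : Type} [MeasurableSpace Ω] {n : ℕ} (spin : Ω → Fin n → Bool)
    (wt : Ω → Fin n → ℝ) (adj : Ω → Fin n → Fin n → Bool) (S : Ω → Set (Fin n)) :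
    MeasurableSpace Ω :=
  MeasurableSpace.comap (spinsOn spin S) ⊤ ⊔ MeasurableSpace.comap adj inferInstance ⊔
    MeasurableSpace.comap wt inferInstance

/-- The σ-algebra generated by `(σ_S, G_{S'}, φ_{S'})`: the spins on `S`, the graph restricted
to `S'`, and the weights of the vertices of `S'`. -/
def infoLocal {Ω : Type} [MeasurableSpace Ω] {n : ℕ} (spin : Ω → Fin n → Bool)
    (wt : Ω → Fin n → ℝ) (adj : Ω → Fin n → Fin n → Bool) (S S' : Ω → Set (Fin n)) :
    MeasurableSpace Ω :=
  MeasurableSpace.comap (spinsOn spin S) ⊤ ⊔ MeasurableSpace.comap (graphOn adj S') ⊤ ⊔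
    MeasurableSpace.comap (wtOn wt S') inferInstance

open MeasureTheory ProbabilityTheory Filter Topology

namespace DCAux

open Classical in
/-- Resample the spins on `A`. -/
def mix {n : ℕ} (A : Set (Fin n)) (ρ τ : Fin n → Bool) : Fin n → Bool :=
  fun v => if v ∈ A then ρ v else τ v

lemma mix_mix {n : ℕ} (A : Set (Fin n)) (ρ ρ' τ τ' : Fin n → Bool) :
    mix A (mix A ρ τ') (mix A ρ' τ) = mix A ρ τ := by
  funext v; by_cases h : v ∈ A <;> simp [mix, h]

lemma mix_self {n : ℕ} (A : Set (Fin n)) (τ : Fin n → Bool) : mix A τ τ = τ := by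
  funext v; by_cases h : v ∈ A <;> simp [mix, h]

lemma mix_right {n : ℕ} (A : Set (Fin n)) (ρ ρ' τ : Fin n → Bool) :
    mix A ρ (mix A ρ' τ) = mix A ρ τ := by
  funext v; by_cases h : v ∈ A <;> simp [mix, h]

lemma mix_swap1 {n : ℕ} (A : Set (Fin n)) (ρ τ : Fin n → Bool) :
    mix A (mix A τ ρ) (mix A ρ τ) = τ := by
  funext v; by_cases h : v ∈ A <;> simp [mix, h]

lemma bayes {n : ℕ} (A : Set (Fin n)) (D X h : (Fin n → Bool) → ℝ) (hD : ∀ τ, 0 < D τ)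
    (hh : ∀ ρ τ, h (mix A ρ τ) = h τ) (hX : ∀ ρ τ, X (mix A ρ τ) = X ρ) :
    ∑ τ, h τ * D τ * ((∑ ρ, X ρ * D (mix A ρ τ)) / (∑ ρ, D (mix A ρ τ)))
      = ∑ τ, h τ * D τ * X τ := by
  set Z : (Fin n → Bool) → ℝ := fun τ => ∑ ρ, D (mix A ρ τ) with hZ
  have hZm : ∀ ρ τ, Z (mix A ρ τ) = Z τ := by
    intro ρ τ; simp only [hZ, mix_right]
  have hZpos : ∀ τ, 0 < Z τ := fun τ => Finset.sum_pos (fun _ _ => hD _) Finset.univ_nonempty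
  calc ∑ τ, h τ * D τ * ((∑ ρ, X ρ * D (mix A ρ τ)) / Z τ)
      = ∑ q : (Fin n → Bool) × (Fin n → Bool),
          h q.1 * D q.1 * (X q.2 * D (mix A q.2 q.1)) / Z q.1 := by
        rw [Fintype.sum_prod_type]
        refine Finset.sum_congr rfl fun τ _ => ?_
        rw [Finset.sum_div, Finset.mul_sum]
        refine Finset.sum_congr rfl fun ρ _ => ?_
        ring
    _ = ∑ q : (Fin n → Bool) × (Fin n → Bool),
          h q.1 * D (mix A q.2 q.1) * (X q.1 * D q.1) / Z q.1 := by
        refine Finset.sum_nbij' (fun q => (mix A q.2 q.1, mix A q.1 q.2))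
          (fun q => (mix A q.2 q.1, mix A q.1 q.2)) (by simp) (by simp) ?_ ?_ ?_
        · intro q _; simp [mix_swap1]
        · intro q _; simp [mix_swap1]
        · intro q _
          simp only [mix_swap1, hh, hX, hZm]
    _ = ∑ τ, h τ * D τ * X τ := by
        rw [Fintype.sum_prod_type]
        refine Finset.sum_congr rfl fun τ _ => ?_
        have : ∀ ρ, h τ * D (mix A ρ τ) * (X τ * D τ) / Z τ
            = (h τ * D τ * X τ / Z τ) * D (mix A ρ τ) := fun ρ => by ring
        simp only [this]
        rw [← Finset.mul_sum]
        exact div_mul_cancel₀ _ (hZpos τ).ne'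

lemma ratio_close {ι : Type} [Fintype ι] [Nonempty ι] (X D L : ι → ℝ) (lo hi : ℝ)
    (hlo : 0 < lo) (hL : ∀ i, 0 < L i) (h1 : ∀ i, lo * L i ≤ D i) (h2 : ∀ i, D i ≤ hi * L i)
    (hX0 : ∀ i, 0 ≤ X i) (hX1 : ∀ i, X i ≤ 1) :
    |(∑ i, X i * D i) / (∑ i, D i) - (∑ i, X i * L i) / (∑ i, L i)| ≤ hi / lo - 1 := by
  have hZL : 0 < ∑ i, L i := Finset.sum_pos (fun i _ => hL i) Finset.univ_nonempty
  have hD : ∀ i, 0 < D i := fun i => lt_of_lt_of_le (mul_pos hlo (hL i)) (h1 i)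
  have hZD : 0 < ∑ i, D i := Finset.sum_pos (fun i _ => hD i) Finset.univ_nonempty
  set N := ∑ i, X i * D i
  set N' := ∑ i, X i * L i
  set Z := ∑ i, D i
  set Z' := ∑ i, L i
  have a1 : N ≤ hi * N' := by
    simp only [N, N', Finset.mul_sum]
    refine Finset.sum_le_sum fun i _ => ?_
    nlinarith [h2 i, hX0 i]
  have a2 : lo * N' ≤ N := by
    simp only [N, N', Finset.mul_sum]
    refine Finset.sum_le_sum fun i _ => ?_
    nlinarith [h1 i, hX0 i]
  have a3 : Z ≤ hi * Z' := by
    simp only [Z, Z', Finset.mul_sum]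
    exact Finset.sum_le_sum fun i _ => h2 i
  have a4 : lo * Z' ≤ Z := by
    simp only [Z, Z', Finset.mul_sum]
    exact Finset.sum_le_sum fun i _ => h1 i
  have hN'0 : 0 ≤ N' := Finset.sum_nonneg fun i _ => mul_nonneg (hX0 i) (hL i).le
  have hN'1 : N' ≤ Z' := Finset.sum_le_sum fun i _ => by nlinarith [hX1 i, hL i]
  have hhi : lo ≤ hi := by
    obtain ⟨i⟩ := ‹Nonempty ι›
    have := (h1 i).trans (h2 i)
    exact le_of_mul_le_mul_right this (hL i)
  have hhi0 : 0 < hi := hlo.trans_le hhi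
  set q := N' / Z' with hq
  have hq0 : 0 ≤ q := div_nonneg hN'0 hZL.le
  have hq1 : q ≤ 1 := (div_le_one hZL).2 hN'1
  have hqN : N' = q * Z' := by rw [hq]; field_simp
  have b1 : N / Z ≤ (hi / lo) * q := by
    rw [div_le_iff₀ hZD]
    have : (hi / lo) * q * (lo * Z') ≤ (hi / lo) * q * Z :=
      mul_le_mul_of_nonneg_left a4 (by positivity)
    have e : (hi / lo) * q * (lo * Z') = hi * N' := by rw [hqN]; field_simp
    linarith
  have b2 : (lo / hi) * q ≤ N / Z := by
    rw [le_div_iff₀ hZD]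
    have : (lo / hi) * q * Z ≤ (lo / hi) * q * (hi * Z') :=
      mul_le_mul_of_nonneg_left a3 (by positivity)
    have e : (lo / hi) * q * (hi * Z') = lo * N' := by rw [hqN]; field_simp
    linarith
  have hr1 : 1 ≤ hi / lo := (one_le_div hlo).2 hhi
  have hr2 : 1 - lo / hi ≤ hi / lo - 1 := by
    have : lo / hi * (hi / lo) = 1 := by field_simp
    have : 0 < lo / hi := by positivity
    nlinarith [sq_nonneg (hi / lo - 1)]
  have hr3 : lo / hi ≤ 1 := (div_le_one hhi0).2 hhi
  rw [abs_le]; constructor <;> nlinarith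

/-- symmetric loopless graphs -/
def Gs (n : ℕ) : Finset (Fin n → Fin n → Bool) :=
  Finset.univ.filter fun g => (∀ u v, g u v = g v u) ∧ (∀ u, g u u = false)

lemma gsum (a b : ℝ) (n : ℕ) (τ : Fin n → Bool) (ψ : Fin n → ℝ)
    (h0 : ∀ u v, 0 ≤ edgeProb a b n τ ψ u v) (h1 : ∀ u v, edgeProb a b n τ ψ u v ≤ 1) :
    ∑ g ∈ Gs n, configDensity a b n g τ ψ ≤ 1 / 2 ^ n := by
  unfold configDensity
  rw [← Finset.mul_sum]
  refine mul_le_of_le_one_right (by positivity) ?_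
  set x : Fin n × Fin n → ℝ := fun p => edgeProb a b n τ ψ p.1 p.2 with hx
  have key := Finset.prod_add x (fun p => 1 - x p) (vertexPairs n)
  have : ∏ p ∈ vertexPairs n, (x p + (1 - x p)) = 1 := by simp
  rw [this] at key
  refine le_of_le_of_eq ?_ key.symm
  have e : ∀ g : Fin n → Fin n → Bool, (∏ p ∈ vertexPairs n,
      if g p.1 p.2 = true then edgeProb a b n τ ψ p.1 p.2 else 1 - edgeProb a b n τ ψ p.1 p.2)
      = (fun t => (∏ i ∈ t, x i) * ∏ i ∈ vertexPairs n \ t, (1 - x i))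
        ((vertexPairs n).filter fun p => g p.1 p.2 = true) := by
    intro g
    rw [Finset.prod_ite]
    simp only [hx]
    congr 2
    ext p; simp; tauto
  rw [Finset.sum_congr rfl fun g _ => e g]
  rw [← Finset.sum_image (s := Gs n)
    (g := fun g : Fin n → Fin n → Bool => (vertexPairs n).filter fun p => g p.1 p.2 = true)
    (f := fun t => (∏ i ∈ t, x i) * ∏ i ∈ vertexPairs n \ t, (1 - x i))]
  · refine Finset.sum_le_sum_of_subset_of_nonneg ?_ ?_
    · intro t ht
      obtain ⟨g, _, rfl⟩ := Finset.mem_image.1 ht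
      simp
    · intro t _ _
      exact mul_nonneg (Finset.prod_nonneg fun p _ => h0 _ _)
        (Finset.prod_nonneg fun p _ => sub_nonneg.2 (h1 _ _))
  · intro g hg g' hg' heq
    simp only [Gs, Finset.coe_filter, Finset.mem_univ, true_and, Set.mem_ofPred_eq] at hg hg'
    have hlt : ∀ i j, i < j → g i j = g' i j := by
      intro i j hij
      have := Finset.ext_iff.1 heq (i, j)
      simp only [Finset.mem_filter, vertexPairs, Finset.mem_univ, true_and, hij] at this
      exact Bool.eq_iff_iff.2 this
    funext i j
    rcases lt_trichotomy i j with h | h | h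
    · exact hlt i j h
    · subst h; rw [hg.2, hg'.2]
    · rw [hg.1, hg'.1]; exact hlt j i h

/-- sign of a spin -/
def sg (b : Bool) : ℝ := if b then 1 else -1

lemma sg_sq (b : Bool) : sg b * sg b = 1 := by cases b <;> simp [sg]
lemma sg_abs (b : Bool) : |sg b| = 1 := by cases b <;> simp [sg]

lemma rademacher {n : ℕ} (ψ : Fin n → ℝ) :
    ∑ τ : Fin n → Bool, (∑ v, ψ v * sg (τ v)) ^ 2 = 2 ^ n * ∑ v, ψ v ^ 2 := by
  have hor : ∀ v w : Fin n, ∑ τ : Fin n → Bool, sg (τ v) * sg (τ w)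
      = if v = w then (2 : ℝ) ^ n else 0 := by
    intro v w
    split_ifs with h
    · subst h; simp [sg_sq]
    · have : ∑ τ : Fin n → Bool, sg (τ v) * sg (τ w)
          = ∑ τ : Fin n → Bool, -(sg (τ v) * sg (τ w)) := by
        refine Finset.sum_nbij' (fun τ => Function.update τ v (!τ v))
          (fun τ => Function.update τ v (!τ v)) (by simp) (by simp) (by simp) (by simp) ?_
        intro τ _
        have hw : w ≠ v := fun e => h e.symm
        simp only [Function.update_self, Function.update_of_ne hw]
        cases τ v <;> cases τ w <;> simp [sg]
      rw [Finset.sum_neg_distrib] at this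
      linarith
  have : ∀ τ : Fin n → Bool, (∑ v, ψ v * sg (τ v)) ^ 2
      = ∑ v, ∑ w, ψ v * ψ w * (sg (τ v) * sg (τ w)) := by
    intro τ
    rw [sq, Finset.sum_mul_sum]
    refine Finset.sum_congr rfl fun v _ => Finset.sum_congr rfl fun w _ => by ring
  simp only [this]
  rw [Finset.sum_comm, Finset.mul_sum]
  refine Finset.sum_congr rfl fun v _ => ?_
  rw [Finset.sum_comm]
  simp only [← Finset.mul_sum, hor]
  simp
  ring

lemma pair_sum {n : ℕ} (f : Fin n → Fin n → ℝ) (hf : ∀ i, f i i = 0) :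
    ∑ p ∈ vertexPairs n, (f p.1 p.2 + f p.2 p.1) = ∑ i, ∑ j, f i j := by
  rw [Finset.sum_add_distrib]
  have h2 : ∑ p ∈ vertexPairs n, f p.2 p.1
      = ∑ p ∈ Finset.univ.filter (fun p : Fin n × Fin n => p.2 < p.1), f p.1 p.2 := by
    refine Finset.sum_nbij' Prod.swap Prod.swap ?_ ?_ ?_ ?_ ?_ <;> simp [vertexPairs]
  rw [h2, vertexPairs, ← Fintype.sum_prod_type' , Finset.sum_filter, Finset.sum_filter,
    ← Finset.sum_add_distrib]
  refine Finset.sum_congr rfl fun p _ => ?_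
  rcases lt_trichotomy p.1 p.2 with h | h | h
  · simp [h, h.not_gt]
  · rw [h, hf]; simp
  · simp [h, h.not_gt]

/-- Posterior probability that `u` has spin `+` given all spins off `A`. -/
def Ff (a b : ℝ) (n : ℕ) (A : Set (Fin n)) (g : Fin n → Fin n → Bool) (τ : Fin n → Bool)
    (ψ : Fin n → ℝ) (u : Fin n) : ℝ :=
  (∑ ρ : Fin n → Bool, (if ρ u = true then (1 : ℝ) else 0) * configDensity a b n g (mix A ρ τ) ψ) /
    (∑ ρ : Fin n → Bool, configDensity a b n g (mix A ρ τ) ψ)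

lemma ep_nonneg {a b : ℝ} (ha : 0 < a) (hb : 0 < b) {n : ℕ} {τ : Fin n → Bool} {ψ : Fin n → ℝ}
    (h0 : ∀ v, 0 ≤ ψ v) (u v : Fin n) : 0 ≤ edgeProb a b n τ ψ u v := by
  unfold edgeProb
  have := h0 u
  have := h0 v
  split_ifs <;> positivity

lemma ep_le {a b φmax : ℝ} (ha : 0 < a) (hb : 0 < b) {n : ℕ} {τ : Fin n → Bool} {ψ : Fin n → ℝ}
    (h0 : ∀ v, 0 ≤ ψ v) (h1 : ∀ v, ψ v ≤ φmax) (u v : Fin n) :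
    edgeProb a b n τ ψ u v ≤ φmax ^ 2 * (a + b) / n := by
  unfold edgeProb
  have hu := h0 u
  have hv := h0 v
  have e : ψ u * ψ v ≤ φmax ^ 2 := by nlinarith [h1 u, h1 v]
  have : (if τ u = τ v then a else b) ≤ a + b := by split_ifs <;> linarith
  have h3 : 0 ≤ (if τ u = τ v then a else b) := by split_ifs <;> linarith
  calc ψ u * ψ v / n * (if τ u = τ v then a else b) ≤ φmax ^ 2 / n * (a + b) := by
        apply mul_le_mul _ this h3 (by positivity)
        gcongr
    _ = φmax ^ 2 * (a + b) / n := by ring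

lemma ep_symm (a b : ℝ) (n : ℕ) (τ : Fin n → Bool) (ψ : Fin n → ℝ) (u v : Fin n) :
    edgeProb a b n τ ψ u v = edgeProb a b n τ ψ v u := by
  unfold edgeProb
  rw [mul_comm (ψ u)]
  congr 1
  simp only [eq_comm]

/-- factor of a pair -/
def fac (a b : ℝ) (n : ℕ) (g : Fin n → Fin n → Bool) (τ : Fin n → Bool)
    (ψ : Fin n → ℝ) (p : Fin n × Fin n) : ℝ :=
  if g p.1 p.2 then edgeProb a b n τ ψ p.1 p.2 else 1 - edgeProb a b n τ ψ p.1 p.2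

lemma cd_eq (a b : ℝ) (n : ℕ) (g : Fin n → Fin n → Bool) (τ : Fin n → Bool)
    (ψ : Fin n → ℝ) : configDensity a b n g τ ψ
      = (1 / 2 ^ n) * ∏ p ∈ vertexPairs n, fac a b n g τ ψ p := rfl

lemma fac_pos {a b φmax : ℝ} (ha : 0 < a) (hb : 0 < b) {n : ℕ} (hn0 : 0 < n)
    (hn : 2 * (φmax ^ 2 * (a + b)) ≤ n)
    {g : Fin n → Fin n → Bool} {τ : Fin n → Bool} {ψ : Fin n → ℝ}
    (h0 : ∀ v, 0 ≤ ψ v) (h1 : ∀ v, ψ v ≤ φmax)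
    (hg : ∀ i j, g i j = true → 0 < ψ i ∧ 0 < ψ j) (p : Fin n × Fin n) :
    0 < fac a b n g τ ψ p := by
  have hn0' : (0 : ℝ) < n := by exact_mod_cast hn0
  unfold fac
  split_ifs with h
  · obtain ⟨x, y⟩ := hg _ _ h
    unfold edgeProb
    split_ifs <;> positivity
  · have := ep_le (τ := τ) ha hb h0 h1 p.1 p.2
    have h2 : φmax ^ 2 * (a + b) / n ≤ 1 / 2 := by
      rw [div_le_iff₀ hn0']; linarith
    linarith

lemma cd_pos {a b φmax : ℝ} (ha : 0 < a) (hb : 0 < b) {n : ℕ} (hn0 : 0 < n)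
    (hn : 2 * (φmax ^ 2 * (a + b)) ≤ n)
    {g : Fin n → Fin n → Bool} (τ : Fin n → Bool) {ψ : Fin n → ℝ}
    (h0 : ∀ v, 0 ≤ ψ v) (h1 : ∀ v, ψ v ≤ φmax)
    (hg : ∀ i j, g i j = true → 0 < ψ i ∧ 0 < ψ j) :
    0 < configDensity a b n g τ ψ := by
  rw [cd_eq]
  exact mul_pos (by positivity) (Finset.prod_pos fun p _ => fac_pos ha hb hn0 hn h0 h1 hg p)

lemma exp_lower {x c : ℝ} (hx0 : 0 ≤ x) (hx : x ≤ c) (hc : c ≤ 1 / 2) :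
    Real.exp (-(x + c ^ 2)) ≤ 1 - x := by
  have h1 : 0 < 1 - x := by linarith
  have h2 : x + x ^ 2 ≤ x + c ^ 2 := by nlinarith
  have h3 : (1 - x) * (1 + (x + x ^ 2) + (x + x ^ 2) ^ 2 / 2) ≥ 1 := by
    have e : (1 - x) * (1 + (x + x ^ 2) + (x + x ^ 2) ^ 2 / 2) = 1 + x ^ 2 / 2 * (1 - x - x ^ 2 - x ^ 3) := by ring
    have : 0 ≤ 1 - x - x ^ 2 - x ^ 3 := by nlinarith [mul_nonneg hx0 hx0, mul_nonneg (mul_nonneg hx0 hx0) hx0]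
    rw [e]; nlinarith [mul_nonneg (by positivity : 0 ≤ x ^ 2 / 2) this]
  have h4 : 1 + (x + x ^ 2) + (x + x ^ 2) ^ 2 / 2 ≤ Real.exp (x + x ^ 2) :=
    Real.quadratic_le_exp_of_nonneg (by positivity)
  calc Real.exp (-(x + c ^ 2)) ≤ Real.exp (-(x + x ^ 2)) := Real.exp_le_exp.2 (by linarith)
    _ = (Real.exp (x + x ^ 2))⁻¹ := Real.exp_neg _
    _ ≤ 1 - x := by
      rw [inv_le_comm₀ (Real.exp_pos _) h1, inv_eq_one_div, div_le_iff₀ h1]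
      nlinarith

lemma fac_congr {a b : ℝ} {n : ℕ} {g g' : Fin n → Fin n → Bool} {τ τ' : Fin n → Bool}
    {ψ ψ' : Fin n → ℝ} {p : Fin n × Fin n} (hg : g p.1 p.2 = g' p.1 p.2)
    (h1 : τ p.1 = τ' p.1) (h2 : τ p.2 = τ' p.2) (h3 : ψ p.1 = ψ' p.1) (h4 : ψ p.2 = ψ' p.2) :
    fac a b n g τ ψ p = fac a b n g' τ' ψ' p := by
  unfold fac edgeProb; rw [hg, h1, h2, h3, h4]

open Classical in
/-- crossing part of the exponent -/
def cr {n : ℕ} (A V : Set (Fin n)) (f : Fin n → Fin n → ℝ) (i j : Fin n) : ℝ :=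
  if i ∈ A ∧ j ∉ V then f i j else 0

open Classical in
lemma fac_bounds {a b φmin φmax : ℝ} (ha : 0 < a) (hb : 0 < b) (hmin : 0 < φmin)
    {n : ℕ} (hn0 : 0 < n) (hn : 2 * (φmax ^ 2 * (a + b)) ≤ n)
    {g gE : Fin n → Fin n → Bool} (hsym : ∀ u v, g u v = g v u)
    {A V : Set (Fin n)} (hAV : A ⊆ V) (hsep : ∀ i ∈ A, ∀ j ∉ V, g i j = false)
    {τ ρ : Fin n → Bool} {ψ w : Fin n → ℝ} (h0 : ∀ v, φmin ≤ ψ v) (h1 : ∀ v, ψ v ≤ φmax)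
    (hgE : ∀ i j, gE i j = true ↔ i ∈ V ∧ j ∈ V ∧ g i j = true)
    (hw1 : ∀ v ∈ V, w v = ψ v) (hw0 : ∀ v ∉ V, w v = 0) (p : Fin n × Fin n) :
    let r := if (p.1 ∈ V ∧ p.2 ∈ V) ∨ (p.1 ∈ A ∧ p.2 ∉ V) ∨ (p.2 ∈ A ∧ p.1 ∉ V) then 1
      else fac a b n g τ ψ p
    let E := edgeProb a b n (mix A ρ τ) ψ
    let K : Fin n → Fin n → ℝ := fun _ _ => (φmax ^ 2 * (a + b) / n) ^ 2
    fac a b n g (mix A ρ τ) ψ p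
      ≤ fac a b n gE (mix A ρ τ) w p * r * Real.exp (-(cr A V E p.1 p.2 + cr A V E p.2 p.1)) ∧
    fac a b n gE (mix A ρ τ) w p * r * Real.exp (-(cr A V E p.1 p.2 + cr A V E p.2 p.1
        + (cr A V K p.1 p.2 + cr A V K p.2 p.1)))
      ≤ fac a b n g (mix A ρ τ) ψ p := by
  have hn0' : (0 : ℝ) < n := by exact_mod_cast hn0
  intro r E K
  have hψ0 : ∀ v, 0 ≤ ψ v := fun v => hmin.le.trans (h0 v)
  have hc : φmax ^ 2 * (a + b) / n ≤ 1 / 2 := by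
    rw [div_le_iff₀ hn0']; linarith
  have hE0 : ∀ i j, 0 ≤ E i j := ep_nonneg ha hb hψ0
  have hE1 : ∀ i j, E i j ≤ φmax ^ 2 * (a + b) / n := ep_le ha hb hψ0 h1
  have hEs : ∀ i j, E i j = E j i := ep_symm _ _ _ _ _
  have offV : ¬ (p.1 ∈ V ∧ p.2 ∈ V) → fac a b n gE (mix A ρ τ) w p = 1 := by
    intro h
    have hg : ¬ (gE p.1 p.2 = true) := by rw [hgE]; tauto
    have hz : w p.1 * w p.2 = 0 := by
      rcases not_and_or.1 h with h | h <;> simp [hw0 _ h]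
    simp [fac, hg, edgeProb, hz]
  have main : ∀ i j, i ∈ A → j ∉ V → (p = (i, j) ∨ p = (j, i)) →
      fac a b n g (mix A ρ τ) ψ p = 1 - E i j := by
    rintro i j hi hj (rfl | rfl)
    · simp [fac, hsep i hi j hj, E]
    · simp only [fac, hsym j i, hsep i hi j hj, ep_symm _ _ _ _ _ j i]; simp [E]
  have up : ∀ x : ℝ, 1 - x ≤ Real.exp (-x) := fun x => by
    have := Real.add_one_le_exp (-x); linarith
  by_cases hV : p.1 ∈ V ∧ p.2 ∈ V
  · have hr : r = 1 := by simp only [r]; rw [if_pos (Or.inl hV)]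
    have e : fac a b n g (mix A ρ τ) ψ p = fac a b n gE (mix A ρ τ) w p := by
      refine fac_congr ?_ rfl rfl (hw1 _ hV.1).symm (hw1 _ hV.2).symm
      apply Bool.eq_iff_iff.2; rw [hgE]; tauto
    simp [hr, e, cr, hV.1, hV.2]
  · rw [offV hV]
    by_cases c1 : p.1 ∈ A ∧ p.2 ∉ V
    · have hr : r = 1 := by simp only [r]; rw [if_pos (Or.inr (Or.inl c1))]
      have c2 : ¬ (p.2 ∈ A ∧ p.1 ∉ V) := fun h => c1.2 (hAV h.1)
      rw [main _ _ c1.1 c1.2 (Or.inl rfl)]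
      simp only [hr, cr, if_pos c1, if_neg c2, add_zero, one_mul, K]
      exact ⟨up _, exp_lower (hE0 _ _) (hE1 _ _) hc⟩
    · by_cases c2 : p.2 ∈ A ∧ p.1 ∉ V
      · have hr : r = 1 := by simp only [r]; rw [if_pos (Or.inr (Or.inr c2))]
        rw [main _ _ c2.1 c2.2 (Or.inr rfl)]
        simp only [hr, cr, if_pos c2, if_neg c1, zero_add, one_mul, K]
        exact ⟨up _, exp_lower (hE0 _ _) (hE1 _ _) hc⟩
      · have hr : r = fac a b n g τ ψ p := by simp only [r]; rw [if_neg (by tauto)]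
        have n1 : p.1 ∉ A := fun h => by have := hAV h; tauto
        have n2 : p.2 ∉ A := fun h => by have := hAV h; tauto
        have e : fac a b n g (mix A ρ τ) ψ p = fac a b n g τ ψ p :=
          fac_congr rfl (by simp [mix, n1]) (by simp [mix, n2]) rfl rfl
        simp only [hr, cr, if_neg c2, if_neg c1, e]
        simp

open Classical in
lemma abs_sum_le {n : ℕ} {φmax : ℝ} (S : Set (Fin n)) (ψ : Fin n → ℝ) (τ : Fin n → Bool)
    (h0 : ∀ v, 0 ≤ ψ v) (h1 : ∀ v, ψ v ≤ φmax) :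
    |∑ i, if i ∈ S then ψ i * sg (τ i) else 0| ≤ φmax * S.ncard := by
  calc |∑ i, if i ∈ S then ψ i * sg (τ i) else 0|
      ≤ ∑ i, |if i ∈ S then ψ i * sg (τ i) else 0| := Finset.abs_sum_le_sum_abs _ _
    _ ≤ ∑ i, if i ∈ S then φmax else 0 := by
        refine Finset.sum_le_sum fun i _ => ?_
        split_ifs
        · rw [abs_mul, sg_abs, mul_one, abs_of_nonneg (h0 i)]; exact h1 i
        · simp
    _ = φmax * S.ncard := by
        rw [← Finset.sum_filter, Finset.sum_const, nsmul_eq_mul, mul_comm,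
          Set.ncard_eq_toFinset_card']
        congr 3
        ext; simp

open Classical in
lemma cr_sum {a b φmin φmax : ℝ} (ha : 0 < a) (hb : 0 < b) (hmin : 0 < φmin)
    {n : ℕ} (hn0 : 0 < n) {A V : Set (Fin n)} (hAV : A ⊆ V)
    {τ ρ : Fin n → Bool} {ψ : Fin n → ℝ} (h0 : ∀ v, φmin ≤ ψ v) (h1 : ∀ v, ψ v ≤ φmax)
    {s t : ℝ} (hs : (V.ncard : ℝ) ≤ s) (ht : |∑ v, ψ v * sg (τ v)| ≤ t) :
    |(∑ i, ∑ j, cr A V (edgeProb a b n (mix A ρ τ) ψ) i j)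
      - ∑ i, ∑ j, cr A V (fun i j => ψ i * ψ j / n * ((a + b) / 2)) i j|
      ≤ (a + b) * (φmax * s) * (t + φmax * s) / n := by
  have hn0' : (0 : ℝ) < n := by exact_mod_cast hn0
  have hψ0 : ∀ v, 0 ≤ ψ v := fun v => hmin.le.trans (h0 v)
  have hφ : 0 ≤ φmax := (hψ0 ⟨0, hn0⟩).trans (h1 _)
  have hs0 : 0 ≤ s := le_trans (by positivity) hs
  have ht0 : 0 ≤ t := (abs_nonneg _).trans ht
  have e : (∑ i, ∑ j, cr A V (edgeProb a b n (mix A ρ τ) ψ) i j)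
      - ∑ i, ∑ j, cr A V (fun i j => ψ i * ψ j / n * ((a + b) / 2)) i j
      = ((a - b) / (2 * n)) * ((∑ i, if i ∈ A then ψ i * sg (ρ i) else 0) *
          (∑ j, if j ∈ Vᶜ then ψ j * sg (τ j) else 0)) := by
    rw [Finset.sum_mul_sum, ← Finset.sum_sub_distrib, Finset.mul_sum]
    refine Finset.sum_congr rfl fun i _ => ?_
    rw [← Finset.sum_sub_distrib, Finset.mul_sum]
    refine Finset.sum_congr rfl fun j _ => ?_
    unfold cr
    by_cases hi : i ∈ A
    · by_cases hj : j ∈ V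
      · simp [hj]
      · have hj' : j ∉ A := fun h => hj (hAV h)
        simp only [hi, hj, edgeProb, mix, hj', sg, Set.mem_compl_iff]
        cases ρ i <;> cases τ j <;> simp <;> field_simp <;> ring
    · simp [hi]
  have b1 : |∑ i, if i ∈ A then ψ i * sg (ρ i) else 0| ≤ φmax * s := by
    refine (abs_sum_le A ψ ρ hψ0 h1).trans ?_
    have : (A.ncard : ℝ) ≤ V.ncard := by exact_mod_cast Set.ncard_le_ncard hAV
    exact mul_le_mul_of_nonneg_left (this.trans hs) hφ
  have b2 : |∑ j, if j ∈ Vᶜ then ψ j * sg (τ j) else 0| ≤ t + φmax * s := by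
    have e2 : (∑ j, if j ∈ Vᶜ then ψ j * sg (τ j) else 0)
        = (∑ v, ψ v * sg (τ v)) - ∑ i, if i ∈ V then ψ i * sg (τ i) else 0 := by
      rw [← Finset.sum_sub_distrib]
      refine Finset.sum_congr rfl fun i _ => ?_
      by_cases h : i ∈ V <;> simp [h]
    rw [e2]
    refine (abs_sub _ _).trans (add_le_add ht ?_)
    exact (abs_sum_le V ψ τ hψ0 h1).trans (mul_le_mul_of_nonneg_left hs hφ)
  have b3 : |(a - b) / (2 * n)| ≤ (a + b) / n := by
    rw [abs_div, abs_of_pos (by positivity : (0 : ℝ) < 2 * n), div_le_div_iff₀ (by positivity) hn0']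
    have : |a - b| ≤ a + b := abs_le.2 ⟨by linarith, by linarith⟩
    nlinarith
  rw [e, abs_mul, abs_mul]
  calc _ ≤ (a + b) / n * ((φmax * s) * (t + φmax * s)) := by gcongr
    _ = _ := by ring

open Classical in
lemma crK_sum {n : ℕ} {A V : Set (Fin n)} (hAV : A ⊆ V) (K : ℝ) (hK : 0 ≤ K)
    {s : ℝ} (hs : (V.ncard : ℝ) ≤ s) :
    ∑ i, ∑ j, cr A V (fun _ _ => K) i j ≤ s * n * K := by
  calc ∑ i, ∑ j, cr A V (fun _ _ => K) i j ≤ ∑ i : Fin n, if i ∈ A then n * K else 0 := by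
        refine Finset.sum_le_sum fun i _ => ?_
        calc ∑ j, cr A V (fun _ _ => K) i j ≤ ∑ j : Fin n, if i ∈ A then K else 0 := by
              refine Finset.sum_le_sum fun j _ => ?_
              unfold cr
              by_cases hi : i ∈ A <;> by_cases hj : j ∈ V <;> simp [hi, hj, hK]
          _ = _ := by split_ifs <;> simp
    _ = A.ncard * (n * K) := by
        rw [← Finset.sum_filter, Finset.sum_const, nsmul_eq_mul, Set.ncard_eq_toFinset_card']
        congr 3
        ext; simp
    _ ≤ s * (n * K) := by
        have : (A.ncard : ℝ) ≤ V.ncard := by exact_mod_cast Set.ncard_le_ncard hAV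
        exact mul_le_mul_of_nonneg_right (this.trans hs) (by positivity)
    _ = _ := by ring

/-- the exponent controlling the error -/
def errE (a b φmax : ℝ) (n : ℕ) (s t : ℝ) : ℝ :=
  2 * ((a + b) * (φmax * s) * (t + φmax * s) / n) + s * n * (φmax ^ 2 * (a + b) / n) ^ 2

open Classical in
lemma compare {a b φmin φmax : ℝ} (ha : 0 < a) (hb : 0 < b) (hmin : 0 < φmin)
    {n : ℕ} (hn0 : 0 < n) (hn : 2 * (φmax ^ 2 * (a + b)) ≤ n)
    {g gE : Fin n → Fin n → Bool} (hsym : ∀ u v, g u v = g v u)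
    {A V : Set (Fin n)} (hAV : A ⊆ V) (hsep : ∀ i ∈ A, ∀ j ∉ V, g i j = false)
    {τ : Fin n → Bool} {ψ w : Fin n → ℝ} (h0 : ∀ v, φmin ≤ ψ v) (h1 : ∀ v, ψ v ≤ φmax)
    (hgE : ∀ i j, gE i j = true ↔ i ∈ V ∧ j ∈ V ∧ g i j = true)
    (hw1 : ∀ v ∈ V, w v = ψ v) (hw0 : ∀ v ∉ V, w v = 0)
    {s t : ℝ} (hs : (V.ncard : ℝ) ≤ s) (ht : |∑ v, ψ v * sg (τ v)| ≤ t) (u : Fin n) :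
    |Ff a b n A g τ ψ u - Ff a b n A gE τ w u| ≤ Real.exp (errE a b φmax n s t) - 1 := by
  have hψp : ∀ v, 0 < ψ v := fun v => hmin.trans_le (h0 v)
  have hφ : 0 ≤ φmax := (hψp ⟨0, hn0⟩).le.trans (h1 _)
  have hwle : ∀ v, 0 ≤ w v ∧ w v ≤ φmax := fun v => by
    by_cases h : v ∈ V
    · rw [hw1 v h]; exact ⟨(hψp v).le, h1 v⟩
    · rw [hw0 v h]; exact ⟨le_rfl, hφ⟩
  have hgw : ∀ i j, gE i j = true → 0 < w i ∧ 0 < w j := fun i j h => by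
    obtain ⟨hi, hj, _⟩ := (hgE i j).1 h
    rw [hw1 i hi, hw1 j hj]; exact ⟨hψp i, hψp j⟩
  set r : Fin n × Fin n → ℝ := fun p =>
    if (p.1 ∈ V ∧ p.2 ∈ V) ∨ (p.1 ∈ A ∧ p.2 ∉ V) ∨ (p.2 ∈ A ∧ p.1 ∉ V) then 1
      else fac a b n g τ ψ p with hr
  have hrpos : ∀ p, 0 < r p := fun p => by
    simp only [hr]
    split_ifs
    · exact one_pos
    · exact fac_pos ha hb hn0 hn (fun v => (hψp v).le) h1 (fun i j _ => ⟨hψp i, hψp j⟩) p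
  set R := ∏ p ∈ vertexPairs n, r p
  have hR : 0 < R := Finset.prod_pos fun p _ => hrpos p
  set xb := ∑ i, ∑ j, cr A V (fun i j => ψ i * ψ j / n * ((a + b) / 2)) i j
  set η := (a + b) * (φmax * s) * (t + φmax * s) / n with hη
  set K : ℝ := (φmax ^ 2 * (a + b) / n) ^ 2 with hK
  have crii : ∀ f : Fin n → Fin n → ℝ, ∀ i, cr A V f i i = 0 := by
    intro f i; unfold cr; rw [if_neg]; exact fun h => h.2 (hAV h.1)
  have hlo : 0 < R * Real.exp (-(xb + η + s * n * K)) := mul_pos hR (Real.exp_pos _)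
  have hLpos : ∀ ρ : Fin n → Bool, 0 < configDensity a b n gE (mix A ρ τ) w := fun ρ =>
    cd_pos ha hb hn0 hn _ (fun v => (hwle v).1) (fun v => (hwle v).2) hgw
  have hfE : ∀ ρ : Fin n → Bool, ∀ p, 0 < fac a b n gE (mix A ρ τ) w p := fun ρ p =>
    fac_pos ha hb hn0 hn (fun v => (hwle v).1) (fun v => (hwle v).2) hgw p
  have hfg : ∀ ρ : Fin n → Bool, ∀ p, 0 < fac a b n g (mix A ρ τ) ψ p := fun ρ p =>
    fac_pos ha hb hn0 hn (fun v => (hψp v).le) h1 (fun i j _ => ⟨hψp i, hψp j⟩) p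
  have hfb := fun (ρ : Fin n → Bool) (p : Fin n × Fin n) =>
    fac_bounds (τ := τ) (ρ := ρ) ha hb hmin hn0 hn hsym hAV hsep h0 h1 hgE hw1 hw0 p
  have hcs := fun (ρ : Fin n → Bool) =>
    abs_le.1 (cr_sum (ρ := ρ) ha hb hmin hn0 hAV h0 h1 hs ht)
  have hKs := crK_sum hAV K (by positivity) hs
  have low : ∀ ρ : Fin n → Bool, R * Real.exp (-(xb + η + s * n * K)) *
      configDensity a b n gE (mix A ρ τ) w ≤ configDensity a b n g (mix A ρ τ) ψ := by
    intro ρ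
    have hp := Finset.prod_le_prod (s := vertexPairs n)
      (fun p _ => (mul_pos (mul_pos (hfE ρ p) (hrpos p)) (Real.exp_pos _)).le)
      (fun p _ => (hfb ρ p).2)
    rw [Finset.prod_mul_distrib, Finset.prod_mul_distrib, ← Real.exp_sum, Finset.sum_neg_distrib,
      Finset.sum_add_distrib, pair_sum _ (crii _), pair_sum _ (crii _)] at hp
    rw [cd_eq, cd_eq]
    have hPE : 0 < ∏ p ∈ vertexPairs n, fac a b n gE (mix A ρ τ) w p :=
      Finset.prod_pos fun p _ => hfE ρ p
    have h3 : Real.exp (-(xb + η + s * n * K)) ≤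
        Real.exp (-(∑ i, ∑ j, cr A V (edgeProb a b n (mix A ρ τ) ψ) i j
          + ∑ i, ∑ j, cr A V (fun _ _ => K) i j)) := by
      apply Real.exp_le_exp.2
      have := (hcs ρ).2
      linarith
    have h4 := mul_le_mul_of_nonneg_left h3 (mul_pos hPE hR).le
    have h5 := h4.trans hp
    calc _ = (1 / 2 ^ n) * ((∏ p ∈ vertexPairs n, fac a b n gE (mix A ρ τ) w p) * R *
            Real.exp (-(xb + η + s * n * K))) := by ring
      _ ≤ _ := mul_le_mul_of_nonneg_left h5 (by positivity)
  have upp : ∀ ρ : Fin n → Bool, configDensity a b n g (mix A ρ τ) ψ ≤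
      R * Real.exp (-(xb - η)) * configDensity a b n gE (mix A ρ τ) w := by
    intro ρ
    have hp := Finset.prod_le_prod (s := vertexPairs n)
      (fun p _ => (hfg ρ p).le)
      (fun p _ => (hfb ρ p).1)
    rw [Finset.prod_mul_distrib, Finset.prod_mul_distrib, ← Real.exp_sum, Finset.sum_neg_distrib,
      pair_sum _ (crii _)] at hp
    rw [cd_eq, cd_eq]
    have hPE : 0 < ∏ p ∈ vertexPairs n, fac a b n gE (mix A ρ τ) w p :=
      Finset.prod_pos fun p _ => hfE ρ p
    have h3 : Real.exp (-(∑ i, ∑ j, cr A V (edgeProb a b n (mix A ρ τ) ψ) i j)) ≤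
        Real.exp (-(xb - η)) := by
      apply Real.exp_le_exp.2
      have := (hcs ρ).1
      linarith
    have h4 := mul_le_mul_of_nonneg_left h3 (mul_pos hPE hR).le
    have h5 := hp.trans h4
    calc _ ≤ (1 / 2 ^ n) * ((∏ p ∈ vertexPairs n, fac a b n gE (mix A ρ τ) w p) * R *
            Real.exp (-(xb - η))) := mul_le_mul_of_nonneg_left h5 (by positivity)
      _ = _ := by ring
  have fin := ratio_close (fun ρ : Fin n → Bool => if ρ u = true then (1 : ℝ) else 0)
    (fun ρ => configDensity a b n g (mix A ρ τ) ψ)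
    (fun ρ => configDensity a b n gE (mix A ρ τ) w) _ _ hlo hLpos low upp
    (fun ρ => by split_ifs <;> norm_num)
    (fun ρ => by split_ifs <;> norm_num)
  refine fin.trans (le_of_eq ?_)
  rw [mul_div_mul_left _ _ hR.ne', ← Real.exp_sub]
  congr 2
  unfold errE
  ring

lemma Ff_nonneg {a b : ℝ} {n : ℕ} {A : Set (Fin n)} {g : Fin n → Fin n → Bool}
    {τ : Fin n → Bool} {ψ : Fin n → ℝ} (h : ∀ τ, 0 < configDensity a b n g τ ψ) (u : Fin n) :
    0 ≤ Ff a b n A g τ ψ u := by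
  unfold Ff
  refine div_nonneg (Finset.sum_nonneg fun ρ _ => mul_nonneg ?_ (h _).le)
    (Finset.sum_nonneg fun ρ _ => (h _).le)
  split_ifs <;> norm_num

lemma Ff_le_one {a b : ℝ} {n : ℕ} {A : Set (Fin n)} {g : Fin n → Fin n → Bool}
    {τ : Fin n → Bool} {ψ : Fin n → ℝ} (h : ∀ τ, 0 < configDensity a b n g τ ψ) (u : Fin n) :
    Ff a b n A g τ ψ u ≤ 1 := by
  unfold Ff
  refine (div_le_one (Finset.sum_pos (fun ρ _ => h _) Finset.univ_nonempty)).2 ?_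
  refine Finset.sum_le_sum fun ρ _ => ?_
  have := h (mix A ρ τ)
  split_ifs <;> linarith

lemma meas_fin {Ω β γ K : Type*} [Finite K] (m : MeasurableSpace Ω) [MeasurableSpace β]
    [MeasurableSpace γ] (κ : Ω → K) (hκ : ∀ k, MeasurableSet[m] (κ ⁻¹' {k})) (X : Ω → β)
    (hX : Measurable[m] X) (F : K → β → γ) (hF : ∀ k, Measurable (F k)) :
    Measurable[m] (fun ω => F (κ ω) (X ω)) := by
  intro U hU
  have : (fun ω => F (κ ω) (X ω)) ⁻¹' U = ⋃ k, (κ ⁻¹' {k} ∩ X ⁻¹' (F k ⁻¹' U)) := by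
    ext ω; simp
  rw [this]
  exact MeasurableSet.iUnion fun k => (hκ k).inter (hX (hF k hU))

lemma meas_cd (a b : ℝ) (n : ℕ) (g : Fin n → Fin n → Bool) (τ : Fin n → Bool) :
    Measurable (fun ψ : Fin n → ℝ => configDensity a b n g τ ψ) := by
  unfold configDensity
  refine Measurable.const_mul (Finset.measurable_prod _ fun p _ => ?_) _
  unfold edgeProb
  split_ifs <;> fun_prop

lemma meas_Ff (a b : ℝ) (n : ℕ) (A : Set (Fin n)) (g : Fin n → Fin n → Bool) (τ : Fin n → Bool)
    (u : Fin n) : Measurable (fun ψ : Fin n → ℝ => Ff a b n A g τ ψ u) := by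
  unfold Ff
  refine Measurable.div (Finset.measurable_sum _ fun ρ _ => (meas_cd _ _ _ _ _).const_mul _)
    (Finset.measurable_sum _ fun ρ _ => meas_cd _ _ _ _ _)

section model

variable {a b : ℝ} {ν : Measure ℝ} {n : ℕ} {Ω : Type} [mΩ : MeasurableSpace Ω] {P : Measure Ω}
  {spin : Ω → Fin n → Bool} {wt : Ω → Fin n → ℝ} {adj : Ω → Fin n → Fin n → Bool}

lemma lint (hM : IsDCPPM a b ν n P spin wt adj)
    (H : (Fin n → Bool) → (Fin n → Fin n → Bool) → (Fin n → ℝ) → ENNReal)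
    (hH : ∀ τ g, Measurable (H τ g)) :
    ∫⁻ ω, H (spin ω) (adj ω) (wt ω) ∂P
      = ∑ τ, ∑ g ∈ Gs n, ∫⁻ ψ, ENNReal.ofReal (configDensity a b n g τ ψ) * H τ g ψ
          ∂(Measure.pi fun _ : Fin n => ν) := by
  obtain ⟨_, hs, hw, had, hsym, hloop, hlaw⟩ := hM
  have hEm : ∀ τ g, MeasurableSet {ω | spin ω = τ ∧ adj ω = g} := fun τ g =>
    (hs (measurableSet_singleton τ)).inter (had (measurableSet_singleton g))
  have e1 : ∀ ω, H (spin ω) (adj ω) (wt ω) = ∑ τ, ∑ g ∈ Gs n,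
      Set.indicator {ω | spin ω = τ ∧ adj ω = g} (fun ω => H τ g (wt ω)) ω := by
    intro ω
    rw [Finset.sum_eq_single (spin ω), Finset.sum_eq_single (adj ω)]
    · rw [Set.indicator_of_mem]; exact ⟨rfl, rfl⟩
    · intro g _ hg
      rw [Set.indicator_of_notMem]; exact fun h => hg h.2.symm
    · intro h
      exact absurd (Finset.mem_filter.2 ⟨Finset.mem_univ _, hsym ω, hloop ω⟩) h
    · intro τ _ hτ
      refine Finset.sum_eq_zero fun g _ => ?_
      rw [Set.indicator_of_notMem]; exact fun h => hτ h.1.symm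
    · simp
  simp_rw [e1]
  have hIm : ∀ τ g, Measurable (fun ω =>
      Set.indicator {ω | spin ω = τ ∧ adj ω = g} (fun ω => H τ g (wt ω)) ω) := fun τ g =>
    ((hH τ g).comp hw).indicator (hEm τ g)
  rw [lintegral_finsetSum _ (fun τ _ => Finset.measurable_sum _ fun g _ => hIm τ g)]
  refine Finset.sum_congr rfl fun τ _ => ?_
  rw [lintegral_finsetSum _ (fun g _ => hIm τ g)]
  refine Finset.sum_congr rfl fun g hg => ?_
  rw [lintegral_indicator (hEm τ g)]
  have hmap : Measure.map wt (P.restrict {ω | spin ω = τ ∧ adj ω = g})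
      = (Measure.pi fun _ : Fin n => ν).withDensity
          (fun ψ => ENNReal.ofReal (configDensity a b n g τ ψ)) := by
    ext B hB
    rw [Measure.map_apply hw hB, Measure.restrict_apply (hw hB), withDensity_apply _ hB]
    obtain ⟨h1, h2⟩ := (Finset.mem_filter.1 hg).2
    rw [← hlaw τ g h1 h2 B hB]
    congr 1
    ext ω; simp only [Set.mem_inter_iff, Set.mem_preimage, Set.mem_ofPred_eq]; tauto
  rw [← lintegral_map (hH τ g) hw, hmap, lintegral_withDensity_eq_lintegral_mul _
    (meas_cd a b n g τ).ennreal_ofReal (hH τ g)]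
  rfl

lemma ae_model (hM : IsDCPPM a b ν n P spin wt adj) {p : (Fin n → ℝ) → Prop}
    (hp : ∀ᵐ ψ ∂(Measure.pi fun _ : Fin n => ν), p ψ) : ∀ᵐ ω ∂P, p (wt ω) := by
  set μ := Measure.pi fun _ : Fin n => ν
  have hN : μ (toMeasurable μ {ψ | ¬ p ψ}) = 0 := by rw [measure_toMeasurable]; exact hp
  set N := toMeasurable μ {ψ | ¬ p ψ}
  have hNm : MeasurableSet N := measurableSet_toMeasurable _ _
  have key : P (wt ⁻¹' N) = 0 := by
    have h := lint hM (fun _ _ => N.indicator 1) (fun _ _ => measurable_one.indicator hNm)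
    have e : (fun ω => N.indicator (1 : (Fin n → ℝ) → ENNReal) (wt ω))
        = (wt ⁻¹' N).indicator 1 := by
      ext ω; by_cases h : wt ω ∈ N <;> simp [h]
    rw [e, lintegral_indicator_one (hM.2.2.1 hNm)] at h
    rw [h]
    refine Finset.sum_eq_zero fun τ _ => Finset.sum_eq_zero fun g _ => ?_
    refine (lintegral_eq_zero_iff ((meas_cd a b n g τ).ennreal_ofReal.mul
      (measurable_one.indicator hNm))).2 ?_
    have : ∀ᵐ ψ ∂μ, ψ ∉ N := by
      rw [ae_iff]; simpa using hN
    filter_upwards [this] with ψ hψ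
    simp [hψ]
  refine measure_mono_null ?_ key
  intro ω hω
  exact subset_toMeasurable μ _ hω

lemma ae_range {φmin φmax : ℝ} [IsProbabilityMeasure ν] (hsupp : ∀ᵐ x ∂ν, x ∈ Set.Icc φmin φmax) :
    ∀ᵐ ψ ∂(Measure.pi fun _ : Fin n => ν), ∀ v, φmin ≤ ψ v ∧ ψ v ≤ φmax := by
  rw [ae_all_iff]
  intro v
  exact (measurePreserving_eval (fun _ : Fin n => ν) v).quasiMeasurePreserving.ae hsupp

lemma bad_bound {φmin φmax : ℝ} (ha : 0 < a) (hb : 0 < b) (hmin : 0 < φmin)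
    [IsProbabilityMeasure ν] (hsupp : ∀ᵐ x ∂ν, x ∈ Set.Icc φmin φmax)
    (hn0 : 0 < n) (hn : 2 * (φmax ^ 2 * (a + b)) ≤ n)
    (hM : IsDCPPM a b ν n P spin wt adj) {t : ℝ} (ht : 0 < t) :
    P {ω | t < |∑ v, wt ω v * sg (spin ω v)|} ≤ ENNReal.ofReal (n * φmax ^ 2 / t ^ 2) := by
  have hn0' : (0 : ℝ) < n := by exact_mod_cast hn0
  have hMm : ∀ τ : Fin n → Bool, Measurable (fun ψ : Fin n → ℝ =>
      ENNReal.ofReal ((∑ v, ψ v * sg (τ v)) ^ 2)) := fun τ => by fun_prop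
  have h1 : ∫⁻ ω, ENNReal.ofReal ((∑ v, wt ω v * sg (spin ω v)) ^ 2) ∂P
      ≤ ENNReal.ofReal (n * φmax ^ 2) := by
    rw [lint hM (fun τ _ ψ => ENNReal.ofReal ((∑ v, ψ v * sg (τ v)) ^ 2)) (fun τ _ => hMm τ)]
    have hm : ∀ τ g, Measurable (fun ψ : Fin n → ℝ => ENNReal.ofReal (configDensity a b n g τ ψ) *
        ENNReal.ofReal ((∑ v, ψ v * sg (τ v)) ^ 2)) := fun τ g =>
      (meas_cd a b n g τ).ennreal_ofReal.mul (hMm τ)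
    have e2 : ∀ τ, ∑ g ∈ Gs n, ∫⁻ ψ, ENNReal.ofReal (configDensity a b n g τ ψ) *
        ENNReal.ofReal ((∑ v, ψ v * sg (τ v)) ^ 2) ∂(Measure.pi fun _ : Fin n => ν)
        = ∫⁻ ψ, ∑ g ∈ Gs n, ENNReal.ofReal (configDensity a b n g τ ψ) *
        ENNReal.ofReal ((∑ v, ψ v * sg (τ v)) ^ 2) ∂(Measure.pi fun _ : Fin n => ν) := fun τ => by
      rw [lintegral_finsetSum _ (fun g _ => hm τ g)]
    simp_rw [e2]
    rw [← lintegral_finsetSum _ (fun τ _ => Finset.measurable_sum _ fun g _ => hm τ g)]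
    calc _ ≤ ∫⁻ _ψ, ENNReal.ofReal (n * φmax ^ 2) ∂(Measure.pi fun _ : Fin n => ν) := by
          refine lintegral_mono_ae ?_
          filter_upwards [ae_range (n := n) hsupp] with ψ hψ
          have hψ0 : ∀ v, 0 < ψ v := fun v => hmin.trans_le (hψ v).1
          have hcd : ∀ g τ, 0 < configDensity a b n g τ ψ := fun g τ =>
            cd_pos ha hb hn0 hn τ (fun v => (hψ0 v).le) (fun v => (hψ v).2)
              (fun i j _ => ⟨hψ0 i, hψ0 j⟩)
          have e3 : ∑ τ : Fin n → Bool, ∑ g ∈ Gs n, ENNReal.ofReal (configDensity a b n g τ ψ) *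
              ENNReal.ofReal ((∑ v, ψ v * sg (τ v)) ^ 2)
              = ENNReal.ofReal (∑ τ : Fin n → Bool, (∑ g ∈ Gs n, configDensity a b n g τ ψ) *
                (∑ v, ψ v * sg (τ v)) ^ 2) := by
            rw [ENNReal.ofReal_sum_of_nonneg (fun τ _ => mul_nonneg
              (Finset.sum_nonneg fun g _ => (hcd g τ).le) (sq_nonneg _))]
            refine Finset.sum_congr rfl fun τ _ => ?_
            rw [ENNReal.ofReal_mul (Finset.sum_nonneg fun g _ => (hcd g τ).le),
              ENNReal.ofReal_sum_of_nonneg (fun g _ => (hcd g τ).le), Finset.sum_mul]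
          rw [e3]
          apply ENNReal.ofReal_le_ofReal
          have hc : φmax ^ 2 * (a + b) / n ≤ 1 := by
            rw [div_le_iff₀ hn0']; nlinarith [sq_nonneg φmax]
          calc _ ≤ ∑ τ : Fin n → Bool, (1 / 2 ^ n) * (∑ v, ψ v * sg (τ v)) ^ 2 := by
                refine Finset.sum_le_sum fun τ _ => mul_le_mul_of_nonneg_right ?_ (sq_nonneg _)
                exact gsum a b n τ ψ (ep_nonneg ha hb fun v => (hψ0 v).le)
                  (fun i j => (ep_le ha hb (fun v => (hψ0 v).le) (fun v => (hψ v).2) i j).trans hc)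
            _ = ∑ v, ψ v ^ 2 := by
                rw [← Finset.mul_sum, rademacher]; field_simp
            _ ≤ ∑ v : Fin n, φmax ^ 2 := by
                refine Finset.sum_le_sum fun v _ => ?_
                have := hψ0 v
                have := (hψ v).2
                gcongr
            _ = n * φmax ^ 2 := by simp
      _ = _ := by simp
  have hsm : Measurable spin := hM.2.1
  have hwm : Measurable wt := hM.2.2.1
  have hmeas : Measurable (fun ω => ENNReal.ofReal ((∑ v, wt ω v * sg (spin ω v)) ^ 2)) :=
    meas_fin mΩ spin (fun k => hsm (measurableSet_singleton k)) wt hwm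
      (fun τ ψ => ENNReal.ofReal ((∑ v, ψ v * sg (τ v)) ^ 2)) hMm
  have h2 := mul_meas_ge_le_lintegral (μ := P) hmeas (ENNReal.ofReal (t ^ 2))
  have h3 : P {ω | t < |∑ v, wt ω v * sg (spin ω v)|} ≤
      P {ω | ENNReal.ofReal (t ^ 2) ≤ ENNReal.ofReal ((∑ v, wt ω v * sg (spin ω v)) ^ 2)} := by
    refine measure_mono fun ω hω => ?_
    simp only [Set.mem_ofPred_eq] at hω ⊢
    apply ENNReal.ofReal_le_ofReal
    rw [← sq_abs (∑ v, wt ω v * sg (spin ω v))]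
    gcongr
  rw [ENNReal.ofReal_div_of_pos (by positivity)]
  rw [ENNReal.le_div_iff_mul_le (Or.inl (by simpa using ht.ne')) (Or.inl ENNReal.ofReal_ne_top),
    mul_comm]
  exact (mul_le_mul_right h3 _).trans (h2.trans h1)

lemma condFull {φmin φmax : ℝ} (ha : 0 < a) (hb : 0 < b) (hmin : 0 < φmin)
    [IsProbabilityMeasure ν] (hsupp : ∀ᵐ x ∂ν, x ∈ Set.Icc φmin φmax)
    (hn0 : 0 < n) (hn : 2 * (φmax ^ 2 * (a + b)) ≤ n)
    (hM : IsDCPPM a b ν n P spin wt adj) (Ag Sg : (Fin n → Fin n → Bool) → Set (Fin n))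
    (hAS : ∀ g v, v ∈ Ag g ↔ v ∉ Sg g) (u : Fin n) (hu : ∀ g, u ∈ Ag g)
    (hle : infoFull spin wt adj (fun ω => Sg (adj ω)) ≤ mΩ)
    (hfm : Measurable[infoFull spin wt adj (fun ω => Sg (adj ω))]
      (fun ω => Ff a b n (Ag (adj ω)) (adj ω) (spin ω) (wt ω) u)) :
    (fun ω => Ff a b n (Ag (adj ω)) (adj ω) (spin ω) (wt ω) u) =ᵐ[P]
      P[(fun ω => if spin ω u = true then (1 : ℝ) else 0)|
        infoFull spin wt adj (fun ω => Sg (adj ω))] := by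
  classical
  have hP : IsProbabilityMeasure P := hM.1
  have hsm : Measurable spin := hM.2.1
  have hwm : Measurable wt := hM.2.2.1
  have hr := ae_range (n := n) hsupp
  have hcd : ∀ ψ : Fin n → ℝ, (∀ v, φmin ≤ ψ v ∧ ψ v ≤ φmax) →
      ∀ g τ, 0 < configDensity a b n g τ ψ := fun ψ hψ g τ =>
    cd_pos ha hb hn0 hn τ (fun v => hmin.le.trans (hψ v).1) (fun v => (hψ v).2)
      (fun i j _ => ⟨hmin.trans_le (hψ i).1, hmin.trans_le (hψ j).1⟩)
  have hFb : ∀ᵐ ω ∂P, 0 ≤ Ff a b n (Ag (adj ω)) (adj ω) (spin ω) (wt ω) u ∧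
      Ff a b n (Ag (adj ω)) (adj ω) (spin ω) (wt ω) u ≤ 1 := by
    filter_upwards [ae_model hM hr] with ω hω
    exact ⟨Ff_nonneg (hcd _ hω _) u, Ff_le_one (hcd _ hω _) u⟩
  have hXm : Measurable (fun ω => if spin ω u = true then (1 : ℝ) else 0) :=
    meas_fin mΩ spin (fun k => hsm (measurableSet_singleton k)) wt hwm
      (fun τ _ => if τ u = true then (1 : ℝ) else 0) (fun τ => measurable_const)
  have hXi : Integrable (fun ω => if spin ω u = true then (1 : ℝ) else 0) P := by
    refine Integrable.of_bound hXm.aestronglyMeasurable 1 (ae_of_all _ fun ω => ?_)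
    split_ifs <;> simp
  have hFi : Integrable (fun ω => Ff a b n (Ag (adj ω)) (adj ω) (spin ω) (wt ω) u) P := by
    refine Integrable.of_bound (hfm.mono hle le_rfl).aestronglyMeasurable 1 ?_
    filter_upwards [hFb] with ω hω
    rw [Real.norm_eq_abs, abs_of_nonneg hω.1]; exact hω.2
  refine ae_eq_condExp_of_forall_setIntegral_eq hle hXi (fun s _ _ => hFi.integrableOn) ?_
    hfm.stronglyMeasurable.aestronglyMeasurable
  intro s hs _
  have hs0 := hle s hs
  -- description of `s`
  obtain ⟨h, hhm, hhi, rfl⟩ : ∃ h : (Fin n → Bool) → (Fin n → Fin n → Bool) → Set (Fin n → ℝ),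
      (∀ τ g, MeasurableSet (h τ g)) ∧ (∀ ρ τ g, h (mix (Ag g) ρ τ) g = h τ g) ∧
      {ω | wt ω ∈ h (spin ω) (adj ω)} = s := by
    unfold infoFull at hs
    rw [← MeasurableSpace.comap_prodMk, ← MeasurableSpace.comap_prodMk] at hs
    obtain ⟨s', hs', rfl⟩ := hs
    refine ⟨fun τ g => {ψ | (({p : Fin n × Bool | p.1 ∈ Sg g ∧ τ p.1 = p.2}, g), ψ) ∈ s'},
      ?_, ?_, ?_⟩
    · intro τ g
      let _ : MeasurableSpace (Set (Fin n × Bool)) := ⊤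
      exact measurable_prodMk_left hs'
    · intro ρ τ g
      have : {p : Fin n × Bool | p.1 ∈ Sg g ∧ mix (Ag g) ρ τ p.1 = p.2}
          = {p : Fin n × Bool | p.1 ∈ Sg g ∧ τ p.1 = p.2} := by
        ext p
        simp only [Set.mem_ofPred_eq]
        refine and_congr_right fun hp => ?_
        have : p.1 ∉ Ag g := fun h => (hAS g _).1 h hp
        simp [mix, this]
      simp only [this]
    · rfl
  rw [integral_eq_lintegral_of_nonneg_ae, integral_eq_lintegral_of_nonneg_ae]
  rotate_left
  · refine ae_of_all _ fun ω => ?_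
    simp only [Pi.zero_apply]; split_ifs <;> norm_num
  · exact hXm.aestronglyMeasurable
  · exact ae_restrict_of_ae (hFb.mono fun ω h => h.1)
  · exact (hfm.mono hle le_rfl).aestronglyMeasurable
  congr 1
  rw [← lintegral_indicator hs0, ← lintegral_indicator hs0]
  have e1 : ∀ Y : (Fin n → Bool) → (Fin n → Fin n → Bool) → (Fin n → ℝ) → ENNReal,
      (Set.indicator {ω | wt ω ∈ h (spin ω) (adj ω)} fun ω => Y (spin ω) (adj ω) (wt ω))
      = fun ω => (fun τ g => (h τ g).indicator (Y τ g)) (spin ω) (adj ω) (wt ω) := by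
    intro Y; funext ω
    by_cases hω : wt ω ∈ h (spin ω) (adj ω)
    · simp [hω]
    · simp [hω]
  rw [e1 (fun τ g ψ => ENNReal.ofReal (Ff a b n (Ag g) g τ ψ u)),
    e1 (fun τ g ψ => ENNReal.ofReal (if τ u = true then (1 : ℝ) else 0))]
  have m1 : ∀ τ g, Measurable ((h τ g).indicator
      (fun ψ => ENNReal.ofReal (Ff a b n (Ag g) g τ ψ u))) := fun τ g =>
    (meas_Ff a b n (Ag g) g τ u).ennreal_ofReal.indicator (hhm τ g)
  have m2 : ∀ τ g, Measurable ((h τ g).indicator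
      (fun ψ : Fin n → ℝ => ENNReal.ofReal (if τ u = true then (1 : ℝ) else 0))) := fun τ g =>
    measurable_const.indicator (hhm τ g)
  rw [lint hM _ m1, lint hM _ m2, Finset.sum_comm]
  conv_rhs => rw [Finset.sum_comm]
  refine Finset.sum_congr rfl fun g _ => ?_
  have mm : ∀ Y : (Fin n → Bool) → (Fin n → ℝ) → ENNReal, (∀ τ, Measurable (Y τ)) →
      ∑ τ, ∫⁻ ψ, ENNReal.ofReal (configDensity a b n g τ ψ) * Y τ ψ
        ∂(Measure.pi fun _ : Fin n => ν)
      = ∫⁻ ψ, ∑ τ, ENNReal.ofReal (configDensity a b n g τ ψ) * Y τ ψ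
        ∂(Measure.pi fun _ : Fin n => ν) := by
    intro Y hY
    have hm' : ∀ τ, Measurable (fun ψ : Fin n → ℝ =>
        ENNReal.ofReal (configDensity a b n g τ ψ) * Y τ ψ) := fun τ =>
      (meas_cd a b n g τ).ennreal_ofReal.mul (hY τ)
    rw [lintegral_finsetSum _ (fun τ _ => hm' τ)]
  rw [mm _ (fun τ => m1 τ g), mm _ (fun τ => m2 τ g)]
  refine lintegral_congr_ae ?_
  filter_upwards [hr] with ψ hψ
  have hD := hcd ψ hψ g
  have hb := bayes (Ag g) (fun τ => configDensity a b n g τ ψ)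
    (fun τ => if τ u = true then (1 : ℝ) else 0) (fun τ => if ψ ∈ h τ g then (1 : ℝ) else 0) hD
    (fun ρ τ => by simp only [hhi]) (fun ρ τ => by simp [mix, hu g])
  have conv : ∀ Y : (Fin n → Bool) → (Fin n → ℝ) → ℝ, (∀ τ, 0 ≤ Y τ ψ) →
      ∑ τ, ENNReal.ofReal (configDensity a b n g τ ψ) *
        (h τ g).indicator (fun ψ => ENNReal.ofReal (Y τ ψ)) ψ
      = ENNReal.ofReal (∑ τ, (if ψ ∈ h τ g then (1 : ℝ) else 0) * configDensity a b n g τ ψ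
          * Y τ ψ) := by
    intro Y hY
    rw [ENNReal.ofReal_sum_of_nonneg]
    · refine Finset.sum_congr rfl fun τ _ => ?_
      by_cases hm : ψ ∈ h τ g
      · simp [hm, ENNReal.ofReal_mul (hD τ).le]
      · simp [hm]
    · intro τ _
      refine mul_nonneg (mul_nonneg ?_ (hD τ).le) (hY τ)
      split_ifs <;> norm_num
  rw [conv (fun τ ψ => Ff a b n (Ag g) g τ ψ u) (fun τ => Ff_nonneg hD u),
    conv (fun τ _ => if τ u = true then (1 : ℝ) else 0) (fun τ => by split_ifs <;> norm_num)]
  exact congrArg ENNReal.ofReal hb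

end model


lemma Ff_congr_loc {a b : ℝ} {n : ℕ} {A V : Set (Fin n)} {gE : Fin n → Fin n → Bool}
    {τ τ' : Fin n → Bool} {w : Fin n → ℝ} (hgE : ∀ i j, gE i j = true → i ∈ V ∧ j ∈ V)
    (hw0 : ∀ v ∉ V, w v = 0) (hτ : ∀ v ∈ V, v ∉ A → τ v = τ' v) (u : Fin n) :
    Ff a b n A gE τ w u = Ff a b n A gE τ' w u := by
  have key : ∀ ρ, configDensity a b n gE (mix A ρ τ) w = configDensity a b n gE (mix A ρ τ') w := by
    intro ρ
    rw [cd_eq, cd_eq]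
    congr 1
    refine Finset.prod_congr rfl fun p _ => ?_
    have hm : ∀ v ∈ V, mix A ρ τ v = mix A ρ τ' v := by
      intro v hv
      by_cases h : v ∈ A
      · simp [mix, h]
      · simp [mix, h, hτ v hv h]
    by_cases hV : p.1 ∈ V ∧ p.2 ∈ V
    · exact fac_congr rfl (hm _ hV.1) (hm _ hV.2) rfl rfl
    · have hg : ¬ (gE p.1 p.2 = true) := fun h => hV (hgE _ _ h)
      have hz : w p.1 * w p.2 = 0 := by
        rcases not_and_or.1 hV with h | h <;> simp [hw0 _ h]
      simp [fac, hg, edgeProb, hz]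
  unfold Ff
  simp only [key]

open Classical in
/-- spins read off from an observed set of pairs -/
def spOf {n : ℕ} (S : Set (Fin n × Bool)) : Fin n → Bool := fun v => decide ((v, true) ∈ S)

open Classical in
/-- adjacency read off from an observed set of edges -/
def gOf {n : ℕ} (E : Set (Fin n × Fin n)) : Fin n → Fin n → Bool := fun i j => decide ((i, j) ∈ E)

/-- the set `A` read off from local information -/
def aOf {n : ℕ} (S : Set (Fin n × Bool)) (V : Set (Fin n)) : Set (Fin n) :=
  {v | v ∈ V ∧ (v, true) ∉ S ∧ (v, false) ∉ S}

lemma spOf_eq {n : ℕ} (S : Set (Fin n × Bool)) (v : Fin n) : spOf S v = true ↔ (v, true) ∈ S := by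
  simp [spOf]

lemma gOf_eq {n : ℕ} (E : Set (Fin n × Fin n)) (i j : Fin n) : gOf E i j = true ↔ (i, j) ∈ E := by
  simp [gOf]

section core

variable {a b : ℝ} {ν : Measure ℝ} {n : ℕ} {Ω : Type} [mΩ : MeasurableSpace Ω] {P : Measure Ω}
  {spin : Ω → Fin n → Bool} {wt : Ω → Fin n → ℝ} {adj : Ω → Fin n → Fin n → Bool}

lemma core_bound [IsProbabilityMeasure P] (full loc : MeasurableSpace Ω) (h1 : loc ≤ full)
    (h2 : full ≤ mΩ) (X q : Ω → ℝ) (hX : Integrable X P) (hq : Measurable[loc] q)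
    (hqi : Integrable q P) (S : Set Ω) (hS : MeasurableSet[loc] S) (ε δ : ℝ) (hε : 0 < ε)
    (hδ : ∫ ω, |S.indicator (fun ω => (P[X|full]) ω - q ω) ω| ∂P ≤ δ) :
    (P {ω | ε < |(P[X|full]) ω - (P[X|loc]) ω|}).toReal ≤ 2 * δ / ε + (1 - (P S).toReal) := by
  have h12 : loc ≤ mΩ := h1.trans h2
  set d : Ω → ℝ := S.indicator (P[X|full] - q) with hd
  have hdi : Integrable d P := (integrable_condExp.sub hqi).indicator (h12 S hS)
  have e1 : P[d|loc] =ᵐ[P] S.indicator (P[X|loc] - q) := by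
    have a1 : P[d|loc] =ᵐ[P] S.indicator (P[P[X|full] - q|loc]) :=
      condExp_indicator (integrable_condExp.sub hqi) hS
    have a2 : P[P[X|full] - q|loc] =ᵐ[P] P[P[X|full]|loc] - P[q|loc] :=
      condExp_sub integrable_condExp hqi loc
    have a3 : P[P[X|full]|loc] =ᵐ[P] P[X|loc] := condExp_condExp_of_le h1 h2
    have a4 : P[q|loc] = q := condExp_of_stronglyMeasurable h12 hq.stronglyMeasurable hqi
    filter_upwards [a1, a2, a3] with ω b1 b2 b3
    rw [b1]
    by_cases hω : ω ∈ S
    · simp [hω, b2, b3, a4]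
    · simp [hω]
  have e2 : ∫ ω, |(P[d|loc]) ω| ∂P ≤ ∫ ω, |d ω| ∂P := integral_abs_condExp_le d
  have hsum : ∫ ω, (|d ω| + |(P[d|loc]) ω|) ∂P ≤ 2 * δ := by
    rw [integral_add hdi.abs integrable_condExp.abs]
    have : ∫ ω, |d ω| ∂P ≤ δ := hδ
    linarith
  have mk := mul_meas_ge_le_integral_of_nonneg (μ := P)
    (f := fun ω => |d ω| + |(P[d|loc]) ω|) (ae_of_all _ fun ω => by positivity)
    (hdi.abs.add integrable_condExp.abs) ε
  have sub : P {ω | ε < |(P[X|full]) ω - (P[X|loc]) ω|} ≤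
      P ({ω | ε ≤ |d ω| + |(P[d|loc]) ω|} ∪ Sᶜ) := by
    refine measure_mono_ae ?_
    filter_upwards [e1] with ω hω h
    have h' : ε < |(P[X|full]) ω - (P[X|loc]) ω| := h
    by_cases hS' : ω ∈ S
    · left
      change ε ≤ |d ω| + |(P[d|loc]) ω|
      rw [hω, hd]
      simp only [Set.indicator_of_mem hS', Pi.sub_apply]
      have := abs_sub_le ((P[X|full]) ω) (q ω) ((P[X|loc]) ω)
      rw [abs_sub_comm (q ω)] at this
      linarith
    · right; exact hS'
  have sub2 : (P {ω | ε < |(P[X|full]) ω - (P[X|loc]) ω|}).toReal ≤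
      P.real {ω | ε ≤ |d ω| + |(P[d|loc]) ω|} + P.real Sᶜ :=
    (ENNReal.toReal_mono (measure_ne_top _ _) sub).trans (measureReal_union_le _ _)
  have hc : P.real Sᶜ = 1 - (P S).toReal := by
    rw [probReal_compl_eq_one_sub (h12 S hS)]; rfl
  rw [hc] at sub2
  have : P.real {ω | ε ≤ |d ω| + |(P[d|loc]) ω|} ≤ 2 * δ / ε := by
    rw [le_div_iff₀ hε]; linarith
  linarith

lemma core {φmin φmax : ℝ} (ha : 0 < a) (hb : 0 < b) (hmin : 0 < φmin)
    [IsProbabilityMeasure ν] (hsupp : ∀ᵐ x ∂ν, x ∈ Set.Icc φmin φmax)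
    (hn0 : 0 < n) (hn : 2 * (φmax ^ 2 * (a + b)) ≤ n)
    (hM : IsDCPPM a b ν n P spin wt adj)
    (Ag Bg Cg : (Fin n → Fin n → Bool) → Set (Fin n))
    (hpart : ∀ g, Disjoint (Ag g) (Bg g) ∧ Disjoint (Ag g) (Cg g) ∧
          Disjoint (Bg g) (Cg g) ∧ Ag g ∪ Bg g ∪ Cg g = Set.univ)
    (u : Fin n) (hu : ∀ g, u ∈ Ag g)
    (hsep : ∀ g, ∀ v ∈ Ag g, ∀ w ∈ Cg g, g v w = false)
    {ε s t : ℝ} (hε : 0 < ε) (hs : 0 ≤ s) (ht : 0 < t) :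
    (P {ω | ε < |(P[(fun ω' => if spin ω' u = true then (1 : ℝ) else 0)|
                  infoFull spin wt adj (fun ω' => Bg (adj ω') ∪ Cg (adj ω'))]) ω -
                (P[(fun ω' => if spin ω' u = true then (1 : ℝ) else 0)|
                  infoLocal spin wt adj (fun ω' => Bg (adj ω'))
                    (fun ω' => Ag (adj ω') ∪ Bg (adj ω'))]) ω|}).toReal
      ≤ 2 * ((Real.exp (errE a b φmax n s t) - 1) + n * φmax ^ 2 / t ^ 2) / ε
        + (1 - (P {ω | ((Ag (adj ω) ∪ Bg (adj ω)).ncard : ℝ) ≤ s}).toReal) := by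
  classical
  have hP : IsProbabilityMeasure P := hM.1
  have hsm : Measurable spin := hM.2.1
  have hwm : Measurable wt := hM.2.2.1
  have ham : Measurable adj := hM.2.2.2.1
  have hsym := hM.2.2.2.2.1
  have hAS : ∀ g v, v ∈ Ag g ↔ v ∉ Bg g ∪ Cg g := by
    intro g v
    obtain ⟨d1, d2, _, hU⟩ := hpart g
    constructor
    · rintro hv (h | h)
      · exact Set.disjoint_left.1 d1 hv h
      · exact Set.disjoint_left.1 d2 hv h
    · intro h
      have : v ∈ Ag g ∪ Bg g ∪ Cg g := by rw [hU]; trivial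
      rcases this with (h' | h') | h'
      · exact h'
      · exact absurd (Or.inl h') h
      · exact absurd (Or.inr h') h
  have hVC : ∀ g v, v ∉ Ag g ∪ Bg g → v ∈ Cg g := by
    intro g v h
    have : v ∈ Ag g ∪ Bg g ∪ Cg g := by rw [(hpart g).2.2.2]; trivial
    exact this.resolve_left h
  -- measurability
  have hκm : ∀ k, MeasurableSet[mΩ] ((fun ω => (spin ω, adj ω)) ⁻¹' {k}) := fun k =>
    (hsm.prodMk ham) (measurableSet_singleton k)
  have hle : (infoFull spin wt adj (fun ω' => Bg (adj ω') ∪ Cg (adj ω'))) ≤ mΩ := by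
    refine sup_le (sup_le ?_ ham.comap_le) hwm.comap_le
    let _ : MeasurableSpace (Set (Fin n × Bool)) := ⊤
    have : Measurable (spinsOn spin (fun ω' => Bg (adj ω') ∪ Cg (adj ω'))) :=
      meas_fin mΩ (fun ω => (spin ω, adj ω)) hκm wt hwm
        (fun k _ => {p : Fin n × Bool | p.1 ∈ Bg k.2 ∪ Cg k.2 ∧ k.1 p.1 = p.2})
        (fun k => measurable_const)
    exact this.comap_le
  set κF : Ω → Set (Fin n × Bool) × (Fin n → Fin n → Bool) := fun ω =>
    (spinsOn spin (fun ω' => Bg (adj ω') ∪ Cg (adj ω')) ω, adj ω) with hκFdef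
  have hκF : ∀ k, MeasurableSet[(infoFull spin wt adj (fun ω' => Bg (adj ω') ∪ Cg (adj ω')))] (κF ⁻¹' {k}) := by
    rintro ⟨k1, k2⟩
    have e : κF ⁻¹' {(k1, k2)} = (spinsOn spin (fun ω' => Bg (adj ω') ∪ Cg (adj ω'))) ⁻¹' {k1}
        ∩ adj ⁻¹' {k2} := by
      ext ω; simp [κF]
    rw [e]
    refine MeasurableSet.inter ?_ ?_
    · refine (le_sup_left.trans le_sup_left : MeasurableSpace.comap
        (spinsOn spin (fun ω' => Bg (adj ω') ∪ Cg (adj ω'))) ⊤ ≤ (infoFull spin wt adj (fun ω' => Bg (adj ω') ∪ Cg (adj ω')))) _ ?_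
      exact ⟨{k1}, trivial, rfl⟩
    · refine (le_sup_right.trans le_sup_left : MeasurableSpace.comap adj inferInstance ≤ (infoFull spin wt adj (fun ω' => Bg (adj ω') ∪ Cg (adj ω')))) _ ?_
      exact ⟨{k2}, measurableSet_singleton k2, rfl⟩
  have hwF : Measurable[(infoFull spin wt adj (fun ω' => Bg (adj ω') ∪ Cg (adj ω')))] wt := by
    refine Measurable.of_comap_le ?_
    exact (le_sup_right : MeasurableSpace.comap wt inferInstance ≤ (infoFull spin wt adj (fun ω' => Bg (adj ω') ∪ Cg (adj ω'))))
  have hfm : Measurable[(infoFull spin wt adj (fun ω' => Bg (adj ω') ∪ Cg (adj ω')))] (fun ω => Ff a b n (Ag (adj ω)) (adj ω) (spin ω) (wt ω) u) := by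
    have h := meas_fin (infoFull spin wt adj (fun ω' => Bg (adj ω') ∪ Cg (adj ω'))) κF hκF wt hwF
      (fun k ψ => Ff a b n (Ag k.2) k.2 (spOf k.1) ψ u) (fun k => meas_Ff _ _ _ _ _ _ _)
    have e : (fun ω => Ff a b n (Ag (adj ω)) (adj ω) (spin ω) (wt ω) u)
        = fun ω => Ff a b n (Ag (κF ω).2) (κF ω).2 (spOf (κF ω).1) (wt ω) u := by
      funext ω
      have hm : ∀ ρ, mix (Ag (adj ω)) ρ (spin ω) = mix (Ag (adj ω)) ρ (spOf (κF ω).1) := by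
        intro ρ; funext v
        by_cases hv : v ∈ Ag (adj ω)
        · simp [mix, hv]
        · have hv' : v ∈ Bg (adj ω) ∪ Cg (adj ω) := by
            by_contra h'; exact hv ((hAS _ _).2 h')
          simp only [mix, hv, if_false]
          apply Bool.eq_iff_iff.2
          rw [spOf_eq]
          simp only [κF, spinsOn, Set.mem_ofPred_eq]
          tauto
      simp only [Ff, hm]
      rfl
    rw [e]; exact h
  have hloc_le : (infoLocal spin wt adj (fun ω' => Bg (adj ω')) (fun ω' => Ag (adj ω') ∪ Bg (adj ω'))) ≤ (infoFull spin wt adj (fun ω' => Bg (adj ω') ∪ Cg (adj ω'))) := by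
    refine sup_le (sup_le ?_ ?_) ?_
    · let _ : MeasurableSpace (Set (Fin n × Bool)) := ⊤
      have h : Measurable[(infoFull spin wt adj (fun ω' => Bg (adj ω') ∪ Cg (adj ω')))] (fun ω => {p : Fin n × Bool | p.1 ∈ Bg (κF ω).2 ∧ p ∈ (κF ω).1}) :=
        meas_fin (infoFull spin wt adj (fun ω' => Bg (adj ω') ∪ Cg (adj ω'))) κF hκF wt hwF
          (fun k _ => {p : Fin n × Bool | p.1 ∈ Bg k.2 ∧ p ∈ k.1}) (fun k => measurable_const)
      have e : spinsOn spin (fun ω' => Bg (adj ω'))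
          = (fun ω => {p : Fin n × Bool | p.1 ∈ Bg (κF ω).2 ∧ p ∈ (κF ω).1}) := by
        funext ω; ext p
        simp only [spinsOn, κF, Set.mem_ofPred_eq, Set.mem_union]
        tauto
      rw [e]; exact h.comap_le
    · let _ : MeasurableSpace (Set (Fin n) × Set (Fin n × Fin n)) := ⊤
      have h : Measurable[(infoFull spin wt adj (fun ω' => Bg (adj ω') ∪ Cg (adj ω')))] (graphOn adj (fun ω' => Ag (adj ω') ∪ Bg (adj ω'))) :=
        meas_fin (infoFull spin wt adj (fun ω' => Bg (adj ω') ∪ Cg (adj ω'))) κF hκF wt hwF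
          (fun k _ => (Ag k.2 ∪ Bg k.2, {q : Fin n × Fin n | q.1 ∈ Ag k.2 ∪ Bg k.2 ∧
            q.2 ∈ Ag k.2 ∪ Bg k.2 ∧ k.2 q.1 q.2 = true})) (fun k => measurable_const)
      exact h.comap_le
    · have h : Measurable[(infoFull spin wt adj (fun ω' => Bg (adj ω') ∪ Cg (adj ω')))] (wtOn wt (fun ω' => Ag (adj ω') ∪ Bg (adj ω'))) :=
        meas_fin (infoFull spin wt adj (fun ω' => Bg (adj ω') ∪ Cg (adj ω'))) κF hκF wt hwF
          (fun k ψ => wtOn (fun _ : Unit => ψ) (fun _ => Ag k.2 ∪ Bg k.2) ()) (fun k => by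
            unfold wtOn
            refine measurable_pi_lambda _ fun v => ?_
            split_ifs
            · exact measurable_pi_apply v
            · exact measurable_const)
      exact h.comap_le
  set κL : Ω → Set (Fin n × Bool) × (Set (Fin n) × Set (Fin n × Fin n)) := fun ω =>
    (spinsOn spin (fun ω' => Bg (adj ω')) ω,
      graphOn adj (fun ω' => Ag (adj ω') ∪ Bg (adj ω')) ω) with hκLdef
  have hκL : ∀ k, MeasurableSet[(infoLocal spin wt adj (fun ω' => Bg (adj ω')) (fun ω' => Ag (adj ω') ∪ Bg (adj ω')))] (κL ⁻¹' {k}) := by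
    rintro ⟨k1, k2⟩
    have e : κL ⁻¹' {(k1, k2)} = (spinsOn spin (fun ω' => Bg (adj ω'))) ⁻¹' {k1}
        ∩ (graphOn adj (fun ω' => Ag (adj ω') ∪ Bg (adj ω'))) ⁻¹' {k2} := by
      ext ω; simp [κL]
    rw [e]
    refine MeasurableSet.inter ?_ ?_
    · refine (le_sup_left.trans le_sup_left : MeasurableSpace.comap
        (spinsOn spin (fun ω' => Bg (adj ω'))) ⊤ ≤ (infoLocal spin wt adj (fun ω' => Bg (adj ω')) (fun ω' => Ag (adj ω') ∪ Bg (adj ω')))) _ ?_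
      exact ⟨{k1}, trivial, rfl⟩
    · refine (le_sup_right.trans le_sup_left : MeasurableSpace.comap
        (graphOn adj (fun ω' => Ag (adj ω') ∪ Bg (adj ω'))) ⊤ ≤ (infoLocal spin wt adj (fun ω' => Bg (adj ω')) (fun ω' => Ag (adj ω') ∪ Bg (adj ω')))) _ ?_
      exact ⟨{k2}, trivial, rfl⟩
  set wL := wtOn wt (fun ω' => Ag (adj ω') ∪ Bg (adj ω')) with hwLdef
  have hwL : Measurable[(infoLocal spin wt adj (fun ω' => Bg (adj ω')) (fun ω' => Ag (adj ω') ∪ Bg (adj ω')))] wL := by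
    refine Measurable.of_comap_le ?_
    exact (le_sup_right : MeasurableSpace.comap wL inferInstance ≤ (infoLocal spin wt adj (fun ω' => Bg (adj ω')) (fun ω' => Ag (adj ω') ∪ Bg (adj ω'))))
  set q : Ω → ℝ := fun ω =>
    Ff a b n (aOf (κL ω).1 (κL ω).2.1) (gOf (κL ω).2.2) (spOf (κL ω).1) (wL ω) u with hq
  have hqm : Measurable[(infoLocal spin wt adj (fun ω' => Bg (adj ω')) (fun ω' => Ag (adj ω') ∪ Bg (adj ω')))] q := meas_fin (infoLocal spin wt adj (fun ω' => Bg (adj ω')) (fun ω' => Ag (adj ω') ∪ Bg (adj ω'))) κL hκL wL hwL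
    (fun k ψ => Ff a b n (aOf k.1 k.2.1) (gOf k.2.2) (spOf k.1) ψ u)
    (fun k => meas_Ff _ _ _ _ _ _ _)
  set S : Set Ω := {ω | ((Ag (adj ω) ∪ Bg (adj ω)).ncard : ℝ) ≤ s} with hSdef
  have hSm : MeasurableSet[(infoLocal spin wt adj (fun ω' => Bg (adj ω')) (fun ω' => Ag (adj ω') ∪ Bg (adj ω')))] S := by
    have e : S = ⋃ k ∈ {k : Set (Fin n × Bool) × (Set (Fin n) × Set (Fin n × Fin n)) |
        (k.2.1.ncard : ℝ) ≤ s}, κL ⁻¹' {k} := by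
      ext ω; simp [S, κL, graphOn]
    rw [e]
    exact MeasurableSet.biUnion (Set.to_countable _) fun k _ => hκL k
  -- simplification of `q`
  have hqe : ∀ ω, q ω = Ff a b n (Ag (adj ω)) (gOf (κL ω).2.2) (spin ω) (wL ω) u := by
    intro ω
    have hA : aOf (κL ω).1 (κL ω).2.1 = Ag (adj ω) := by
      ext v
      have d1 : v ∈ Ag (adj ω) → v ∉ Bg (adj ω) :=
        fun h => Set.disjoint_left.1 (hpart (adj ω)).1 h
      simp only [aOf, κL, graphOn, spinsOn, Set.mem_ofPred_eq, Set.mem_union]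
      cases spin ω v <;> simp <;> tauto
    simp only [hq, hA]
    refine Ff_congr_loc (V := Ag (adj ω) ∪ Bg (adj ω)) ?_ ?_ ?_ u
    · intro i j h
      rw [gOf_eq] at h
      exact ⟨h.1, h.2.1⟩
    · intro v hv
      simp only [wL, wtOn]; rw [if_neg hv]
    · intro v hv hvA
      have hvB : v ∈ Bg (adj ω) := hv.resolve_left hvA
      apply Bool.eq_iff_iff.2
      rw [spOf_eq]
      simp only [κL, spinsOn, Set.mem_ofPred_eq]
      tauto
  have hgE : ∀ ω i j, gOf (κL ω).2.2 i j = true ↔ i ∈ Ag (adj ω) ∪ Bg (adj ω) ∧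
      j ∈ Ag (adj ω) ∪ Bg (adj ω) ∧ adj ω i j = true := by
    intro ω i j
    rw [gOf_eq]
    rfl
  have hw1 : ∀ ω, ∀ v ∈ Ag (adj ω) ∪ Bg (adj ω), wL ω v = wt ω v := by
    intro ω v hv; simp only [wL, wtOn]; rw [if_pos hv]
  have hw0 : ∀ ω, ∀ v ∉ Ag (adj ω) ∪ Bg (adj ω), wL ω v = 0 := by
    intro ω v hv; simp only [wL, wtOn]; rw [if_neg hv]
  have hr := ae_model hM (ae_range (n := n) hsupp)
  have hFb : ∀ᵐ ω ∂P, 0 ≤ Ff a b n (Ag (adj ω)) (adj ω) (spin ω) (wt ω) u ∧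
      Ff a b n (Ag (adj ω)) (adj ω) (spin ω) (wt ω) u ≤ 1 ∧ 0 ≤ q ω ∧ q ω ≤ 1 := by
    filter_upwards [hr] with ω hψ
    have c1 : ∀ τ, 0 < configDensity a b n (adj ω) τ (wt ω) := fun τ =>
      cd_pos ha hb hn0 hn τ (fun v => hmin.le.trans (hψ v).1) (fun v => (hψ v).2)
        (fun i j _ => ⟨hmin.trans_le (hψ i).1, hmin.trans_le (hψ j).1⟩)
    have hwb : ∀ v, 0 ≤ wL ω v ∧ wL ω v ≤ φmax := fun v => by
      by_cases hv : v ∈ Ag (adj ω) ∪ Bg (adj ω)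
      · rw [hw1 ω v hv]; exact ⟨hmin.le.trans (hψ v).1, (hψ v).2⟩
      · rw [hw0 ω v hv]
        exact ⟨le_rfl, hmin.le.trans ((hψ v).1.trans (hψ v).2)⟩
    have c2 : ∀ τ, 0 < configDensity a b n (gOf (κL ω).2.2) τ (wL ω) := fun τ =>
      cd_pos ha hb hn0 hn τ (fun v => (hwb v).1) (fun v => (hwb v).2) (fun i j h => by
        obtain ⟨hi, hj, _⟩ := (hgE ω i j).1 h
        rw [hw1 ω i hi, hw1 ω j hj]
        exact ⟨hmin.trans_le (hψ i).1, hmin.trans_le (hψ j).1⟩)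
    rw [hqe ω]
    exact ⟨Ff_nonneg c1 u, Ff_le_one c1 u, Ff_nonneg c2 u, Ff_le_one c2 u⟩
  have hqi : Integrable q P := by
    refine Integrable.of_bound (hqm.mono (hloc_le.trans hle) le_rfl).aestronglyMeasurable 1 ?_
    filter_upwards [hFb] with ω hω
    rw [Real.norm_eq_abs, abs_of_nonneg hω.2.2.1]; exact hω.2.2.2
  have hXm : Measurable (fun ω => if spin ω u = true then (1 : ℝ) else 0) :=
    meas_fin mΩ spin (fun k => hsm (measurableSet_singleton k)) wt hwm
      (fun τ _ => if τ u = true then (1 : ℝ) else 0) (fun τ => measurable_const)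
  have hXi : Integrable (fun ω => if spin ω u = true then (1 : ℝ) else 0) P := by
    refine Integrable.of_bound hXm.aestronglyMeasurable 1 (ae_of_all _ fun ω => ?_)
    split_ifs <;> simp
  have hcf := condFull ha hb hmin hsupp hn0 hn hM Ag (fun g => Bg g ∪ Cg g) hAS u hu hle hfm
  refine core_bound (infoFull spin wt adj (fun ω' => Bg (adj ω') ∪ Cg (adj ω'))) (infoLocal spin wt adj (fun ω' => Bg (adj ω')) (fun ω' => Ag (adj ω') ∪ Bg (adj ω'))) hloc_le hle _ q hXi hqm hqi S hSm ε _ hε ?_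
  set Bad : Set Ω := {ω | t < |∑ v, wt ω v * sg (spin ω v)|} with hBad
  have hBm : MeasurableSet Bad := by
    have : Measurable (fun ω => |∑ v, wt ω v * sg (spin ω v)|) :=
      meas_fin mΩ spin (fun k => hsm (measurableSet_singleton k)) wt hwm
        (fun τ ψ => |∑ v, ψ v * sg (τ v)|) (fun τ => by
          refine Measurable.abs ?_; fun_prop)
    exact measurableSet_lt measurable_const this
  have herr : 0 ≤ errE a b φmax n s t := by
    have hφ : 0 ≤ φmax := by
      obtain ⟨x, hx⟩ := hsupp.exists
      exact hmin.le.trans (hx.1.trans hx.2)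
    unfold errE; positivity
  have hex : 0 ≤ Real.exp (errE a b φmax n s t) - 1 := by
    have := Real.add_one_le_exp (errE a b φmax n s t); linarith
  have pt : ∀ᵐ ω ∂P, |S.indicator (fun ω => (P[(fun ω' => if spin ω' u = true then (1 : ℝ) else 0)|
      (infoFull spin wt adj (fun ω' => Bg (adj ω') ∪ Cg (adj ω')))]) ω - q ω) ω| ≤ (Real.exp (errE a b φmax n s t) - 1) + Bad.indicator 1 ω := by
    filter_upwards [hcf, hFb, hr] with ω h1 h2 h3
    by_cases hS' : ω ∈ S
    · rw [Set.indicator_of_mem hS', ← h1]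
      by_cases hB : ω ∈ Bad
      · rw [Set.indicator_of_mem hB]
        have : |Ff a b n (Ag (adj ω)) (adj ω) (spin ω) (wt ω) u - q ω| ≤ 1 :=
          abs_le.2 ⟨by linarith [h2.1, h2.2.2.2], by linarith [h2.2.1, h2.2.2.1]⟩
        simp only [Pi.one_apply]
        linarith
      · rw [Set.indicator_of_notMem hB, add_zero, hqe ω]
        exact compare ha hb hmin hn0 hn (hsym ω) Set.subset_union_left
          (fun i hi j hj => hsep _ i hi j (hVC _ _ hj)) (fun v => (h3 v).1) (fun v => (h3 v).2)
          (hgE ω) (hw1 ω) (hw0 ω) hS' (not_lt.1 hB) u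
    · rw [Set.indicator_of_notMem hS', abs_zero]
      have : 0 ≤ Bad.indicator (1 : Ω → ℝ) ω := Set.indicator_nonneg (fun _ _ => zero_le_one) ω
      linarith
  have hBi : Integrable (Bad.indicator (1 : Ω → ℝ)) P :=
    (integrable_const (1 : ℝ)).indicator hBm
  calc _ ≤ ∫ ω, ((Real.exp (errE a b φmax n s t) - 1) + Bad.indicator 1 ω) ∂P := by
        refine integral_mono_ae ?_ ((integrable_const _).add hBi) pt
        exact ((integrable_condExp.sub hqi).indicator (hle _ (hloc_le _ hSm))).abs
    _ = (Real.exp (errE a b φmax n s t) - 1) + P.real Bad := by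
        rw [integral_add (integrable_const _) hBi, integral_indicator_one hBm]; simp
    _ ≤ _ := by
        have := bad_bound ha hb hmin hsupp hn0 hn hM ht
        have h2 : P.real Bad ≤ n * φmax ^ 2 / t ^ 2 :=
          ENNReal.toReal_le_of_le_ofReal (by positivity) this
        linarith

end core

lemma small (a b φmax : ℝ) : Tendsto (fun n : ℕ =>
    (Real.exp (errE a b φmax n ((n:ℝ)^((1:ℝ)/8)) ((n:ℝ)^((3:ℝ)/4))) - 1)
      + n * φmax ^ 2 / ((n:ℝ)^((3:ℝ)/4)) ^ 2) atTop (𝓝 0) := by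
  have pw : ∀ r : ℝ, 0 < r → Tendsto (fun n : ℕ => (n:ℝ)^(-r)) atTop (𝓝 0) := fun r hr =>
    (tendsto_rpow_neg_atTop hr).comp tendsto_natCast_atTop_atTop
  have h1 : Tendsto (fun n : ℕ => errE a b φmax n ((n:ℝ)^((1:ℝ)/8)) ((n:ℝ)^((3:ℝ)/4)))
      atTop (𝓝 0) := by
    have h := (((pw (1/8) (by norm_num)).const_mul (2*(a+b)*φmax)).add
      ((pw (3/4) (by norm_num)).const_mul (2*(a+b)*φmax^2))).add
      ((pw (7/8) (by norm_num)).const_mul ((φmax^2*(a+b))^2))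
    simp only [mul_zero, add_zero] at h
    refine h.congr' ?_
    filter_upwards [eventually_gt_atTop 0] with n hn
    have hn' : (0:ℝ) < n := by exact_mod_cast hn
    have e1 : (n:ℝ)^(-(1/8):ℝ) = (n:ℝ)^((1:ℝ)/8) * (n:ℝ)^((3:ℝ)/4) / n := by
      rw [← Real.rpow_add hn', ← Real.rpow_sub_one hn'.ne']; norm_num
    have e2 : (n:ℝ)^(-(3/4):ℝ) = (n:ℝ)^((1:ℝ)/8) * (n:ℝ)^((1:ℝ)/8) / n := by
      rw [← Real.rpow_add hn', ← Real.rpow_sub_one hn'.ne']; norm_num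
    have e3 : (n:ℝ)^(-(7/8):ℝ) = (n:ℝ)^((1:ℝ)/8) / n := by
      rw [← Real.rpow_sub_one hn'.ne']; norm_num
    rw [e1, e2, e3, errE]
    field_simp
    try ring
  have h2 : Tendsto (fun n : ℕ => n * φmax ^ 2 / ((n:ℝ)^((3:ℝ)/4)) ^ 2) atTop (𝓝 0) := by
    have h := (pw (1/2) (by norm_num)).const_mul (φmax^2)
    rw [mul_zero] at h
    refine h.congr' ?_
    filter_upwards [eventually_gt_atTop 0] with n hn
    have hn' : (0:ℝ) < n := by exact_mod_cast hn
    have e1 : ((n:ℝ)^((3:ℝ)/4)) ^ 2 = n * (n:ℝ)^((1:ℝ)/2) := by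
      rw [← Real.rpow_natCast, ← Real.rpow_mul hn'.le, ← Real.rpow_one_add' hn'.le (by norm_num)]
      norm_num
    rw [e1, Real.rpow_neg hn'.le]
    have := Real.rpow_pos_of_pos hn' (1/2)
    field_simp
  have h3 := (((Real.continuous_exp.tendsto 0).comp h1).sub_const 1).add h2
  simpa using h3


end DCAux

/-- **Long-range correlations in the DC-PPM are weak.**
Let `G` be an instance of the DC-PPM on `n` vertices and `u` a uniformly chosen vertex.  Let
`A, B, C` be a (random, i.e. graph-dependent) partition of the vertex set with `u ∈ A` such
that `B` separates `A` and `C` in `G`.  If `|A ∪ B| ≤ n^{1/8}` with probability `1 - o_n(1)`,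
then `|P(σ_u = + | σ_{B∪C}, G, φ) - P(σ_u = + | σ_B, G_{A∪B}, φ_{A∪B})| = o_n(1)` with
probability `1 - o_n(1)`, the `o_n(1)` terms being uniform over all such partition rules:
quantitatively, for every `ε > 0` there is `N` such that for all `n ≥ N` and every partition
rule, the probability (averaged over the uniform vertex `u`) that the two conditional
probabilities differ by more than `ε` is at most `ε` plus the probability that the size
condition `|A ∪ B| ≤ n^{1/8}` fails. -/
theorem stmt12
    (a b φmin φmax : ℝ) (ha : 0 < a) (hb : 0 < b)
    (hφmin : 0 < φmin) (hφ : φmin ≤ φmax)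
    (ν : Measure ℝ) (hν : IsProbabilityMeasure ν)
    (hsupp : ∀ᵐ x ∂ν, x ∈ Set.Icc φmin φmax)
    (Ω : ℕ → Type) [mΩ : ∀ n, MeasurableSpace (Ω n)]
    (P : ∀ n, Measure (Ω n))
    (spin : ∀ n, Ω n → Fin n → Bool) (wt : ∀ n, Ω n → Fin n → ℝ)
    (adj : ∀ n, Ω n → Fin n → Fin n → Bool)
    (hmodel : ∀ᶠ n in atTop, IsDCPPM a b ν n (P n) (spin n) (wt n) (adj n)) :
    ∀ ε : ℝ, 0 < ε → ∃ N : ℕ, ∀ n : ℕ, N ≤ n →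
      ∀ Ar Br Cr : (Fin n → Fin n → Bool) → Fin n → Set (Fin n),
        (∀ g u, Disjoint (Ar g u) (Br g u) ∧ Disjoint (Ar g u) (Cr g u) ∧
          Disjoint (Br g u) (Cr g u) ∧ Ar g u ∪ Br g u ∪ Cr g u = Set.univ) →
        (∀ g u, u ∈ Ar g u) →
        (∀ g u, ∀ v ∈ Ar g u, ∀ w ∈ Cr g u, g v w = false) →
        (1 / (n : ℝ)) * ∑ u : Fin n,
            (P n {ω | ε <
              |((P n)[(fun ω' => if spin n ω' u = true then (1 : ℝ) else 0)|
                  infoFull (spin n) (wt n) (adj n)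
                    (fun ω' => Br (adj n ω') u ∪ Cr (adj n ω') u)]) ω -
                ((P n)[(fun ω' => if spin n ω' u = true then (1 : ℝ) else 0)|
                  infoLocal (spin n) (wt n) (adj n) (fun ω' => Br (adj n ω') u)
                    (fun ω' => Ar (adj n ω') u ∪ Br (adj n ω') u)]) ω|}).toReal
          ≤ ε + (1 / (n : ℝ)) * ∑ u : Fin n,
              (1 - (P n {ω |
                ((Ar (adj n ω) u ∪ Br (adj n ω) u).ncard : ℝ)
                  ≤ (n : ℝ) ^ ((1 : ℝ) / 8)}).toReal) := by
  intro ε hε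
  have hsm := (DCAux.small a b φmax).eventually (gt_mem_nhds (show (0:ℝ) < ε * ε / 2 by positivity))
  have hbig := tendsto_natCast_atTop_atTop.eventually_ge_atTop (2 * (φmax ^ 2 * (a + b)))
  obtain ⟨N, hN⟩ := eventually_atTop.1
    (((hmodel.and hsm).and hbig).and (eventually_gt_atTop 0))
  refine ⟨N, fun n hn Ar Br Cr hpart hu hsep => ?_⟩
  obtain ⟨⟨⟨hM, hs⟩, hb'⟩, hn0⟩ := hN n hn
  have hn' : (0:ℝ) < n := by exact_mod_cast hn0
  have hsmall : 2 * ((Real.exp (DCAux.errE a b φmax n ((n:ℝ)^((1:ℝ)/8)) ((n:ℝ)^((3:ℝ)/4))) - 1)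
      + n * φmax ^ 2 / ((n:ℝ)^((3:ℝ)/4)) ^ 2) / ε ≤ ε := by
    rw [div_le_iff₀ hε]; linarith
  have key := fun u : Fin n => (DCAux.core (Ω := Ω n) ha hb hφmin hsupp hn0 hb' hM
    (fun g => Ar g u) (fun g => Br g u) (fun g => Cr g u) (fun g => hpart g u) u
    (fun g => hu g u) (fun g => hsep g u) hε (Real.rpow_nonneg hn'.le ((1:ℝ)/8))
    (Real.rpow_pos_of_pos hn' ((3:ℝ)/4))).trans (add_le_add_left hsmall _)
  have hsum := Finset.sum_le_sum fun u (_ : u ∈ (Finset.univ : Finset (Fin n))) => key u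
  rw [Finset.sum_add_distrib, Finset.sum_const, Finset.card_univ, Fintype.card_fin,
    nsmul_eq_mul] at hsum
  refine (mul_le_mul_of_nonneg_left hsum (by positivity)).trans (le_of_eq ?_)
  rw [mul_add]
  congr 1
  field_simp
end
end
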